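/- Assume d₁ ≥ 2 and K := (n + 2 − max{dim V₁*, dim V₂*})/2^{d₁+d₂−2} > 7(d₁+d₂−1). Then for every integer d ≥ 1 the singular series 𝔖_d is absolutely convergent, and for every sufficiently small δ > 0 and every ε > 0 there is a constant (depending only on F, n, m, r, δ, ε) such that for all Q ≥ d sufficiently large: |𝔖_d − 𝔖_d(Q)| ≪ max{d^{d₁(r+1)/2^{d₁+d₂−2}+ε}, d}·Q^{−δ}. -/

import Mathlib

open MvPolynomial MeasureTheory
open scoped BigOperators ENNReal Classical

noncomputable section

namespace PaperTM

/-- Index type for the `n + 2` variables `(x₀,…,x_r, y_{r+1},…,y_m, z_{m+1},…,z_{n+1})`. -/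
abbrev Idx (n m r : ℕ) := Fin (r + 1) ⊕ (Fin (m - r) ⊕ Fin (n - m + 1))

/-- `e(t) = exp(2 π i t)`. -/
def eexp (t : ℝ) : ℂ := Complex.exp (2 * Real.pi * Complex.I * t)

variable {n m r : ℕ}

/-- Evaluation of `F` at a triple of vectors with entries in a commutative ring. -/
def evalF {R : Type} [CommRing R] (F : MvPolynomial (Idx n m r) ℤ)
    (x : Fin (r + 1) → R) (y : Fin (m - r) → R) (z : Fin (n - m + 1) → R) : R :=
  MvPolynomial.aeval (Sum.elim x (Sum.elim y z)) F

/-- `F` is bihomogeneous of bidegree `(d₁, d₂)`: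
`F(a𝐱, ab𝐲, b𝐳) = a^{d₁} b^{d₂} F(𝐱,𝐲,𝐳)` for all scalars `a, b`. -/
def Bihomogeneous (F : MvPolynomial (Idx n m r) ℤ) (d₁ d₂ : ℕ) : Prop :=
  ∀ (R : Type) [CommRing R], ∀ (a b : R) (x : Fin (r + 1) → R) (y : Fin (m - r) → R)
    (z : Fin (n - m + 1) → R),
    evalF F (fun i => a * x i) (fun j => a * b * y j) (fun k => b * z k) =
      a ^ d₁ * b ^ d₂ * evalF F x y z

/-- The partial derivative `∂F/∂t_i`, viewed as a polynomial with complex coefficients. -/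
def pderivC (F : MvPolynomial (Idx n m r) ℤ) (i : Idx n m r) :
    MvPolynomial (Idx n m r) ℂ :=
  MvPolynomial.map (Int.castRingHom ℂ) (MvPolynomial.pderiv i F)

/-- The ideal of `V₁* = {∂F/∂x_i = 0 (0 ≤ i ≤ r), ∂F/∂y_j = 0 (r+1 ≤ j ≤ m)}`. -/
def idealV1 (F : MvPolynomial (Idx n m r) ℤ) : Ideal (MvPolynomial (Idx n m r) ℂ) :=
  Ideal.span ((Set.range fun i : Fin (r + 1) => pderivC F (Sum.inl i)) ∪
    (Set.range fun j : Fin (m - r) => pderivC F (Sum.inr (Sum.inl j))))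

/-- The ideal of `V₂* = {∂F/∂y_j = 0 (r+1 ≤ j ≤ m), ∂F/∂z_k = 0 (m+1 ≤ k ≤ n+1)}`. -/
def idealV2 (F : MvPolynomial (Idx n m r) ℤ) : Ideal (MvPolynomial (Idx n m r) ℂ) :=
  Ideal.span ((Set.range fun j : Fin (m - r) => pderivC F (Sum.inr (Sum.inl j))) ∪
    (Set.range fun k : Fin (n - m + 1) => pderivC F (Sum.inr (Sum.inr k))))

/-- The dimension of the affine variety `V₁* ⊆ ℂ^{n+2}`. -/
def dimV1 (F : MvPolynomial (Idx n m r) ℤ) : WithBot ℕ∞ :=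
  ringKrullDim (MvPolynomial (Idx n m r) ℂ ⧸ idealV1 F)

/-- The dimension of the affine variety `V₂* ⊆ ℂ^{n+2}`. -/
def dimV2 (F : MvPolynomial (Idx n m r) ℤ) : WithBot ℕ∞ :=
  ringKrullDim (MvPolynomial (Idx n m r) ℂ ⧸ idealV2 F)

/-- The polynomial `F(𝐱, 𝐘, 𝐙)` with complex coefficients obtained from `F` by specializing
the variables `𝐱` to a fixed point of `ℂ^{r+1}`. -/
def subsX (x : Fin (r + 1) → ℂ) (p : MvPolynomial (Idx n m r) ℤ) :
    MvPolynomial (Fin (m - r) ⊕ Fin (n - m + 1)) ℂ :=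
  MvPolynomial.aeval (Sum.elim (fun i => MvPolynomial.C (x i))
    (Sum.elim (fun j => MvPolynomial.X (Sum.inl j)) (fun k => MvPolynomial.X (Sum.inr k)))) p

/-- Specialization of the variables `𝐳` to a fixed point of `ℂ^{n-m+1}`. -/
def subsZ (z : Fin (n - m + 1) → ℂ) (p : MvPolynomial (Idx n m r) ℤ) :
    MvPolynomial (Fin (r + 1) ⊕ Fin (m - r)) ℂ :=
  MvPolynomial.aeval (Sum.elim (fun i => MvPolynomial.X (Sum.inl i))
    (Sum.elim (fun j => MvPolynomial.X (Sum.inr j)) (fun k => MvPolynomial.C (z k)))) p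

/-- Dimension of `V₂,𝐱* = {(𝐲,𝐳) : ∂F/∂y_j(𝐱,𝐲,𝐳) = 0, ∂F/∂z_k(𝐱,𝐲,𝐳) = 0}`. -/
def dimV2x (F : MvPolynomial (Idx n m r) ℤ) (x : Fin (r + 1) → ℂ) : WithBot ℕ∞ :=
  ringKrullDim (MvPolynomial (Fin (m - r) ⊕ Fin (n - m + 1)) ℂ ⧸
    Ideal.span
      ((Set.range fun j : Fin (m - r) => subsX x (MvPolynomial.pderiv (Sum.inr (Sum.inl j)) F)) ∪
       (Set.range fun k : Fin (n - m + 1) => subsX x (MvPolynomial.pderiv (Sum.inr (Sum.inr k)) F))))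

/-- Dimension of `V₁,𝐳* = {(𝐱,𝐲) : ∂F/∂x_i(𝐱,𝐲,𝐳) = 0, ∂F/∂y_j(𝐱,𝐲,𝐳) = 0}`. -/
def dimV1z (F : MvPolynomial (Idx n m r) ℤ) (z : Fin (n - m + 1) → ℂ) : WithBot ℕ∞ :=
  ringKrullDim (MvPolynomial (Fin (r + 1) ⊕ Fin (m - r)) ℂ ⧸
    Ideal.span
      ((Set.range fun i : Fin (r + 1) => subsZ z (MvPolynomial.pderiv (Sum.inl i) F)) ∪
       (Set.range fun j : Fin (m - r) => subsZ z (MvPolynomial.pderiv (Sum.inr (Sum.inl j)) F))))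

/-- The set `A₂^λ = {𝐱 ∈ ℂ^{r+1} : dim V₂,𝐱* < dim V₂* − (r+1) + λ}`, where `D₂ = dim V₂*`;
the inequality is stated equivalently as `dim V₂,𝐱* + (r+1) < D₂ + λ`. -/
def A2set (F : MvPolynomial (Idx n m r) ℤ) (lam D₂ : ℕ) : Set (Fin (r + 1) → ℂ) :=
  {x | dimV2x F x + (((r + 1 : ℕ) : ℕ∞) : WithBot ℕ∞) < (((D₂ + lam : ℕ) : ℕ∞) : WithBot ℕ∞)}

/-- The set `A₁^μ = {𝐳 ∈ ℂ^{n-m+1} : dim V₁,𝐳* < dim V₁* − (n−m+1) + μ}`, where `D₁ = dim V₁*`. -/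
def A1set (F : MvPolynomial (Idx n m r) ℤ) (mu D₁ : ℕ) : Set (Fin (n - m + 1) → ℂ) :=
  {z | dimV1z F z + (((n - m + 1 : ℕ) : ℕ∞) : WithBot ℕ∞) < (((D₁ + mu : ℕ) : ℕ∞) : WithBot ℕ∞)}

/-- The exponential sum `S_d(α)`. -/
def Sd (F : MvPolynomial (Idx n m r) ℤ) (d : ℕ) (P₁ P₂ α : ℝ) : ℂ :=
  ∑' q : (Fin (r + 1) → ℤ) × (Fin (m - r) → ℤ) × (Fin (n - m + 1) → ℤ),
    if ‖q.1‖ ≤ P₁ ∧ ‖q.2.1‖ ≤ d * ‖q.1‖ * P₂ ∧ ‖q.2.2‖ ≤ P₂ then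
      eexp (α * (evalF F (fun i => (d : ℤ) * q.1 i) q.2.1 q.2.2 : ℤ))
    else 0

/-- The complete exponential sum `S_{a,q,d}`. -/
def Saqd (F : MvPolynomial (Idx n m r) ℤ) (d a q : ℕ) : ℂ :=
  ∑' b : (Fin (r + 1) → ZMod q) × (Fin (m - r) → ZMod q) × (Fin (n - m + 1) → ZMod q),
    eexp ((a : ℝ) / (q : ℝ) *
      ((evalF F (fun i => (d : ZMod q) * b.1 i) b.2.1 b.2.2).val : ℝ))

/-- The term `A_d(q) = q^{-(n+2)} ∑_{0 ≤ a < q, (a,q)=1} S_{a,q,d}` of the singular series. -/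
def Aq (F : MvPolynomial (Idx n m r) ℤ) (d q : ℕ) : ℂ :=
  (q : ℂ) ^ (-((n : ℤ) + 2)) *
    ∑ a ∈ (Finset.range q).filter fun a => Nat.gcd a q = 1, Saqd F d a q

/-- The singular series `𝔖_d`. -/
def singSeries (F : MvPolynomial (Idx n m r) ℤ) (d : ℕ) : ℂ := ∑' q : ℕ, Aq F d q

/-- The partial singular series `𝔖_d(Q)`. -/
def singSeriesPartial (F : MvPolynomial (Idx n m r) ℤ) (d Q : ℕ) : ℂ :=
  ∑ q ∈ Finset.Icc 1 Q, Aq F d q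

/-- The integral `I(β)` over the region `|𝐮| ≤ 1`, `|𝐯| ≤ |𝐮|`, `|𝐰| ≤ 1`. -/
def Ibeta (F : MvPolynomial (Idx n m r) ℤ) (β : ℝ) : ℂ :=
  ∫ p : (Fin (r + 1) → ℝ) × (Fin (m - r) → ℝ) × (Fin (n - m + 1) → ℝ),
    if ‖p.1‖ ≤ 1 ∧ ‖p.2.1‖ ≤ ‖p.1‖ ∧ ‖p.2.2‖ ≤ 1 then
      eexp (β * evalF F p.1 p.2.1 p.2.2)
    else 0

/-- The truncated singular integral `J(φ) = ∫_{|β| ≤ φ} I(β) dβ`. -/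
def Jphi (F : MvPolynomial (Idx n m r) ℤ) (φ : ℝ) : ℂ :=
  ∫ β in Set.Icc (-φ) φ, Ibeta F β

/-- The singular integral `J = ∫_ℝ I(β) dβ`. -/
def Jint (F : MvPolynomial (Idx n m r) ℤ) : ℂ := ∫ β : ℝ, Ibeta F β

/-- The constant `σ_d = d^{m-r-d₁} 𝔖_d J`. -/
def sigmaD (F : MvPolynomial (Idx n m r) ℤ) (d₁ d : ℕ) : ℂ :=
  (d : ℂ) ^ ((m : ℤ) - r - d₁) * singSeries F d * Jint F

/-- `S_{a,q,d}(𝐱)`, the complete exponential sum with `𝐱` fixed. -/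
def SaqdX (F : MvPolynomial (Idx n m r) ℤ) (d : ℕ) (x : Fin (r + 1) → ℤ) (a q : ℕ) : ℂ :=
  ∑' b : (Fin (m - r) → ZMod q) × (Fin (n - m + 1) → ZMod q),
    eexp ((a : ℝ) / (q : ℝ) *
      ((evalF F (fun i => ((d * x i : ℤ) : ZMod q)) b.1 b.2).val : ℝ))

/-- The singular series `𝔖_{d,𝐱} = ∑_q q^{-(n-r+1)} ∑_{(a,q)=1} S_{a,q,d}(𝐱)`. -/
def singSeriesX (F : MvPolynomial (Idx n m r) ℤ) (d : ℕ) (x : Fin (r + 1) → ℤ) : ℂ :=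
  ∑' q : ℕ, (q : ℂ) ^ (-((n : ℤ) - r + 1)) *
    ∑ a ∈ (Finset.range q).filter fun a => Nat.gcd a q = 1, SaqdX F d x a q

/-- `I_𝐱(β) = ∫_{[-1,1]^{m-r} × [-1,1]^{n-m+1}} e(β F(𝐱, k𝐯, 𝐰)) d𝐯 d𝐰` with `k = |𝐱|`. -/
def IbetaX (F : MvPolynomial (Idx n m r) ℤ) (x : Fin (r + 1) → ℤ) (β : ℝ) : ℂ :=
  ∫ p : (Fin (m - r) → ℝ) × (Fin (n - m + 1) → ℝ),
    if ‖p.1‖ ≤ 1 ∧ ‖p.2‖ ≤ 1 then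
      eexp (β * evalF F (fun i => (x i : ℝ)) (fun j => ‖x‖ * p.1 j) p.2)
    else 0

/-- `J_{d,𝐱} = ∫_ℝ I_𝐱(d^{d₁} β) dβ`. -/
def JdX (F : MvPolynomial (Idx n m r) ℤ) (d₁ d : ℕ) (x : Fin (r + 1) → ℤ) : ℂ :=
  ∫ β : ℝ, IbetaX F x ((d : ℝ) ^ d₁ * β)

/-- `S_{a,q,d}(𝐳)`, the complete exponential sum with `𝐳` fixed. -/
def SaqdZ (F : MvPolynomial (Idx n m r) ℤ) (d : ℕ) (z : Fin (n - m + 1) → ℤ) (a q : ℕ) : ℂ :=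
  ∑' b : (Fin (r + 1) → ZMod q) × (Fin (m - r) → ZMod q),
    eexp ((a : ℝ) / (q : ℝ) *
      ((evalF F (fun i => (d : ZMod q) * b.1 i) b.2 (fun k => ((z k : ℤ) : ZMod q))).val : ℝ))

/-- The singular series `𝔖_{d,𝐳} = ∑_q q^{-(m+1)} ∑_{(a,q)=1} S_{a,q,d}(𝐳)`. -/
def singSeriesZ (F : MvPolynomial (Idx n m r) ℤ) (d : ℕ) (z : Fin (n - m + 1) → ℤ) : ℂ :=
  ∑' q : ℕ, (q : ℂ) ^ (-((m : ℤ) + 1)) *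
    ∑ a ∈ (Finset.range q).filter fun a => Nat.gcd a q = 1, SaqdZ F d z a q

/-- `I_𝐳(β) = ∫_{(𝐮,𝐯) ∈ [-1,1]^{r+1} × [-1,1]^{m-r}, |𝐯| < |𝐮|} e(β F(𝐮, l𝐯, 𝐳)) d𝐮 d𝐯`
with `l = |𝐳|`. -/
def IbetaZ (F : MvPolynomial (Idx n m r) ℤ) (z : Fin (n - m + 1) → ℤ) (β : ℝ) : ℂ :=
  ∫ p : (Fin (r + 1) → ℝ) × (Fin (m - r) → ℝ),
    if ‖p.1‖ ≤ 1 ∧ ‖p.2‖ ≤ 1 ∧ ‖p.2‖ < ‖p.1‖ then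
      eexp (β * evalF F p.1 (fun j => ‖z‖ * p.2 j) (fun k => (z k : ℝ)))
    else 0

/-- `J_𝐳 = ∫_ℝ I_𝐳(β) dβ`. -/
def JZ (F : MvPolynomial (Idx n m r) ℤ) (z : Fin (n - m + 1) → ℤ) : ℂ :=
  ∫ β : ℝ, IbetaZ F z β

/-- The major arcs `𝔐^{(1)}(θ)` (with `dt = d̃ = d₁ + d₂ - 2`). -/
def majorArc1 (d d₁ dt : ℕ) (P θ : ℝ) : Set ℝ :=
  {α | α ∈ Set.Icc (0 : ℝ) 1 ∧ ∃ q a : ℕ, 0 < q ∧ d ∣ q ∧ a < q ∧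
    (q : ℝ) ≤ d * P ^ (((dt : ℝ) + 1) * θ) ∧
    |α * q - a| ≤ ((d : ℝ) ^ (d₁ - 1))⁻¹ * P ^ (-1 + ((dt : ℝ) + 1) * θ)}

/-- The major arcs `𝔐^{(2)}(θ)`. -/
def majorArc2 (d d₁ dt : ℕ) (P θ : ℝ) : Set ℝ :=
  {α | α ∈ Set.Icc (0 : ℝ) 1 ∧ ∃ q a : ℕ, 0 < q ∧ a < q ∧ Nat.gcd a q = 1 ∧
    (q : ℝ) ≤ P ^ (((dt : ℝ) + 1) * θ) ∧
    |α * q - a| ≤ ((d : ℝ) ^ d₁)⁻¹ * P ^ (-1 + ((dt : ℝ) + 1) * θ)}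

/-- The minor arcs `𝔪(θ) = [0,1) \ (𝔐^{(1)}(θ) ∪ 𝔐^{(2)}(θ))`. -/
def minorArcs (d d₁ dt : ℕ) (P θ : ℝ) : Set ℝ :=
  Set.Ico (0 : ℝ) 1 \ (majorArc1 d d₁ dt P θ ∪ majorArc2 d d₁ dt P θ)

section HilbertFunction

lemma restrictTotalDegree_le_of_mul_X {R σ : Type*} [CommRing R]
    {W : ℕ → Submodule R (MvPolynomial σ R)}
    (h0 : 1 ∈ W 0) (hmono : ∀ s, W s ≤ W (s + 1))
    (hX : ∀ s v, ∀ f ∈ W s, X v * f ∈ W (s + 1)) (s : ℕ) :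
    restrictTotalDegree σ R s ≤ W s := by
  have h1 : ∀ s, (1 : MvPolynomial σ R) ∈ W s := fun s => by
    induction s with
    | zero => exact h0
    | succ s ih => exact hmono s ih
  have key : ∀ s, ∀ d : σ →₀ ℕ, d.degree ≤ s → monomial d (1 : R) ∈ W s := by
    intro s
    induction s with
    | zero =>
      intro d hd
      have : d = 0 := by
        rw [← Finsupp.degree_eq_zero_iff]; omega
      subst this
      exact h1 0
    | succ s ih =>
      intro d hd
      by_cases h : d = 0
      · subst h; exact h1 _
      obtain ⟨v, hv⟩ : ∃ v, d v ≠ 0 := by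
        by_contra! hc
        exact h (Finsupp.ext hc)
      have hle : Finsupp.single v 1 ≤ d := by
        rw [Finsupp.single_le_iff]; omega
      have hd' : Finsupp.single v 1 + (d - Finsupp.single v 1) = d := add_tsub_cancel_of_le hle
      have : monomial d (1 : R) = X v * monomial (d - Finsupp.single v 1) 1 := by
        rw [X, monomial_mul, hd', mul_one]
      rw [this]
      refine hX s v _ (ih _ ?_)
      have := congrArg Finsupp.degree hd'
      rw [map_add, Finsupp.degree_single] at this
      omega
  intro f hf
  rw [mem_restrictTotalDegree] at hf
  rw [f.as_sum]
  refine Submodule.sum_mem _ fun d hd => ?_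
  have : monomial d (coeff d f) = (coeff d f) • monomial d (1 : R) := by
    rw [smul_monomial, smul_eq_mul, mul_one]
  rw [this]
  refine Submodule.smul_mem _ _ (key s d ?_)
  exact (le_totalDegree hd).trans hf

variable {k : Type*} [Field k]

lemma finrank_restrictTotalDegree_le {σ : Type*} [Fintype σ] (s : ℕ) :
    Module.finrank k (restrictTotalDegree σ k s) ≤ (s + 1) ^ Fintype.card σ := by
  let e : (σ → Fin (s + 1)) → MvPolynomial σ k := fun a =>
    monomial (Finsupp.equivFunOnFinite.symm fun i => (a i : ℕ)) 1
  have hle : restrictTotalDegree σ k s ≤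
      Submodule.span k ((Finset.univ.image e : Finset (MvPolynomial σ k)) : Set _) := by
    intro f hf
    rw [mem_restrictTotalDegree] at hf
    rw [f.as_sum]
    refine Submodule.sum_mem _ fun d hd => ?_
    have : monomial d (coeff d f) = (coeff d f) • monomial d (1 : k) := by
      rw [smul_monomial, smul_eq_mul, mul_one]
    rw [this]
    refine Submodule.smul_mem _ _ (Submodule.subset_span ?_)
    have hdeg : d.degree ≤ s := (le_totalDegree hd).trans hf
    simp only [Finset.coe_image, Finset.coe_univ, Set.image_univ, Set.mem_range]
    refine ⟨fun i => ⟨d i, ?_⟩, ?_⟩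
    · have := Finsupp.le_degree i d
      omega
    · simp only [e]
      congr 1
      ext i
      simp
  refine (Submodule.finrank_mono hle).trans ((finrank_span_finset_le_card _).trans ?_)
  refine Finset.card_image_le.trans ?_
  simp

lemma ringKrullDim_le_of_isIntegral_of_injective {R S : Type*} [CommRing R] [CommRing S]
    [Algebra R S] [Algebra.IsIntegral R S] (hinj : Function.Injective (algebraMap R S)) :
    ringKrullDim R ≤ ringKrullDim S := by
  refine iSup_le fun l => ?_
  obtain ⟨P, -, hP, hPl⟩ := Ideal.exists_ideal_over_prime_of_isIntegral (S := S)
    l.head.asIdeal ⊥ (by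
      rw [← RingHom.ker_eq_comap_bot, (RingHom.injective_iff_ker_eq_bot _).1 hinj]; exact bot_le)
  have : P.LiesOver l.head.asIdeal := ⟨hPl.symm⟩
  obtain ⟨l', hlen, -, -⟩ := Ideal.exists_ltSeries_of_hasGoingUp l P
  rw [← hlen]
  exact le_iSup (fun p : LTSeries (PrimeSpectrum S) => ((p.length : ℕ∞) : WithBot ℕ∞)) l'

lemma exists_finrank_map_restrictTotalDegree_le_of_finite {τ : Type*} {A : Type*} [CommRing A]
    [Algebra k A] (π : MvPolynomial τ k →ₐ[k] A) {δ M : ℕ} (g : MvPolynomial (Fin δ) k →ₐ[k] A)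
    (w : Fin M → A) (hw : ∀ a, ∃ c : Fin M → MvPolynomial (Fin δ) k, a = ∑ j, g (c j) * w j)
    [Fintype τ] :
    ∃ C : ℕ, ∀ s : ℕ, Module.finrank k
      ((restrictTotalDegree τ k s).map π.toLinearMap) ≤ C * (s + 1) ^ δ := by
  choose cf hcf using hw
  obtain ⟨E, hE⟩ := Finite.exists_le fun p : τ × Fin M × Fin M =>
    (cf (π (X p.1) * w p.2.1) p.2.2).totalDegree
  obtain ⟨E₀, hE₀⟩ := Finite.exists_le fun j : Fin M => (cf 1 j).totalDegree
  let Φ : (Fin M → MvPolynomial (Fin δ) k) →ₗ[k] A :=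
    { toFun := fun c => ∑ j, g (c j) * w j
      map_add' := fun a b => by simp [add_mul, Finset.sum_add_distrib]
      map_smul' := fun r a => by simp [Finset.smul_sum] }
  obtain ⟨Ψ, hΨ⟩ : ∃ Ψ : ∀ t : ℕ, (Fin M → restrictTotalDegree (Fin δ) k t) →ₗ[k] A,
      ∀ t a, a ∈ LinearMap.range (Ψ t) ↔ ∃ c : Fin M → MvPolynomial (Fin δ) k,
      (∀ j, (c j).totalDegree ≤ t) ∧ a = ∑ j, g (c j) * w j := by
    refine ⟨fun t => Φ ∘ₗ LinearMap.pi fun j => (Submodule.subtype _) ∘ₗ LinearMap.proj j,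
      fun t a => ⟨?_, ?_⟩⟩
    · rintro ⟨c, rfl⟩
      exact ⟨fun j => c j, fun j => (mem_restrictTotalDegree _ _ _).1 (c j).2, rfl⟩
    · rintro ⟨c, hc, rfl⟩
      exact ⟨fun j => ⟨c j, (mem_restrictTotalDegree _ _ _).2 (hc j)⟩, rfl⟩
  have hW : ∀ s, restrictTotalDegree τ k s ≤
      (LinearMap.range (Ψ (E * s + E₀))).comap π.toLinearMap := by
    refine restrictTotalDegree_le_of_mul_X ?_ ?_ ?_
    · rw [Submodule.mem_comap, hΨ]
      refine ⟨cf 1, fun j => by simpa using hE₀ j, ?_⟩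
      rw [← hcf]
      exact map_one π
    · intro s f hf
      rw [Submodule.mem_comap, hΨ] at hf ⊢
      obtain ⟨c, hc, h⟩ := hf
      exact ⟨c, fun j => (hc j).trans (by gcongr; omega), h⟩
    · intro s v f hf
      rw [Submodule.mem_comap, hΨ] at hf ⊢
      obtain ⟨c, hc, h⟩ := hf
      refine ⟨fun j => ∑ i, c i * cf (π (X v) * w i) j, fun j => ?_, ?_⟩
      · refine totalDegree_finsetSum_le fun i _ => (totalDegree_mul _ _).trans ?_
        have := hc i
        have := hE (v, i, j)
        nlinarith
      · have h1 : π.toLinearMap (X v * f) = π (X v) * π.toLinearMap f := map_mul π _ _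
        rw [h1, h, Finset.mul_sum]
        simp only [map_sum, map_mul, Finset.sum_mul]
        rw [Finset.sum_comm]
        refine Finset.sum_congr rfl fun i _ => ?_
        have h2 : π (X v) * (g (c i) * w i) = g (c i) * (π (X v) * w i) := by ring
        rw [h2, hcf (π (X v) * w i), Finset.mul_sum]
        refine Finset.sum_congr rfl fun j _ => ?_
        rw [← hcf]
        ring
  refine ⟨M * (E + E₀ + 1) ^ δ, fun s => ?_⟩
  have h1 : Module.finrank k ((restrictTotalDegree τ k s).map π.toLinearMap) ≤
      Module.finrank k (LinearMap.range (Ψ (E * s + E₀))) :=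
    Submodule.finrank_mono (Submodule.map_le_iff_le_comap.2 (hW s))
  refine h1.trans ((LinearMap.finrank_range_le _).trans ?_)
  rw [Module.finrank_pi_fintype, Finset.sum_const, Finset.card_univ, Fintype.card_fin,
    smul_eq_mul, mul_assoc, ← mul_pow]
  refine Nat.mul_le_mul_left _ ((finrank_restrictTotalDegree_le _).trans ?_)
  rw [Fintype.card_fin]
  exact Nat.pow_le_pow_left (by nlinarith [Nat.zero_le E₀, Nat.zero_le s]) _

/-- The Hilbert function of an affine algebra grows at most like a polynomial whose degree is the
Krull dimension. -/
theorem exists_finrank_map_restrictTotalDegree_le {τ : Type*} [Fintype τ]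
    {A : Type*} [CommRing A] [Algebra k A] [Algebra.FiniteType k A]
    (π : MvPolynomial τ k →ₐ[k] A) (D : ℕ) (hD : ringKrullDim A = ((D : ℕ∞) : WithBot ℕ∞)) :
    ∃ C : ℕ, ∀ s : ℕ, Module.finrank k
      ((restrictTotalDegree τ k s).map π.toLinearMap) ≤ C * (s + 1) ^ D := by
  have : Nontrivial A := by
    by_contra h
    rw [not_nontrivial_iff_subsingleton] at h
    rw [ringKrullDim_eq_bot_of_subsingleton] at hD
    exact WithBot.bot_ne_coe hD
  obtain ⟨δ, g, ginj, gfin⟩ := exists_finite_inj_algHom_of_fg k A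
  have hδ : δ ≤ D := by
    algebraize [g.toRingHom]
    have : Module.Finite (MvPolynomial (Fin δ) k) A := gfin
    have : Algebra.IsIntegral (MvPolynomial (Fin δ) k) A := Algebra.IsIntegral.of_finite _ _
    have h := ringKrullDim_le_of_isIntegral_of_injective (R := MvPolynomial (Fin δ) k)
      (S := A) ginj
    rw [hD, MvPolynomial.ringKrullDim_of_isNoetherianRing, ringKrullDim_eq_zero_of_field,
      zero_add, Nat.card_eq_fintype_card, Fintype.card_fin] at h
    exact_mod_cast h
  obtain ⟨M, w, hw⟩ : ∃ M : ℕ, ∃ w : Fin M → A,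
      ∀ a, ∃ c : Fin M → MvPolynomial (Fin δ) k, a = ∑ j, g (c j) * w j := by
    algebraize [g.toRingHom]
    have : Module.Finite (MvPolynomial (Fin δ) k) A := gfin
    obtain ⟨M, w, hw⟩ := Module.Finite.exists_fin (R := MvPolynomial (Fin δ) k)
      (M := A)
    refine ⟨M, w, fun a => ?_⟩
    have ha : a ∈ Submodule.span (MvPolynomial (Fin δ) k) (Set.range w) := by rw [hw]; trivial
    obtain ⟨c, hc⟩ := (Submodule.mem_span_range_iff_exists_fun _).1 ha
    refine ⟨c, hc.symm.trans (Finset.sum_congr rfl fun j _ => ?_)⟩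
    rw [Algebra.smul_def]
    rfl
  obtain ⟨C, hC⟩ := exists_finrank_map_restrictTotalDegree_le_of_finite π g w hw
  exact ⟨C, fun s => (hC s).trans (by gcongr; omega)⟩

end HilbertFunction

section PointCount

variable {k : Type*} [Field k]

lemma exists_finset_span_add_mem {τ : Type*} [Fintype τ] (I : Ideal (MvPolynomial τ k)) (D : ℕ)
    (hD : ringKrullDim (MvPolynomial τ k ⧸ I) = ((D : ℕ∞) : WithBot ℕ∞)) :
    ∃ C : ℕ, ∃ b : ℕ → Finset (MvPolynomial τ k), ∀ s, (b s).card ≤ C * (s + 1) ^ D ∧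
      ∀ f : MvPolynomial τ k, f.totalDegree ≤ s →
        ∃ v ∈ Submodule.span k (b s : Set (MvPolynomial τ k)), v.totalDegree ≤ s ∧ f - v ∈ I := by
  obtain ⟨C, hC⟩ := exists_finrank_map_restrictTotalDegree_le (Ideal.Quotient.mkₐ k I) D hD
  have key : ∀ s : ℕ, ∃ b : Finset (MvPolynomial τ k), b.card ≤ C * (s + 1) ^ D ∧
      ∀ f : MvPolynomial τ k, f.totalDegree ≤ s →
        ∃ v ∈ Submodule.span k (b : Set (MvPolynomial τ k)), v.totalDegree ≤ s ∧ f - v ∈ I := by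
    intro s
    set V := (restrictTotalDegree τ k s).map (Ideal.Quotient.mkₐ k I).toLinearMap with hV
    let B := Module.finBasis k V
    have hB : ∀ i, ∃ p ∈ restrictTotalDegree τ k s, Ideal.Quotient.mkₐ k I p = B i := fun i => by
      have := (B i).2
      exact (Submodule.mem_map (f := (Ideal.Quotient.mkₐ k I).toLinearMap)).1 this
    choose p hp hpB using hB
    refine ⟨Finset.univ.image p, Finset.card_image_le.trans ?_, fun f hf => ?_⟩
    · rw [Finset.card_univ, Fintype.card_fin]
      exact hC s
    · have hfV : Ideal.Quotient.mkₐ k I f ∈ V := by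
        rw [hV]
        exact Submodule.mem_map_of_mem (f := (Ideal.Quotient.mkₐ k I).toLinearMap)
          ((mem_restrictTotalDegree _ _ _).2 hf)
      refine ⟨∑ i, B.repr ⟨_, hfV⟩ i • p i, Submodule.sum_mem _ fun i _ =>
        Submodule.smul_mem _ _ (Submodule.subset_span (by simp)), ?_, ?_⟩
      · rw [← mem_restrictTotalDegree]
        exact Submodule.sum_mem _ fun i _ => Submodule.smul_mem _ _ (hp i)
      · rw [← Ideal.Quotient.eq_zero_iff_mem]
        have h1 := congrArg Subtype.val (B.sum_repr ⟨_, hfV⟩)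
        simp only [Submodule.coe_sum, Submodule.coe_smul] at h1
        have h2 : Ideal.Quotient.mkₐ k I (f - ∑ i, B.repr ⟨_, hfV⟩ i • p i) = 0 := by
          rw [map_sub, map_sum, sub_eq_zero]
          simp only [map_smul, hpB]
          exact h1.symm
        exact h2
  choose b hb using key
  exact ⟨C, b, hb⟩

/-- Polynomials of total degree smaller than `s`. -/
def lowDegree (σ k : Type*) [Field k] : ℕ → Submodule k (MvPolynomial σ k)
  | 0 => ⊥
  | s + 1 => restrictTotalDegree σ k s

lemma mul_mem_lowDegree {σ : Type*} {s t : ℕ} {p q : MvPolynomial σ k} (hp : p.totalDegree ≤ t)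
    (hq : q ∈ lowDegree σ k s) : p * q ∈ lowDegree σ k (t + s) := by
  cases s with
  | zero =>
    have : q = 0 := hq
    rw [this, mul_zero]
    exact Submodule.zero_mem _
  | succ s =>
    have hq' := (mem_restrictTotalDegree _ _ _).1 hq
    refine (mem_restrictTotalDegree _ _ _).2 ((totalDegree_mul _ _).trans ?_)
    change _ ≤ t + s
    omega

lemma lowDegree_mono {σ : Type*} {s t : ℕ} (h : s ≤ t) : lowDegree σ k s ≤ lowDegree σ k t := by
  intro p hp
  cases s with
  | zero =>
    have : p = 0 := hp
    rw [this]
    exact Submodule.zero_mem _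
  | succ s =>
    obtain ⟨t, rfl⟩ := Nat.exists_eq_succ_of_ne_zero (show t ≠ 0 by omega)
    have hp' := (mem_restrictTotalDegree _ _ _).1 hp
    exact (mem_restrictTotalDegree _ _ _).2 (by omega)

lemma mem_span_of_totalDegree_le {τ γ : Type*} (G : γ → MvPolynomial τ k) (e : γ → ℕ)
    (hG : ∀ j, (G j).IsHomogeneous (e j)) {s : ℕ} {f : MvPolynomial τ k}
    (hf : f ∈ Ideal.span (Set.range G)) (hs : f.totalDegree ≤ s) :
    f ∈ Submodule.span k {p | ∃ r j, p = r * G j ∧ r.totalDegree + e j ≤ s} := by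
  set T := Submodule.span k {p | ∃ r j, p = r * G j ∧ r.totalDegree + e j ≤ s} with hT
  let tr : MvPolynomial τ k →ₗ[k] MvPolynomial τ k :=
    ∑ i ∈ Finset.range (s + 1), homogeneousComponent i
  have htr : ∀ p, tr p = ∑ i ∈ Finset.range (s + 1), homogeneousComponent i p := fun p => by
    simp [tr]
  have hmono : ∀ d c j, tr (monomial d c * G j) ∈ T := by
    intro d c j
    have hh : (monomial d c * G j).IsHomogeneous (d.degree + e j) :=
      (isHomogeneous_monomial c rfl).mul (hG j)
    rw [htr]
    refine Submodule.sum_mem _ fun i hi => ?_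
    rw [homogeneousComponent_of_mem hh]
    split_ifs with h
    · refine Submodule.subset_span ⟨_, j, rfl, ?_⟩
      have : (monomial d c).totalDegree ≤ d.degree := totalDegree_monomial_le d c
      have := Finset.mem_range.1 hi
      omega
    · exact Submodule.zero_mem _
  have hmul : ∀ p j, tr (p * G j) ∈ T := by
    intro p j
    conv => rw [p.as_sum, Finset.sum_mul, map_sum]
    exact Submodule.sum_mem _ fun d _ => hmono d _ j
  have hall : ∀ r, tr (r * f) ∈ T := by
    clear hs
    induction hf using Submodule.span_induction with
    | mem x hx =>
      obtain ⟨j, rfl⟩ := hx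
      exact fun r => hmul r j
    | zero => intro r; rw [mul_zero, map_zero]; exact Submodule.zero_mem _
    | add x y _ _ hx hy =>
      intro r
      rw [mul_add, map_add]
      exact Submodule.add_mem _ (hx r) (hy r)
    | smul a x _ hx =>
      intro r
      rw [smul_eq_mul, ← mul_assoc]
      exact hx _
  have h1 := hall 1
  rw [one_mul, htr] at h1
  have h2 : ∑ i ∈ Finset.range (s + 1), homogeneousComponent i f = f := by
    ext d
    rw [coeff_sum]
    simp only [coeff_homogeneousComponent, Finset.sum_ite_eq, Finset.mem_range]
    split_ifs with h
    · rfl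
    · by_contra hne
      have := le_totalDegree (mem_support_iff.2 (Ne.symm hne))
      have h3 : d.degree = d.sum fun _ e => e := rfl
      omega
  rwa [h2] at h1

section Specialization

variable {τ σ : Type*}

/-- The substitution identifying the variables indexed by `σ` with variables indexed by `τ`. -/
def specialize (k : Type*) [CommRing k] (ϖ : σ → τ) :
    MvPolynomial (τ ⊕ σ) k →ₐ[k] MvPolynomial τ k :=
  rename (Sum.elim id ϖ)

lemma exists_eq_rename_specialize_add [Fintype σ] (ϖ : σ → τ) {s : ℕ}
    {f : MvPolynomial (τ ⊕ σ) k} (hf : f.totalDegree ≤ s) :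
    ∃ q : σ → MvPolynomial (τ ⊕ σ) k, (∀ v, q v ∈ lowDegree (τ ⊕ σ) k s) ∧
      f = rename Sum.inl (specialize k ϖ f) +
        ∑ v, (X (Sum.inr v) - X (Sum.inl (ϖ v))) * q v := by
  let θ : MvPolynomial (τ ⊕ σ) k →ₐ[k] MvPolynomial (τ ⊕ σ) k :=
    (rename Sum.inl).comp (specialize k ϖ)
  let ℓ : σ → MvPolynomial (τ ⊕ σ) k := fun v => X (Sum.inr v) - X (Sum.inl (ϖ v))
  let W₀ : ℕ → Submodule k (MvPolynomial (τ ⊕ σ) k) := fun s =>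
    { carrier := {f | ∃ q : σ → MvPolynomial (τ ⊕ σ) k, (∀ v, q v ∈ lowDegree (τ ⊕ σ) k s) ∧
        f - θ f = ∑ v, ℓ v * q v}
      add_mem' := by
        rintro a b ⟨q, hq, h⟩ ⟨q', hq', h'⟩
        refine ⟨q + q', fun v => Submodule.add_mem _ (hq v) (hq' v), ?_⟩
        simp only [Pi.add_apply, mul_add, Finset.sum_add_distrib, ← h, ← h', map_add]
        ring
      zero_mem' := ⟨0, fun v => Submodule.zero_mem _, by simp⟩
      smul_mem' := by
        rintro c a ⟨q, hq, h⟩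
        refine ⟨c • q, fun v => Submodule.smul_mem _ _ (hq v), ?_⟩
        simp only [Pi.smul_apply, mul_smul_comm, ← Finset.smul_sum, ← h, map_smul, smul_sub] }
  have hθl : ∀ i, θ (X (Sum.inl i)) = X (Sum.inl i) := fun i => by
    simp [θ, specialize]
  have hθr : ∀ i, θ (X (Sum.inr i)) = X (Sum.inl (ϖ i)) := fun i => by
    simp [θ, specialize]
  have hX : ∀ i : τ ⊕ σ, (X i : MvPolynomial (τ ⊕ σ) k).totalDegree ≤ 1 := fun i => by
    rw [totalDegree_X]
  obtain ⟨W, hW⟩ : ∃ W : ℕ → Submodule k (MvPolynomial (τ ⊕ σ) k),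
      ∀ s f, f ∈ W s ↔ (∃ q : σ → MvPolynomial (τ ⊕ σ) k,
      (∀ v, q v ∈ lowDegree (τ ⊕ σ) k s) ∧ f - θ f = ∑ v, ℓ v * q v) ∧ f.totalDegree ≤ s :=
    ⟨fun s => W₀ s ⊓ restrictTotalDegree (τ ⊕ σ) k s,
      fun s f => and_congr Iff.rfl (mem_restrictTotalDegree _ _ _)⟩
  clear W₀
  have hle : ∀ s, restrictTotalDegree (τ ⊕ σ) k s ≤ W s := by
    refine restrictTotalDegree_le_of_mul_X ?_ ?_ ?_
    · rw [hW]
      exact ⟨⟨0, fun v => Submodule.zero_mem _, by simp⟩, by simp⟩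
    · intro s f hf
      rw [hW] at hf ⊢
      obtain ⟨⟨q, hq, h⟩, hd⟩ := hf
      exact ⟨⟨q, fun v => lowDegree_mono (Nat.le_succ s) (hq v), h⟩, by omega⟩
    · intro s i f hf
      rw [hW] at hf ⊢
      obtain ⟨⟨q, hq, h⟩, hd⟩ := hf
      have hXq : ∀ i v, X i * q v ∈ lowDegree (τ ⊕ σ) k (s + 1) := fun i v => by
        rw [add_comm]
        exact mul_mem_lowDegree (hX i) (hq v)
      refine ⟨?_, (totalDegree_mul _ _).trans (by have := hX i; omega)⟩
      rcases i with i | v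
      · refine ⟨fun w => X (Sum.inl i) * q w, fun w => hXq _ _, ?_⟩
        rw [map_mul, hθl, ← mul_sub, h, Finset.mul_sum]
        exact Finset.sum_congr rfl fun w _ => by ring
      · refine ⟨fun w => X (Sum.inl (ϖ v)) * q w + if w = v then f else 0, fun w => ?_, ?_⟩
        · refine Submodule.add_mem _ (hXq _ _) ?_
          split_ifs
          · exact (mem_restrictTotalDegree _ _ _).2 hd
          · exact Submodule.zero_mem _
        · have h1 : X (Sum.inr v) * f - θ (X (Sum.inr v) * f) =
              X (Sum.inl (ϖ v)) * (f - θ f) + ℓ v * f := by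
            rw [map_mul, hθr]
            simp only [ℓ]
            ring
          have h2 : ∀ w, ℓ w * (X (Sum.inl (ϖ v)) * q w + if w = v then f else 0) =
              X (Sum.inl (ϖ v)) * (ℓ w * q w) + if w = v then ℓ w * f else 0 := fun w => by
            split_ifs <;> ring
          rw [h1, h, Finset.sum_congr rfl fun w _ => h2 w, Finset.sum_add_distrib,
            Finset.sum_ite_eq', if_pos (Finset.mem_univ v), Finset.mul_sum]
  obtain ⟨⟨q, hq, h⟩, -⟩ := (hW _ _).1 (hle s ((mem_restrictTotalDegree _ _ _).2 hf))
  exact ⟨q, hq, by rw [← h]; simp [θ]⟩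

end Specialization

end PointCount

section PointCount

variable {k : Type*} [Field k] {τ σ : Type*} [Fintype σ]

lemma map_mem_span_of_totalDegree_le {γ A : Type*} [CommRing A] [Algebra k A] (ϖ : σ → τ)
    (E : MvPolynomial (τ ⊕ σ) k →ₐ[k] A) (g : γ → MvPolynomial (τ ⊕ σ) k) (e : γ → ℕ)
    (hge : ∀ j, (g j).totalDegree ≤ e j) (hg : ∀ j, (specialize k ϖ (g j)).IsHomogeneous (e j))
    (hE : ∀ j, E (g j) = 0) (I : Ideal (MvPolynomial τ k))
    (hI : I ≤ Ideal.span (Set.range fun j => specialize k ϖ (g j)))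
    (b : ℕ → Finset (MvPolynomial τ k))
    (hb : ∀ s, ∀ f : MvPolynomial τ k, f.totalDegree ≤ s →
        ∃ v ∈ Submodule.span k (b s : Set (MvPolynomial τ k)), v.totalDegree ≤ s ∧ f - v ∈ I)
    (s : ℕ) (f : MvPolynomial (τ ⊕ σ) k) (hf : f.totalDegree ≤ s) :
    E f ∈ Submodule.span k {x | ∃ a : σ →₀ ℕ, a.degree ≤ s ∧ ∃ p ∈ b (s - a.degree),
      x = (a.prod fun v i => E (X (Sum.inr v) - X (Sum.inl (ϖ v))) ^ i) *
        E (rename Sum.inl p)} := by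
  obtain ⟨ℓ, hℓ⟩ : ∃ ℓ : σ → MvPolynomial (τ ⊕ σ) k,
    ∀ v, ℓ v = X (Sum.inr v) - X (Sum.inl (ϖ v)) := ⟨_, fun _ => rfl⟩
  simp only [← hℓ]
  obtain ⟨N, hN⟩ : ∃ N : ℕ → Submodule k A, ∀ s, N s = Submodule.span k {x | ∃ a : σ →₀ ℕ,
      a.degree ≤ s ∧ ∃ p ∈ b (s - a.degree),
      x = (a.prod fun v i => E (ℓ v) ^ i) * E (rename Sum.inl p)} := ⟨_, fun _ => rfl⟩
  rw [← hN]
  have hmul : ∀ s v x, x ∈ N s → E (ℓ v) * x ∈ N (s + 1) := by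
    intro s v
    have : N s ≤ (N (s + 1)).comap (LinearMap.mulLeft k (E (ℓ v))) := by
      rw [hN, Submodule.span_le]
      rintro _ ⟨a, ha, p, hp, rfl⟩
      change _ * _ ∈ N (s + 1)
      rw [hN]
      refine Submodule.subset_span ⟨Finsupp.single v 1 + a, ?_, p, ?_, ?_⟩
      · rw [map_add, Finsupp.degree_single]; omega
      · rw [map_add, Finsupp.degree_single]
        convert hp using 2
        omega
      · rw [Finsupp.prod_add_index' (h := fun v i => E (ℓ v) ^ i) (fun _ => pow_zero _)
            (fun _ _ _ => pow_add _ _ _),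
          Finsupp.prod_single_index (h := fun v i => E (ℓ v) ^ i) (pow_zero _), pow_one, mul_assoc]
    exact fun x hx => this hx
  induction s using Nat.strong_induction_on generalizing f with
  | _ s ih =>
  have hlow : ∀ q ∈ lowDegree (τ ⊕ σ) k s, ∀ v, E (ℓ v * q) ∈ N s := by
    intro q hq v
    cases s with
    | zero =>
      have : q = 0 := hq
      rw [this, mul_zero, map_zero]
      exact Submodule.zero_mem _
    | succ s =>
      rw [map_mul]
      exact hmul s v _ (ih s (Nat.lt_succ_self s) q ((mem_restrictTotalDegree _ _ _).1 hq))
  have hgen : ∀ r j, r.totalDegree + e j ≤ s →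
      E (rename Sum.inl (r * specialize k ϖ (g j))) ∈ N s := by
    intro r j hr
    obtain ⟨q, hq, h⟩ := exists_eq_rename_specialize_add ϖ (hge j)
    have h1 : E (rename Sum.inl (r * specialize k ϖ (g j))) =
        -∑ v, E (ℓ v * (rename Sum.inl r * q v)) := by
      have h2 : rename Sum.inl (specialize k ϖ (g j)) = g j - ∑ v, ℓ v * q v := by
        rw [eq_sub_iff_add_eq]
        simp only [hℓ]
        exact h.symm
      rw [map_mul, map_mul, h2, map_sub, hE, zero_sub, mul_neg, map_sum, Finset.mul_sum]
      congr 1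
      refine Finset.sum_congr rfl fun v _ => ?_
      rw [← map_mul]
      congr 1
      ring
    rw [h1]
    refine Submodule.neg_mem _ (Submodule.sum_mem _ fun v _ => hlow _ ?_ v)
    exact lowDegree_mono hr (mul_mem_lowDegree (totalDegree_rename_le _ _) (hq v))
  obtain ⟨q, hq, h⟩ := exists_eq_rename_specialize_add ϖ hf
  simp only [← hℓ] at h
  rw [h, map_add, map_sum]
  refine Submodule.add_mem _ ?_ (Submodule.sum_mem _ fun v _ => hlow _ (hq v) v)
  obtain ⟨v, hv, hvs, hvI⟩ := hb s (specialize k ϖ f) ((totalDegree_rename_le _ _).trans hf)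
  have h1 : specialize k ϖ f = v + (specialize k ϖ f - v) := by ring
  rw [h1, map_add, map_add]
  refine Submodule.add_mem _ ?_ ?_
  · have : Submodule.span k (b s : Set (MvPolynomial τ k)) ≤
        (N s).comap (E.comp (rename Sum.inl)).toLinearMap := by
      rw [Submodule.span_le]
      intro p hp
      change E (rename Sum.inl p) ∈ N s
      rw [hN]
      exact Submodule.subset_span ⟨0, by simp, p, by simpa using hp, by simp⟩
    exact this hv
  · have hdeg : (specialize k ϖ f - v).totalDegree ≤ s :=
      (totalDegree_sub _ _).trans (max_le ((totalDegree_rename_le _ _).trans hf) hvs)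
    have hmem := mem_span_of_totalDegree_le _ e hg (hI hvI) hdeg
    have : Submodule.span k {p | ∃ r j, p = r * specialize k ϖ (g j) ∧ r.totalDegree + e j ≤ s} ≤
        (N s).comap (E.comp (rename Sum.inl)).toLinearMap := by
      rw [Submodule.span_le]
      rintro _ ⟨r, j, rfl, hr⟩
      exact hgen r j hr
    exact this hmem

lemma exists_interpolation [CharZero k] {ι : Type*} [Fintype ι] (B : ℕ) (Y : Finset (ι → ℤ))
    (hY : ∀ y ∈ Y, ∀ i, |y i| ≤ B) (φ : Y → k) :
    ∃ f : MvPolynomial ι k, f.totalDegree ≤ Fintype.card ι * (2 * B) ∧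
      ∀ y : Y, eval (fun i => ((y : ι → ℤ) i : k)) f = φ y := by
  let P : (ι → ℤ) → MvPolynomial ι k := fun y =>
    ∏ i, ∏ t ∈ (Finset.Icc (-B : ℤ) B).erase (y i), (X i - C (t : k))
  have hP : ∀ y ∈ Y, (P y).totalDegree ≤ Fintype.card ι * (2 * B) := by
    intro y hy
    refine (totalDegree_finsetProd _ _).trans ?_
    rw [← Finset.card_univ, ← smul_eq_mul]
    refine Finset.sum_le_card_nsmul _ _ _ fun i _ => ?_
    refine (totalDegree_finsetProd _ _).trans ?_
    have h1 : ((Finset.Icc (-B : ℤ) B).erase (y i)).card ≤ 2 * B := by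
      rw [Finset.card_erase_of_mem (Finset.mem_Icc.2 (abs_le.1 (hY y hy i))), Int.card_Icc]
      omega
    refine le_trans ?_ h1
    refine (Finset.sum_le_card_nsmul _ _ 1 fun t _ => ?_).trans (by simp)
    exact (totalDegree_sub _ _).trans
      (max_le (totalDegree_X _).le (by rw [totalDegree_C]; exact zero_le_one))
  have hev : ∀ y ∈ Y, ∀ y' ∈ Y, eval (fun i => (y' i : k)) (P y) = 0 ↔ y' ≠ y := by
    intro y hy y' hy'
    simp only [P, map_prod, map_sub, eval_X, eval_C, Finset.prod_eq_zero_iff, sub_eq_zero,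
      Int.cast_inj, Finset.mem_univ, true_and, Finset.mem_erase, Finset.mem_Icc]
    constructor
    · rintro ⟨i, t, ⟨hne, -⟩, rfl⟩ rfl
      exact hne rfl
    · intro hne
      obtain ⟨i, hi⟩ := Function.ne_iff.1 hne
      exact ⟨i, y' i, ⟨hi, abs_le.1 (hY y' hy' i)⟩, rfl⟩
  refine ⟨∑ y : Y, (φ y / eval (fun i => ((y : ι → ℤ) i : k)) (P y)) • P y, ?_, fun y => ?_⟩
  · exact totalDegree_finsetSum_le fun y _ => (totalDegree_smul_le _ _).trans (hP y y.2)
  · rw [map_sum, Finset.sum_eq_single y]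
    · rw [smul_eval, div_mul_cancel₀]
      intro h
      exact (hev y y.2 y y.2).1 h rfl
    · intro y' _ hne
      rw [smul_eval, (hev y' y'.2 y y.2).2 (fun h => hne (Subtype.ext h.symm)), mul_zero]
    · intro h
      exact absurd (Finset.mem_univ y) h

/-- Integer points in a box on which the `g j` vanish are few if, after identifying variables,
the `g j` become forms generating an ideal of small Krull dimension. -/
theorem exists_card_le_of_ringKrullDim [CharZero k] [Fintype τ] {γ : Type*} (ϖ : σ → τ)
    (g : γ → MvPolynomial (τ ⊕ σ) k) (e : γ → ℕ)
    (hge : ∀ j, (g j).totalDegree ≤ e j) (hg : ∀ j, (specialize k ϖ (g j)).IsHomogeneous (e j))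
    (I : Ideal (MvPolynomial τ k))
    (hI : I ≤ Ideal.span (Set.range fun j => specialize k ϖ (g j))) (D : ℕ)
    (hD : ringKrullDim (MvPolynomial τ k ⧸ I) = ((D : ℕ∞) : WithBot ℕ∞)) :
    ∃ K : ℕ, ∀ B : ℕ, 1 ≤ B → ∀ Y : Finset (τ ⊕ σ → ℤ), (∀ y ∈ Y, ∀ i, |y i| ≤ B) →
      (∀ y ∈ Y, ∀ j, eval (fun i => (y i : k)) (g j) = 0) →
        Y.card ≤ K * B ^ (D + Fintype.card σ) := by
  obtain ⟨C, b, hb⟩ := exists_finset_span_add_mem I D hD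
  set n := Fintype.card (τ ⊕ σ) with hn
  refine ⟨C * (2 * n + 1) ^ (D + Fintype.card σ), fun B hB Y hY hYg => ?_⟩
  set s := n * (2 * B) with hs
  let E : MvPolynomial (τ ⊕ σ) k →ₐ[k] (Y → k) :=
    AlgHom.pi fun y => aeval fun i => ((y : τ ⊕ σ → ℤ) i : k)
  have hE : ∀ f y, E f y = eval (fun i => ((y : τ ⊕ σ → ℤ) i : k)) f := fun f y => by
    simp [E, aeval_eq_eval]
  let L : (σ →₀ ℕ) → Y → k := fun a =>
    a.prod fun v i => E (X (Sum.inr v) - X (Sum.inl (ϖ v))) ^ i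
  let S : Finset (Y → k) := (Finset.univ : Finset (σ → Fin (s + 1))).biUnion fun a =>
    (b (s - ∑ v, (a v : ℕ))).image fun p =>
      L (Finsupp.equivFunOnFinite.symm fun v => (a v : ℕ)) * E (rename Sum.inl p)
  have htop : (⊤ : Submodule k (Y → k)) ≤ Submodule.span k (S : Set (Y → k)) := by
    intro φ _
    obtain ⟨f, hf, hfφ⟩ := exists_interpolation B Y hY φ
    have hφ : φ = E f := by
      ext y
      rw [hE, hfφ]
    rw [hφ]
    have := map_mem_span_of_totalDegree_le ϖ E g e hge hg
      (fun j => by ext y; rw [hE]; exact hYg y y.2 j) I hI b (fun s => (hb s).2) s f hf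
    refine Submodule.span_mono ?_ this
    rintro _ ⟨a, ha, p, hp, rfl⟩
    simp only [S, Finset.coe_biUnion, Set.mem_iUnion, Finset.coe_image, Set.mem_image]
    have hsum : a.degree = ∑ v, a v := Finsupp.degree_eq_sum a
    refine ⟨fun v => ⟨a v, ?_⟩, Finset.mem_coe.2 (Finset.mem_univ _), p, ?_, ?_⟩
    · have := Finsupp.le_degree v a
      omega
    · rw [← hsum]
      exact hp
    · simp only [L]
      congr 2
      ext v
      simp
  have h1 : Y.card ≤ S.card := by
    have h2 := Submodule.finrank_mono htop
    rw [finrank_top, Module.finrank_fintype_fun_eq_card, Fintype.card_coe] at h2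
    exact h2.trans (finrank_span_finset_le_card _)
  refine h1.trans (Finset.card_biUnion_le.trans ?_)
  have h3 : ∀ a : σ → Fin (s + 1), ((b (s - ∑ v, (a v : ℕ))).image fun p =>
      L (Finsupp.equivFunOnFinite.symm fun v => (a v : ℕ)) * E (rename Sum.inl p)).card ≤
        C * (s + 1) ^ D := fun a => by
    refine Finset.card_image_le.trans ((hb _).1.trans ?_)
    gcongr
    omega
  refine (Finset.sum_le_card_nsmul _ _ _ fun a _ => h3 a).trans ?_
  rw [Finset.card_univ, Fintype.card_fun, Fintype.card_fin, smul_eq_mul]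
  have h4 : s + 1 ≤ (2 * n + 1) * B := by rw [hs]; nlinarith
  calc (s + 1) ^ Fintype.card σ * (C * (s + 1) ^ D) = C * (s + 1) ^ (D + Fintype.card σ) := by ring
    _ ≤ C * ((2 * n + 1) * B) ^ (D + Fintype.card σ) := by gcongr
    _ = _ := by rw [mul_pow, mul_assoc]

end PointCount

section Weyl

variable {A V : Type*} [AddCommGroup A] [Finite A] [AddCommGroup V] [Fintype V]

lemma sq_expect_le {α : Type*} [Fintype α] [Nonempty α] (f : α → ℝ) :
    (𝔼 a, f a) ^ 2 ≤ 𝔼 a, f a ^ 2 := by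
  have := Finset.expect_mul_sq_le_sq_mul_sq Finset.univ f fun _ => 1
  simpa [Fintype.expect_const] using this

lemma expect_add_right (f : V → ℂ) (t : V) : 𝔼 v, f (v + t) = 𝔼 v, f v :=
  Fintype.expect_equiv (Equiv.addRight t) _ _ fun _ => rfl

lemma expect_re {α : Type*} [Fintype α] (f : α → ℂ) : (𝔼 a, f a).re = 𝔼 a, (f a).re := by
  rw [Fintype.expect_eq_sum_div_card, Fintype.expect_eq_sum_div_card, Complex.div_natCast_re,
    Complex.re_sum]

lemma expect_eq_expect_shift (f : V → ℂ) (h : V →+ V) : 𝔼 v, f v = 𝔼 v, 𝔼 u, f (v + h u) := by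
  rw [Finset.expect_comm]
  simp_rw [expect_add_right]
  rw [Fintype.expect_const]

/-- The van der Corput step of Weyl differencing. -/
lemma norm_expect_sq_le (ψ : AddChar A ℂ) (φ : V → A) (h : V →+ V) :
    ‖𝔼 v, ψ (φ v)‖ ^ 2 ≤ (𝔼 u, 𝔼 v, ψ (φ (v + h u) - φ v)).re := by
  rw [expect_eq_expect_shift _ h]
  have h1 : ‖𝔼 v, 𝔼 u, ψ (φ (v + h u))‖ ^ 2 ≤ 𝔼 v, ‖𝔼 u, ψ (φ (v + h u))‖ ^ 2 :=
    (pow_le_pow_left₀ (norm_nonneg _) (RCLike.norm_expect_le (K := ℂ)) 2).trans (sq_expect_le _)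
  refine h1.trans (le_of_eq ?_)
  have h2 : ∀ v, ((‖𝔼 u, ψ (φ (v + h u))‖ ^ 2 : ℝ) : ℂ) =
      𝔼 w, 𝔼 u, ψ (φ (v + h w + h u) - φ (v + h w)) := by
    intro v
    have h3 : (starRingEnd ℂ) (𝔼 u, ψ (φ (v + h u))) = 𝔼 u, ψ (-φ (v + h u)) := by
      rw [Fintype.expect_eq_sum_div_card, Fintype.expect_eq_sum_div_card, map_div₀, map_sum,
        map_natCast]
      simp_rw [AddChar.map_neg_eq_conj]
    rw [Complex.ofReal_pow, ← Complex.conj_mul', h3, Fintype.expect_mul_expect]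
    refine Finset.expect_congr rfl fun w _ => ?_
    rw [← expect_add_right _ w]
    refine Finset.expect_congr rfl fun u _ => ?_
    rw [← AddChar.map_add_eq_mul, neg_add_eq_sub, h.map_add, add_comm (h u), add_assoc]
  have h3 : ((𝔼 v, ‖𝔼 u, ψ (φ (v + h u))‖ ^ 2 : ℝ) : ℂ) =
      𝔼 u, 𝔼 v, ψ (φ (v + h u) - φ v) := by
    refine (RCLike.ofReal_expect (K := ℂ) _ _).trans ?_
    refine (Finset.expect_congr rfl fun v _ => h2 v).trans ?_
    rw [Finset.expect_comm (f := fun u v => ψ (φ (v + h u) - φ v))]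
    exact (expect_eq_expect_shift (fun v => 𝔼 u, ψ (φ (v + h u) - φ v)) h).symm
  rw [← h3, Complex.ofReal_re]

/-- The differencing step for a phase that is affine along `h`. -/
lemma norm_expect_le (ψ : AddChar A ℂ) (φ : V → A) (h : V →+ V)
    (hφ : ∀ v u w, φ (v + h u + h w) - φ (v + h u) - (φ (v + h w) - φ v) = 0) :
    ‖𝔼 v, ψ (φ v)‖ ≤ (𝔼 u, 𝔼 v, ψ (φ (v + h u) - φ v)).re := by
  rw [expect_eq_expect_shift _ h, Finset.expect_comm (t := Finset.univ)
    (f := fun u v => ψ (φ (v + h u) - φ v)), expect_re]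
  refine (RCLike.norm_expect_le (K := ℂ)).trans (Finset.expect_le_expect fun v _ => ?_)
  let χ : AddChar V ℂ :=
    { toFun := fun u => ψ (φ (v + h u) - φ v)
      map_zero_eq_one' := by simp
      map_add_eq_mul' := fun u w => by
        rw [← AddChar.map_add_eq_mul]
        congr 1
        have := hφ v u w
        rw [map_add, ← add_assoc]
        rw [sub_eq_zero] at this
        rw [← this]
        abel }
  have h1 : ∀ u, ψ (φ (v + h u)) = ψ (φ v) * χ u := fun u => by
    change _ = _ * ψ _
    rw [← AddChar.map_add_eq_mul, add_sub_cancel]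
  simp_rw [h1]
  rw [← Finset.mul_expect, norm_mul, AddChar.norm_apply, one_mul]
  change ‖𝔼 u, χ u‖ ≤ (𝔼 u, χ u).re
  rw [AddChar.expect_eq_ite]
  split_ifs <;> simp

end Weyl

section Differencing

variable {R ι κ : Type*} [CommRing R] (col : ι → κ)

/-- Keep the coordinates of colour `μ`, replacing all others by zero. -/
def mask (R : Type*) [CommRing R] (μ : κ) : (ι → R) →+ (ι → R) where
  toFun u i := if col i = μ then u i else 0
  map_zero' := by ext; simp
  map_add' u v := by ext i; by_cases h : col i = μ <;> simp [h]

lemma mask_apply (μ : κ) (u : ι → R) (i : ι) :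
    mask col R μ u i = if col i = μ then u i else 0 := rfl

/-- The finite difference of a polynomial in the direction of the colour `μ` part of `u`. -/
def diffMap (μ : κ) (u : ι → R) : MvPolynomial ι R →ₗ[R] MvPolynomial ι R :=
  (aeval fun i => X i + C (mask col R μ u i)).toLinearMap - LinearMap.id

lemma diffMap_apply (μ : κ) (u : ι → R) (P : MvPolynomial ι R) :
    diffMap col μ u P = aeval (fun i => X i + C (mask col R μ u i)) P - P := rfl

lemma eval_diffMap (μ : κ) (u v : ι → R) (P : MvPolynomial ι R) :
    eval v (diffMap col μ u P) = eval (v + mask col R μ u) P - eval v P := by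
  rw [diffMap_apply, map_sub, aeval_def, algebraMap_eq, ← coe_eval₂Hom, ← RingHom.comp_apply,
    MvPolynomial.comp_eval₂Hom]
  congr 1
  rw [coe_eval₂Hom, eval, coe_eval₂Hom]
  congr 1
  · ext; simp
  · ext; simp

/-- All iterated differences of `P` along the colours in `L` vanish. -/
def IsKilled : List κ → MvPolynomial ι R → Prop
  | [], P => P = 0
  | μ :: L, P => ∀ u, IsKilled L (diffMap col μ u P)

lemma IsKilled.add {L : List κ} : ∀ {P Q : MvPolynomial ι R},
    IsKilled col L P → IsKilled col L Q → IsKilled col L (P + Q) := by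
  induction L with
  | nil => rintro _ _ rfl rfl; exact add_zero 0
  | cons μ L ih => intro P Q hP hQ u; rw [map_add]; exact ih (hP u) (hQ u)

lemma isKilled_zero (L : List κ) : IsKilled col L (0 : MvPolynomial ι R) := by
  induction L with
  | nil => rfl
  | cons μ L ih => intro u; rw [map_zero]; exact ih

lemma isKilled_sum {α : Type*} (s : Finset α) (L : List κ) (P : α → MvPolynomial ι R)
    (h : ∀ a ∈ s, IsKilled col L (P a)) : IsKilled col L (∑ a ∈ s, P a) := by
  induction s using Finset.induction_on with
  | empty => exact isKilled_zero col L
  | insert a s ha ih =>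
    rw [Finset.sum_insert ha]
    exact (h a (Finset.mem_insert_self _ _)).add col
      (ih fun b hb => h b (Finset.mem_insert_of_mem hb))

variable [Fintype R] [Fintype ι] (ψ : AddChar R ℂ)

/-- The average over all differencing directions of the norm of the differenced sums. -/
def weylNorm : List κ → MvPolynomial ι R → ℝ
  | [], P => ‖𝔼 v, ψ (eval v P)‖
  | μ :: L, P => 𝔼 u, weylNorm L (diffMap col μ u P)

/-- The average over all differencing directions of the differenced sums. -/
def weylSum : List κ → MvPolynomial ι R → ℂ
  | [], P => 𝔼 v, ψ (eval v P)
  | μ :: L, P => 𝔼 u, weylSum L (diffMap col μ u P)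

lemma weylNorm_nonneg (L : List κ) : ∀ P : MvPolynomial ι R, 0 ≤ weylNorm col ψ L P := by
  induction L with
  | nil => exact fun P => norm_nonneg _
  | cons μ L ih => exact fun P => Finset.expect_nonneg fun u _ => ih _

lemma re_weylSum_le_weylNorm (L : List κ) :
    ∀ P : MvPolynomial ι R, (weylSum col ψ L P).re ≤ weylNorm col ψ L P := by
  induction L with
  | nil => exact fun P => Complex.re_le_norm _
  | cons μ L ih =>
    intro P
    rw [weylSum, weylNorm, expect_re]
    exact Finset.expect_le_expect fun u _ => ih _

lemma weylSum_singleton (μ : κ) (P : MvPolynomial ι R) : weylSum col ψ [μ] P =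
    𝔼 u, 𝔼 v, ψ (eval (v + mask col R μ u) P - eval v P) := by
  simp only [weylSum, eval_diffMap]

lemma weylNorm_sq_le (L : List κ) (μ : κ) : ∀ P : MvPolynomial ι R,
    weylNorm col ψ L P ^ 2 ≤ (weylSum col ψ (L ++ [μ]) P).re := by
  induction L with
  | nil =>
    intro P
    rw [List.nil_append, weylSum_singleton]
    exact norm_expect_sq_le ψ (fun v => eval v P) (mask col R μ)
  | cons μ' L ih =>
    intro P
    rw [List.cons_append, weylSum, weylNorm, expect_re]
    exact (sq_expect_le _).trans (Finset.expect_le_expect fun u _ => ih _)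

lemma weylNorm_le (L : List κ) (μ : κ) : ∀ P : MvPolynomial ι R,
    IsKilled col (L ++ [μ, μ]) P → weylNorm col ψ L P ≤ (weylSum col ψ (L ++ [μ]) P).re := by
  induction L with
  | nil =>
    intro P hP
    rw [List.nil_append, weylSum_singleton]
    refine norm_expect_le ψ (fun v => eval v P) (mask col R μ) fun v u w => ?_
    have : diffMap col μ u (diffMap col μ w P) = 0 := hP w u
    have h := congrArg (eval v) this
    rwa [eval_diffMap, eval_diffMap, eval_diffMap, map_zero] at h
  | cons μ' L ih =>
    intro P hP
    rw [List.cons_append, weylSum, weylNorm, expect_re]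
    exact Finset.expect_le_expect fun u _ => ih _ (hP u)

lemma weylSum_congr (L : List κ) : ∀ P Q : MvPolynomial ι R,
    IsKilled col L (P - Q) → weylSum col ψ L P = weylSum col ψ L Q := by
  induction L with
  | nil => intro P Q h; rw [sub_eq_zero.1 h]
  | cons μ L ih =>
    intro P Q h
    exact Finset.expect_congr rfl fun u _ => ih _ _ (by rw [← map_sub]; exact h u)

/-- `P` has its normalised exponential sum bounded, after `s` applications of Cauchy-Schwarz,
by the differenced norm along `L`. -/
lemma pow_le_weylNorm_append (P : MvPolynomial ι R) (L L' : List κ) {s : ℕ}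
    (h : weylNorm col ψ [] P ^ 2 ^ s ≤ weylNorm col ψ L P) :
    weylNorm col ψ [] P ^ 2 ^ (s + L'.length) ≤ weylNorm col ψ (L ++ L') P := by
  induction L' generalizing L s with
  | nil => simpa using h
  | cons μ L' ih =>
    have h1 : weylNorm col ψ [] P ^ 2 ^ (s + 1) ≤ weylNorm col ψ (L ++ [μ]) P := by
      rw [pow_succ, pow_mul]
      exact (pow_le_pow_left₀ (pow_nonneg (weylNorm_nonneg ..) _) h 2).trans
        ((weylNorm_sq_le ..).trans (re_weylSum_le_weylNorm ..))
    have := ih (L ++ [μ]) h1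
    rwa [List.append_assoc, List.singleton_append, add_assoc, add_comm 1] at this

/-- Differencing `a` times in a direction along which `P` has degree `a` costs only `a - 1`
applications of Cauchy-Schwarz. -/
lemma pow_le_re_weylSum_replicate (P : MvPolynomial ι R) (L : List κ) (μ : κ) {a : ℕ} (ha : 1 ≤ a)
    (hP : IsKilled col (L ++ List.replicate (a + 1) μ) P) {s : ℕ}
    (h : weylNorm col ψ [] P ^ 2 ^ s ≤ weylNorm col ψ L P) :
    weylNorm col ψ [] P ^ 2 ^ (s + (a - 1)) ≤
      (weylSum col ψ (L ++ List.replicate a μ) P).re := by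
  obtain ⟨a, rfl⟩ := Nat.exists_eq_add_of_le' ha
  have h1 := pow_le_weylNorm_append col ψ P L (List.replicate a μ) h
  rw [List.length_replicate] at h1
  rw [Nat.add_sub_cancel]
  refine h1.trans ?_
  rw [List.replicate_add, ← List.append_assoc]
  refine weylNorm_le col ψ _ μ P ?_
  rw [List.append_assoc]
  rwa [add_assoc, List.replicate_add] at hP

lemma pow_le_weylNorm_replicate (P : MvPolynomial ι R) (L : List κ) (μ : κ) (a : ℕ)
    (hP : IsKilled col (L ++ List.replicate (a + 1) μ) P) {s : ℕ}
    (h : weylNorm col ψ [] P ^ 2 ^ s ≤ weylNorm col ψ L P) :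
    weylNorm col ψ [] P ^ 2 ^ (s + (a - 1)) ≤ weylNorm col ψ (L ++ List.replicate a μ) P := by
  rcases Nat.eq_zero_or_pos a with rfl | ha
  · simpa using h
  · exact (pow_le_re_weylSum_replicate col ψ P L μ ha hP h).trans (re_weylSum_le_weylNorm ..)

/-- Weyl's inequality along the colours `μ₁` (`b` times), `μ₀` (`a` times), `μ₂` (`c` times). -/
lemma pow_le_re_weylSum (P : MvPolynomial ι R) (μ₀ μ₁ μ₂ : κ) (a b c : ℕ) (h : 1 ≤ a + b + c)
    (ha : IsKilled col (List.replicate b μ₁ ++ List.replicate (a + 1) μ₀) P)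
    (hc : IsKilled col
      (List.replicate b μ₁ ++ List.replicate a μ₀ ++ List.replicate (c + 1) μ₂) P) :
    ‖𝔼 v, ψ (eval v P)‖ ^ 2 ^ (b + (a - 1) + (c - 1)) ≤ (weylSum col ψ
      (List.replicate b μ₁ ++ List.replicate a μ₀ ++ List.replicate c μ₂) P).re := by
  change weylNorm col ψ [] P ^ _ ≤ _
  have h0 : weylNorm col ψ [] P ^ 2 ^ 0 ≤ weylNorm col ψ [] P := by simp
  have h1 := pow_le_weylNorm_append col ψ P [] (List.replicate b μ₁) h0
  rw [List.length_replicate, List.nil_append, zero_add] at h1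
  have h2 := pow_le_weylNorm_replicate col ψ P _ μ₀ a ha h1
  rcases Nat.eq_zero_or_pos c with rfl | hc'
  · rcases Nat.eq_zero_or_pos a with rfl | ha'
    · obtain ⟨b, rfl⟩ : ∃ b', b = b' + 1 := Nat.exists_eq_add_of_le' (by omega)
      have h3 := pow_le_weylNorm_append col ψ P [] (List.replicate b μ₁) h0
      rw [List.length_replicate, List.nil_append, zero_add] at h3
      simp only [List.replicate_zero, List.append_nil, Nat.zero_sub, add_zero]
      rw [List.replicate_add, pow_succ, pow_mul]
      exact (pow_le_pow_left₀ (pow_nonneg (weylNorm_nonneg ..) _) h3 2).trans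
        (weylNorm_sq_le ..)
    · simpa using pow_le_re_weylSum_replicate col ψ P _ μ₀ ha' ha h1
  · exact pow_le_re_weylSum_replicate col ψ P _ μ₂ hc' hc h2

end Differencing

section ColourDegree

variable {R ι κ : Type*} [CommRing R] (col : ι → κ)

lemma monomial_induction {p : (ι →₀ ℕ) → Prop} (h0 : p 0)
    (h : ∀ a v, p a → p (a + Finsupp.single v 1)) (a : ι →₀ ℕ) : p a := by
  induction a using Finsupp.induction with
  | zero => exact h0
  | single_add v n a _ _ ih =>
    rw [add_comm]
    clear * - ih h
    induction n with
    | zero => simpa using ih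
    | succ n ihn => rw [Finsupp.single_add, ← add_assoc]; exact h _ _ ihn

/-- The derivation in the direction of the colour `μ` part of `u`. -/
def derMap (μ : κ) (u : ι → R) : Derivation R (MvPolynomial ι R) (MvPolynomial ι R) :=
  mkDerivation R fun i => C (mask col R μ u i)

lemma derMap_X (μ : κ) (u : ι → R) (v : ι) : derMap col μ u (X v) = C (mask col R μ u v) :=
  mkDerivation_X _ _ _

lemma diffMap_X_mul (μ : κ) (u : ι → R) (v : ι) (P : MvPolynomial ι R) :
    diffMap col μ u (X v * P) =
      X v * diffMap col μ u P + C (mask col R μ u v) * (P + diffMap col μ u P) := by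
  rw [diffMap_apply, diffMap_apply, map_mul, aeval_X]
  ring

/-- The derivative of `P` along the directions `us`, of colours prescribed by `L`, at `0`. -/
def multiDer : (L : List κ) → (Fin L.length → ι → R) → MvPolynomial ι R → R
  | [], _, P => constantCoeff P
  | μ :: L, us, P => multiDer L (Fin.tail us) (derMap col μ (us 0) P)

variable [DecidableEq κ]

/-- The weight counting only the variables of colour `μ`. -/
def colWeight (μ : κ) (i : ι) : ℕ := if col i = μ then 1 else 0

/-- Polynomials whose degree in the variables of colour `μ` is at most `e μ`, for every `μ`. -/
def degLE (R : Type*) [CommRing R] (e : κ → ℤ) : Submodule R (MvPolynomial ι R) :=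
  restrictSupport R {a | ∀ μ, (Finsupp.weight (colWeight col μ) a : ℤ) ≤ e μ}

lemma mem_degLE {e : κ → ℤ} {P : MvPolynomial ι R} : P ∈ degLE col R e ↔
    ∀ a ∈ P.support, ∀ μ, (Finsupp.weight (colWeight col μ) a : ℤ) ≤ e μ :=
  Iff.rfl

lemma degLE_mono {e e' : κ → ℤ} (h : e ≤ e') : degLE col R e ≤ degLE col R e' :=
  fun _ hP _ ha μ => (hP ha μ).trans (h μ)

lemma eq_zero_of_mem_degLE {e : κ → ℤ} {P : MvPolynomial ι R} (hP : P ∈ degLE col R e) {μ : κ}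
    (hμ : e μ < 0) : P = 0 := by
  rw [← support_eq_empty, Finset.eq_empty_iff_forall_notMem]
  intro a ha
  have := hP ha μ
  omega

lemma X_mul_mem_degLE {e : κ → ℤ} {P : MvPolynomial ι R} (hP : P ∈ degLE col R e) (v : ι) :
    X v * P ∈ degLE col R (e + Pi.single (col v) 1) := by
  rw [mem_degLE]
  intro a ha μ
  rw [support_X_mul, Finset.mem_map] at ha
  obtain ⟨a, ha, rfl⟩ := ha
  have := hP ha μ
  simp only [addLeftEmbedding_apply, map_add, Finsupp.weight_single, one_smul, colWeight,
    Pi.add_apply, Pi.single_apply, eq_comm (a := μ)]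
  split_ifs <;> push_cast <;> omega

lemma monomial_mem_degLE (a : ι →₀ ℕ) (r : R) :
    monomial a r ∈ degLE col R fun μ => (Finsupp.weight (colWeight col μ) a : ℤ) := by
  rw [degLE, monomial_mem_restrictSupport]
  exact Or.inl fun μ => le_rfl

/-- A linear map lowering the degree by `f` on monomials lowers it on all polynomials. -/
lemma map_mem_degLE (T : MvPolynomial ι R →ₗ[R] MvPolynomial ι R) (f : κ → ℤ)
    (hT : ∀ a, T (monomial a 1) ∈
      degLE col R ((fun μ => (Finsupp.weight (colWeight col μ) a : ℤ)) - f))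
    {e : κ → ℤ} {P : MvPolynomial ι R} (hP : P ∈ degLE col R e) :
    T P ∈ degLE col R (e - f) := by
  rw [P.as_sum, map_sum]
  refine Submodule.sum_mem _ fun a ha => ?_
  have : monomial a (coeff a P) = coeff a P • monomial a (1 : R) := by
    rw [smul_monomial, smul_eq_mul, mul_one]
  rw [this, map_smul]
  exact Submodule.smul_mem _ _
    (degLE_mono col (fun μ => sub_le_sub_right (hP ha μ) _) (hT a))

lemma C_mask_mul_mem_degLE (μ : κ) (u : ι → R) (v : ι) {e : κ → ℤ} {P : MvPolynomial ι R}
    (hP : col v = μ → P ∈ degLE col R e) : C (mask col R μ u v) * P ∈ degLE col R e := by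
  rw [mask_apply]
  split_ifs with h
  · rw [← smul_eq_C_mul]
    exact Submodule.smul_mem _ _ (hP h)
  · rw [C_0, zero_mul]
    exact Submodule.zero_mem _

lemma weight_single_add (a : ι →₀ ℕ) (v : ι) :
    (fun μ => (Finsupp.weight (colWeight col μ) (a + Finsupp.single v 1) : ℤ)) =
      (fun μ => (Finsupp.weight (colWeight col μ) a : ℤ)) + Pi.single (col v) 1 := by
  ext μ
  simp only [map_add, Finsupp.weight_single, one_smul, colWeight, Pi.add_apply, Pi.single_apply,
    eq_comm (a := μ)]
  split_ifs <;> simp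

lemma diffMap_monomial_mem (μ : κ) (u : ι → R) (a : ι →₀ ℕ) :
    diffMap col μ u (monomial a 1) ∈ degLE col R
      ((fun μ => (Finsupp.weight (colWeight col μ) a : ℤ)) - Pi.single μ 1) := by
  induction a using monomial_induction with
  | h0 =>
    have : diffMap col μ u (monomial 0 1) = 0 := by
      rw [diffMap_apply, monomial_zero', map_one, map_one, sub_self]
    rw [this]
    exact Submodule.zero_mem _
  | h a v ih =>
    have hX : monomial (a + Finsupp.single v 1) (1 : R) = X v * monomial a 1 := by
      rw [X, monomial_mul, one_mul, add_comm]
    rw [weight_single_add, hX]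
    rw [diffMap_X_mul]
    refine Submodule.add_mem _ ?_ (C_mask_mul_mem_degLE _ _ _ _ fun h => ?_)
    · convert X_mul_mem_degLE col ih v using 2
      ring
    · rw [h, add_sub_cancel_right]
      exact Submodule.add_mem _ (monomial_mem_degLE col a 1) (degLE_mono col (by simp) ih)

lemma diffMap_sub_derMap_monomial_mem (μ : κ) (u : ι → R) (a : ι →₀ ℕ) :
    (diffMap col μ u - (derMap col μ u : MvPolynomial ι R →ₗ[R] MvPolynomial ι R))
      (monomial a 1) ∈ degLE col R
        ((fun μ => (Finsupp.weight (colWeight col μ) a : ℤ)) - Pi.single μ 2) := by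
  induction a using monomial_induction with
  | h0 =>
    have : (diffMap col μ u - (derMap col μ u : MvPolynomial ι R →ₗ[R] MvPolynomial ι R))
        (monomial 0 1) = 0 := by
      rw [LinearMap.sub_apply, diffMap_apply, monomial_zero', map_one, map_one, sub_self]
      simp
    rw [this]
    exact Submodule.zero_mem _
  | h a v ih =>
    have hX : monomial (a + Finsupp.single v 1) (1 : R) = X v * monomial a 1 := by
      rw [X, monomial_mul, one_mul, add_comm]
    rw [weight_single_add, hX]
    have : (diffMap col μ u - (derMap col μ u : MvPolynomial ι R →ₗ[R] MvPolynomial ι R))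
        (X v * monomial a 1) = X v * (diffMap col μ u -
          (derMap col μ u : MvPolynomial ι R →ₗ[R] MvPolynomial ι R)) (monomial a 1) +
            C (mask col R μ u v) * diffMap col μ u (monomial a 1) := by
      rw [LinearMap.sub_apply, LinearMap.sub_apply, Derivation.coeFn_coe, Derivation.leibniz,
        diffMap_X_mul, derMap_X, smul_eq_mul, smul_eq_mul]
      ring
    rw [this]
    refine Submodule.add_mem _ ?_ (C_mask_mul_mem_degLE _ _ _ _ fun h => ?_)
    · convert X_mul_mem_degLE col ih v using 2
      ring
    · convert diffMap_monomial_mem col μ u a using 2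
      rw [h, add_sub_assoc, sub_eq_add_neg _ (Pi.single μ 1)]
      congr 1
      rw [← Pi.single_sub, ← Pi.single_neg]
      norm_num

lemma diffMap_mem_degLE (μ : κ) (u : ι → R) {e : κ → ℤ} {P : MvPolynomial ι R}
    (hP : P ∈ degLE col R e) : diffMap col μ u P ∈ degLE col R (e - Pi.single μ 1) :=
  map_mem_degLE col _ _ (diffMap_monomial_mem col μ u) hP

lemma diffMap_sub_derMap_mem_degLE (μ : κ) (u : ι → R) {e : κ → ℤ} {P : MvPolynomial ι R}
    (hP : P ∈ degLE col R e) :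
    diffMap col μ u P - derMap col μ u P ∈ degLE col R (e - Pi.single μ 2) :=
  map_mem_degLE col _ _ (diffMap_sub_derMap_monomial_mem col μ u) hP

lemma isKilled_of_mem_degLE (L : List κ) : ∀ {e : κ → ℤ} {P : MvPolynomial ι R},
    P ∈ degLE col R e → ∀ μ, e μ < L.count μ → IsKilled col L P := by
  induction L with
  | nil => intro e P hP μ hμ; exact eq_zero_of_mem_degLE col hP (by simpa using hμ)
  | cons ν L ih =>
    intro e P hP μ hμ u
    refine ih (diffMap_mem_degLE col ν u hP) μ ?_
    rw [List.count_cons] at hμ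
    simp only [Pi.sub_apply, Pi.single_apply]
    split_ifs with h
    · subst h; simp at hμ; omega
    · rw [if_neg (by simpa using Ne.symm h)] at hμ; omega

lemma derMap_mem_degLE (μ : κ) (u : ι → R) {e : κ → ℤ} {P : MvPolynomial ι R}
    (hP : P ∈ degLE col R e) : derMap col μ u P ∈ degLE col R (e - Pi.single μ 1) := by
  have h := sub_sub_cancel (diffMap col μ u P) (derMap col μ u P)
  rw [← h]
  refine Submodule.sub_mem _ (diffMap_mem_degLE col μ u hP)
    (degLE_mono col ?_ (diffMap_sub_derMap_mem_degLE col μ u hP))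
  intro ν
  simp only [Pi.sub_apply, Pi.single_apply]
  split_ifs <;> omega

lemma expect_fin_succ {V : Type*} [Fintype V] {k : ℕ} (f : (Fin (k + 1) → V) → ℂ) :
    𝔼 us, f us = 𝔼 u, 𝔼 us, f (Fin.cons u us) := by
  rw [← Finset.expect_product', Finset.univ_product_univ]
  exact (Fintype.expect_equiv (Fin.consEquiv fun _ => V) _ _ fun _ => rfl).symm

/-- The completely differenced sum of a polynomial is a sum over its derivative form. -/
theorem weylSum_eq_expect_multiDer [Fintype R] [Fintype ι] (ψ : AddChar R ℂ) (L : List κ) :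
    ∀ P : MvPolynomial ι R, P ∈ degLE col R (fun μ => (L.count μ : ℤ)) →
      weylSum col ψ L P = 𝔼 us, ψ (multiDer col L us P) := by
  induction L with
  | nil =>
    intro P hP
    have hC : P = C (constantCoeff P) := by
      ext a
      rw [coeff_C, constantCoeff_eq]
      split_ifs with h
      · rw [h]
      · by_contra ha
        obtain ⟨i, hi⟩ := DFunLike.ne_iff.1 (Ne.symm h)
        have h1 := (mem_degLE col).1 hP a (mem_support_iff.2 ha) (col i)
        have h2 := Finsupp.le_weight (colWeight col (col i)) (s := i) (by simp [colWeight]) a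
        simp at h1 hi
        omega
    have h1 : ∀ v, eval v P = constantCoeff P := fun v => by
      conv_lhs => rw [hC, eval_C]
    simp only [weylSum, multiDer, h1, Fintype.expect_const]
  | cons μ L ih =>
    intro P hP
    refine Eq.trans ?_ (expect_fin_succ _).symm
    refine Finset.expect_congr rfl fun u _ => ?_
    have hc : (fun ν => ((μ :: L).count ν : ℤ)) - Pi.single μ 1 = fun ν => (L.count ν : ℤ) := by
      ext ν
      simp only [List.count_cons, Pi.sub_apply, Pi.single_apply]
      by_cases h : ν = μ
      · simp [h]
      · simp [h, Ne.symm h]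
    rw [weylSum_congr col ψ L _ (derMap col μ u P), ih _ (hc ▸ derMap_mem_degLE col μ u hP)]
    · rfl
    · refine isKilled_of_mem_degLE col L (diffMap_sub_derMap_mem_degLE col μ u hP) μ ?_
      simp
      omega

end ColourDegree

section MultiDer

variable {R ι κ : Type*} [CommRing R] (col : ι → κ)

lemma multiDer_add (L : List κ) : ∀ (us : Fin L.length → ι → R) (P Q : MvPolynomial ι R),
    multiDer col L us (P + Q) = multiDer col L us P + multiDer col L us Q := by
  induction L with
  | nil => exact fun us P Q => map_add _ _ _
  | cons μ L ih => intro us P Q; simp only [multiDer, map_add, ih]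

lemma multiDer_zero (L : List κ) (us : Fin L.length → ι → R) : multiDer col L us 0 = 0 :=
  map_zero (AddMonoidHom.mk' _ (multiDer_add col L us))

lemma multiDer_smul (L : List κ) : ∀ (us : Fin L.length → ι → R) (c : R) (P : MvPolynomial ι R),
    multiDer col L us (c • P) = c * multiDer col L us P := by
  induction L with
  | nil => intro us c P; simp [multiDer, smul_eq_C_mul]
  | cons μ L ih => intro us c P; simp only [multiDer, Derivation.map_smul, ih]

lemma multiDer_sum {α : Type*} (s : Finset α) (L : List κ) (us : Fin L.length → ι → R)
    (P : α → MvPolynomial ι R) :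
    multiDer col L us (∑ a ∈ s, P a) = ∑ a ∈ s, multiDer col L us (P a) :=
  map_sum (AddMonoidHom.mk' _ (multiDer_add col L us)) P s

lemma derMap_apply [Fintype ι] (μ : κ) (u : ι → R) (P : MvPolynomial ι R) :
    derMap col μ u P = ∑ v, mask col R μ u v • pderiv v P := by
  induction P using MvPolynomial.induction_on with
  | C a => simp [derivation_C]
  | add p q hp hq => simp only [map_add, hp, hq, smul_add, Finset.sum_add_distrib]
  | mul_X p v hp =>
    simp only [Derivation.leibniz, hp, derMap_X, pderiv_X, smul_add, Finset.sum_add_distrib,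
      Finset.smul_sum, smul_comm (X v : MvPolynomial ι R)]
    congr 1
    rw [Finset.sum_eq_single v]
    · simp [smul_eq_C_mul, mul_comm]
    · intro w _ hw; simp [hw.symm]
    · simp

lemma derMap_eq_sum [Fintype ι] (μ : κ) (u : ι → R) (P : MvPolynomial ι R) :
    derMap col μ u P = ∑ i, u i • derMap col μ (Pi.single i 1) P := by
  rw [derMap_apply]
  refine Finset.sum_congr rfl fun i _ => ?_
  rw [derMap_apply, Finset.sum_eq_single i]
  · simp [mask_apply]
  · intro v _ hv; simp [mask_apply, hv]
  · simp

lemma derMap_single [Fintype ι] (μ : κ) (i : ι) (P : MvPolynomial ι R) :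
    derMap col μ (Pi.single i 1) P = if col i = μ then pderiv i P else 0 := by
  rw [derMap_apply, Finset.sum_eq_single i]
  · by_cases h : col i = μ <;> simp [mask_apply, h]
  · intro v _ hv; simp [mask_apply, hv]
  · simp

/-- Expansion of the derivative form along one of its arguments. -/
lemma multiDer_eq_sum [Fintype ι] (L : List κ) : ∀ (us : Fin L.length → ι → R)
    (t : Fin L.length) (P : MvPolynomial ι R), multiDer col L us P =
      ∑ i, us t i * multiDer col L (Function.update us t (Pi.single i 1)) P := by
  induction L with
  | nil => intro us t; exact t.elim0
  | cons μ L ih =>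
    intro us t P
    refine Fin.cases ?_ (fun t => ?_) t
    · simp only [multiDer]
      rw [derMap_eq_sum, multiDer_sum]
      refine Finset.sum_congr rfl fun i _ => ?_
      rw [multiDer_smul, Function.update_self]
      congr 2
    · simp only [multiDer, Fin.tail_update_succ, ne_eq, (Fin.succ_ne_zero t).symm,
        not_false_eq_true,
        Function.update_of_ne]
      exact ih (Fin.tail us) t _

lemma multiDer_update_single_eq_zero [Fintype ι] (L : List κ) : ∀ (us : Fin L.length → ι → R)
    (t : Fin L.length) (P : MvPolynomial ι R) (i : ι), col i ≠ L[t] →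
      multiDer col L (Function.update us t (Pi.single i 1)) P = 0 := by
  induction L with
  | nil => intro us t; exact t.elim0
  | cons μ L ih =>
    intro us t P i
    refine Fin.cases (fun h => ?_) (fun t h => ?_) t
    · simp only [multiDer, Function.update_self]
      rw [derMap_single, if_neg (show ¬ col i = μ from h)]
      exact multiDer_zero col _ _
    · simp only [multiDer, Fin.tail_update_succ]
      exact ih (Fin.tail us) t _ i h

lemma map_derMap {S : Type*} [CommRing S] [Fintype ι] (f : R →+* S) (μ : κ) (u : ι → R)
    (P : MvPolynomial ι R) :
    map f (derMap col μ u P) = derMap col μ (fun i => f (u i)) (map f P) := by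
  simp only [derMap_apply, map_sum, pderiv_map, smul_eq_C_mul, map_mul, map_C]
  refine Finset.sum_congr rfl fun v _ => ?_
  rw [mask_apply, mask_apply]
  split_ifs <;> simp

lemma map_multiDer {S : Type*} [CommRing S] [Fintype ι] (f : R →+* S) (L : List κ) :
    ∀ (us : Fin L.length → ι → R) (P : MvPolynomial ι R), f (multiDer col L us P) =
      multiDer col L (fun t i => f (us t i)) (map f P) := by
  induction L with
  | nil => intro us P; simp [multiDer, constantCoeff_map]
  | cons μ L ih =>
    intro us P
    simp only [multiDer]
    rw [ih, map_derMap]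
    rfl

/-- If the arguments are linear forms, or constants, the derivative form is a polynomial of the
corresponding degree. -/
lemma totalDegree_multiDer_le {T k : Type*} [CommRing k] [Fintype ι] (L : List κ) :
    ∀ (us : Fin L.length → ι → MvPolynomial T k) (P : MvPolynomial ι (MvPolynomial T k))
      (ε : Fin L.length → ℕ) (s : ℕ), (∀ t i, (us t i).totalDegree ≤ ε t) →
        (∀ a, (coeff a P).totalDegree ≤ s) →
          (multiDer col L us P).totalDegree ≤ s + ∑ t, ε t := by
  induction L with
  | nil => intro us P ε s _ hP; exact (hP 0).trans (Nat.le_add_right _ _)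
  | cons μ L ih =>
    intro us P ε s hus hP
    refine (ih (Fin.tail us) _ (Fin.tail ε) (s + ε 0) (fun t i => hus _ i) fun a => ?_).trans ?_
    · rw [derMap_apply, coeff_sum]
      refine totalDegree_finsetSum_le fun v _ => ?_
      rw [coeff_smul, coeff_pderiv, smul_eq_mul]
      have h1 : (mask col (MvPolynomial T k) μ (us 0) v).totalDegree ≤ ε 0 := by
        rw [mask_apply]
        split_ifs
        · exact hus 0 v
        · simp
      have h2 : ((a v : MvPolynomial T k) + 1).totalDegree = 0 := by
        rw [← Nat.cast_succ, ← map_natCast C, totalDegree_C]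
      have h3 := totalDegree_mul (coeff (a + Finsupp.single v 1) P) ((a v : MvPolynomial T k) + 1)
      have h4 := hP (a + Finsupp.single v 1)
      refine (totalDegree_mul _ _).trans ?_
      omega
    · exact ((add_assoc _ _ _).trans (congrArg _ (Fin.sum_univ_succ ε).symm)).le

end MultiDer

section Diagonal

variable {R ι κ : Type*} [CommRing R] [DecidableEq κ] (col : ι → κ)

lemma pderiv_comm (i j : ι) (P : MvPolynomial ι R) :
    pderiv i (pderiv j P) = pderiv j (pderiv i P) := by
  have h : ⁅pderiv (R := R) i, pderiv j⁆ = 0 := derivation_ext fun v => by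
    rw [Derivation.commutator_apply, pderiv_X, pderiv_X, Pi.single_apply, Pi.single_apply]
    split_ifs <;> simp
  have h2 := congrArg (fun D => D P) h
  rw [Derivation.commutator_apply] at h2
  exact sub_eq_zero.1 h2

/-- `P` is homogeneous of degree `e μ` in the variables of colour `μ`, for every `μ`. -/
def IsMultiHom (e : κ → ℕ) (P : MvPolynomial ι R) : Prop :=
  ∀ μ, IsWeightedHomogeneous (colWeight col μ) P (e μ)

variable {col}

lemma IsMultiHom.pderiv {e e' : κ → ℕ} {P : MvPolynomial ι R} (hP : IsMultiHom col e P) {i : ι}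
    (h : ∀ μ, e' μ + colWeight col μ i = e μ) : IsMultiHom col e' (pderiv i P) :=
  fun μ => (hP μ).pderiv (h μ)

variable [Fintype ι]

lemma isMultiHom_derMap {e e' : κ → ℕ} {P : MvPolynomial ι R} (hP : IsMultiHom col e P) {ν : κ}
    (h : ∀ μ, e' μ + (if ν = μ then 1 else 0) = e μ) (u : ι → R) :
    IsMultiHom col e' (derMap col ν u P) := by
  intro μ
  rw [← mem_weightedHomogeneousSubmodule, derMap_apply]
  refine Submodule.sum_mem _ fun v _ => ?_
  rw [mask_apply]
  split_ifs with hv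
  · refine Submodule.smul_mem _ _ ?_
    exact hP.pderiv (fun μ => by rw [colWeight, hv]; exact h μ) μ
  · rw [zero_smul]
    exact Submodule.zero_mem _

lemma IsMultiHom.eval_derMap {e : κ → ℕ} {P : MvPolynomial ι R} (hP : IsMultiHom col e P) (ν : κ)
    (x : ι → R) : eval x (derMap col ν x P) = e ν * eval x P := by
  have h := congrArg (eval x) (hP ν).sum_weight_X_mul_pderiv
  rw [derMap_apply, map_sum]
  rw [map_sum, nsmul_eq_mul, map_mul, map_natCast] at h
  rw [← h]
  refine Finset.sum_congr rfl fun v _ => ?_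
  rw [mask_apply, colWeight]
  split_ifs <;> simp [smul_eq_C_mul]

lemma multiDer_diagonal (L : List κ) (x : ι → R) : ∃ k : ℕ, 0 < k ∧ ∀ P : MvPolynomial ι R,
    IsMultiHom col (fun μ => L.count μ) P → multiDer col L (fun _ => x) P = k * eval x P := by
  induction L with
  | nil =>
    refine ⟨1, one_pos, fun P hP => ?_⟩
    have hC : P = C (constantCoeff P) := by
      ext a
      rw [coeff_C, constantCoeff_eq]
      split_ifs with h
      · rw [h]
      · by_contra ha
        obtain ⟨i, hi⟩ := DFunLike.ne_iff.1 (Ne.symm h)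
        have h1 := hP (col i) ha
        have h2 := Finsupp.le_weight (colWeight col (col i)) (s := i) (by simp [colWeight]) a
        simp at h1 hi
        omega
    conv_rhs => rw [hC, eval_C]
    simp [multiDer]
  | cons ν L ih =>
    obtain ⟨k, hk, ih⟩ := ih
    refine ⟨k * (L.count ν + 1), by positivity, fun P hP => ?_⟩
    have h1 := ih _ (isMultiHom_derMap hP (ν := ν) (fun μ => by simp [List.count_cons]) x)
    rw [hP.eval_derMap, List.count_cons_self] at h1
    refine h1.trans ?_
    push_cast
    ring

/-- On the diagonal, the derivative form with one free argument is a partial derivative. -/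
lemma multiDer_diagonal_update (L : List κ) (x : ι → R) (i : ι) : ∀ t : Fin L.length, L[t] = col i →
    ∃ k : ℕ, 0 < k ∧ ∀ P : MvPolynomial ι R, IsMultiHom col (fun μ => L.count μ) P →
      multiDer col L (Function.update (fun _ => x) t (Pi.single i 1)) P =
        k * eval x (pderiv i P) := by
  induction L with
  | nil => exact fun t => t.elim0
  | cons ν L ih =>
    intro t
    refine Fin.cases (fun h => ?_) (fun t h => ?_) t
    · obtain ⟨k, hk, hL⟩ := multiDer_diagonal (col := col) L x
      refine ⟨k, hk, fun P hP => ?_⟩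
      have hν : ν = col i := h
      rw [← hL _ (hP.pderiv fun μ => by simp [List.count_cons, colWeight, hν])]
      simp only [multiDer, Function.update_self, derMap_single, if_pos hν.symm]
      rfl
    · obtain ⟨k, hk, hL⟩ := ih t h
      have hi : 0 < L.count (col i) := by
        rw [List.count_pos_iff]
        exact h ▸ List.getElem_mem _
      refine ⟨k * ((ν :: L).count ν - colWeight col ν i), ?_, fun P hP => ?_⟩
      · refine Nat.mul_pos hk ?_
        rw [List.count_cons_self, colWeight]
        split_ifs with hc
        · rw [hc] at hi; omega
        · omega
      · have h1 := hL _ (isMultiHom_derMap hP (ν := ν) (fun μ => by simp [List.count_cons]) x)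
        have h2 : pderiv i (derMap col ν x P) = derMap col ν x (pderiv i P) := by
          simp only [derMap_apply, map_sum, Derivation.map_smul, pderiv_comm i]
        have h3 : IsMultiHom col (fun μ => (ν :: L).count μ - colWeight col μ i) (pderiv i P) := by
          refine hP.pderiv fun μ => Nat.sub_add_cancel ?_
          rw [List.count_cons, colWeight]
          split_ifs with hc <;> first | omega | (rw [hc] at hi; omega)
        rw [h2, h3.eval_derMap] at h1
        simp only [multiDer, Fin.tail_update_succ, ne_eq, (Fin.succ_ne_zero t).symm,
          not_false_eq_true, Function.update_of_ne]
        refine h1.trans ?_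
        rw [Nat.cast_mul, mul_assoc]

end Diagonal

section Pigeonhole

/-- If `X` is stable under differences in each coordinate, then it can be covered by few translates
of its subset of points with coordinates in `S`, provided each fibre of `cell` has its differences
in `S`. -/
lemma card_le_pow_mul_card_filter {θ V Γ : Type*} [Fintype θ] [Fintype V] [Fintype Γ]
    [DecidableEq θ] [AddCommGroup V] (cell : V → Γ) (S : Set V)
    (hcell : ∀ v w, cell v = cell w → v - w ∈ S) (X : Set (θ → V))
    (hX : ∀ us ∈ X, ∀ t w, Function.update us t w ∈ X → Function.update us t (us t - w) ∈ X)
    (T : Finset θ) :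
    (Finset.univ.filter fun us => us ∈ X).card ≤ Fintype.card Γ ^ T.card *
      (Finset.univ.filter fun us => us ∈ X ∧ ∀ t ∈ T, us t ∈ S).card := by
  induction T using Finset.induction_on with
  | empty => simp
  | insert t T ht ih =>
    refine ih.trans ?_
    rw [Finset.card_insert_of_notMem ht, pow_succ, mul_assoc]
    refine Nat.mul_le_mul_left _ ?_
    set Y : Finset (θ → V) := Finset.univ.filter fun us => us ∈ X ∧ ∀ t ∈ T, us t ∈ S
    let rep : (θ → V) → Γ → V := fun us γ =>
      if h : ∃ v, Function.update us t v ∈ X ∧ cell v = γ then h.choose else 0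
    have hrep : ∀ us ∈ Y, Function.update us t (rep us (cell (us t))) ∈ X ∧
        cell (rep us (cell (us t))) = cell (us t) := by
      intro us hus
      have h : ∃ v, Function.update us t v ∈ X ∧ cell v = cell (us t) :=
        ⟨us t, by rw [Function.update_eq_self]; exact (Finset.mem_filter.1 hus).2.1, rfl⟩
      simp only [rep, dif_pos h]
      exact h.choose_spec
    have hrep_update : ∀ us γ v, rep (Function.update us t v) γ = rep us γ := by
      intro us γ v
      simp only [rep, Function.update_idem]
    rw [← Finset.card_univ, ← Finset.card_product]
    refine Finset.card_le_card_of_injOn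
      (fun us => (cell (us t), Function.update us t (us t - rep us (cell (us t))))) ?_ ?_
    · intro us hus
      obtain ⟨h1, h2⟩ := hrep us hus
      have hus' := (Finset.mem_filter.1 hus).2
      simp only [Finset.coe_product, Set.mem_prod, Finset.mem_coe, Finset.mem_univ, true_and,
        Finset.mem_filter]
      refine ⟨hX us hus'.1 t _ h1, fun s hs => ?_⟩
      rcases Finset.mem_insert.1 hs with rfl | hs'
      · rw [Function.update_self]
        exact hcell _ _ h2.symm
      · rw [Function.update_of_ne (by rintro rfl; exact ht hs')]
        exact hus'.2 s hs'
    · intro us _ vs _ h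
      simp only [Prod.mk.injEq] at h
      obtain ⟨h1, h2⟩ := h
      have h3 : rep us (cell (us t)) = rep vs (cell (vs t)) := by
        rw [← hrep_update us _ (us t - rep us (cell (us t))), h2, hrep_update, h1]
      have h4 := congrFun h2 t
      rw [Function.update_self, Function.update_self, h3, sub_left_inj] at h4
      funext s
      by_cases hs : s = t
      · rw [hs, h4]
      · have := congrFun h2 s
        rwa [Function.update_of_ne hs, Function.update_of_ne hs] at this

lemma expect_update {θ V : Type*} [Fintype θ] [Fintype V] [Nonempty V] [DecidableEq θ] (t : θ)
    (f : (θ → V) → ℂ) : 𝔼 us, f us = 𝔼 us, 𝔼 w, f (Function.update us t w) := by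
  rw [← Finset.expect_product', Finset.univ_product_univ]
  let e : (θ → V) × V → (θ → V) × V := fun p => (Function.update p.1 t p.2, p.1 t)
  have he : Function.Involutive e := fun p => by simp [e]
  rw [Fintype.expect_equiv he.toPerm (fun p => f (Function.update p.1 t p.2)) (fun p => f p.1)
    fun _ => rfl, ← Finset.univ_product_univ,
    Finset.expect_product' _ _ fun (us : θ → V) (_ : V) => f us]
  simp only [Fintype.expect_const]

lemma expect_linear_form {R ι : Type*} [CommRing R] [Fintype R] [Fintype ι] {ψ : AddChar R ℂ}
    (hψ : ψ.IsPrimitive) (c : ι → R) :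
    𝔼 w : ι → R, ψ (∑ i, w i * c i) = if ∀ i, c i = 0 then 1 else 0 := by
  let χ : AddChar (ι → R) ℂ :=
    ψ.compAddMonoidHom (AddMonoidHom.mk' (fun w => ∑ i, w i * c i) fun v w => by
      simp [add_mul, Finset.sum_add_distrib])
  have h : χ = 0 ↔ ∀ i, c i = 0 := by
    refine ⟨fun h i => ?_, fun h => ?_⟩
    · by_contra hi
      refine hψ hi (DFunLike.ext _ _ fun x => ?_)
      have := congrArg (fun φ => φ (Pi.single i x)) h
      simpa [χ, AddChar.mulShift_apply, Pi.single_apply, mul_comm] using this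
    · refine DFunLike.ext _ _ fun x => ?_
      simp [χ, h]
  have h2 := AddChar.expect_eq_ite χ
  simp only [h] at h2
  exact h2

end Pigeonhole

section Probability

variable {R ι κ : Type*} [CommRing R] [Fintype ι] (col : ι → κ)

/-- The arguments at which the derivative form vanishes identically in the argument `t`. -/
def zeroLocus (R : Type*) [CommRing R] (L : List κ) (t : Fin L.length) (P : MvPolynomial ι R) :
    Set (Fin L.length → ι → R) :=
  {us | ∀ i, col i = L[t] → multiDer col L (Function.update us t (Pi.single i 1)) P = 0}

lemma mem_zeroLocus {L : List κ} {t : Fin L.length} {P : MvPolynomial ι R}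
    {us : Fin L.length → ι → R} : us ∈ zeroLocus col R L t P ↔
      ∀ i, multiDer col L (Function.update us t (Pi.single i 1)) P = 0 := by
  refine forall_congr' fun i => ⟨fun h => ?_, fun h _ => h⟩
  by_cases hi : col i = L[t]
  · exact h hi
  · exact multiDer_update_single_eq_zero col L us t P i hi

lemma multiDer_update_sub (L : List κ) (us : Fin L.length → ι → R) (t : Fin L.length)
    (v w : ι → R) (P : MvPolynomial ι R) : multiDer col L (Function.update us t (v - w)) P =
      multiDer col L (Function.update us t v) P - multiDer col L (Function.update us t w) P := by
  rw [multiDer_eq_sum col L _ t, multiDer_eq_sum col L (Function.update us t v) t,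
    multiDer_eq_sum col L (Function.update us t w) t, ← Finset.sum_sub_distrib]
  refine Finset.sum_congr rfl fun i _ => ?_
  simp only [Function.update_self, Function.update_idem, Pi.sub_apply]
  ring

lemma zeroLocus_sub_mem (L : List κ) (t : Fin L.length) (P : MvPolynomial ι R)
    (us : Fin L.length → ι → R) (hus : us ∈ zeroLocus col R L t P) (s : Fin L.length) (w : ι → R)
    (hw : Function.update us s w ∈ zeroLocus col R L t P) :
    Function.update us s (us s - w) ∈ zeroLocus col R L t P := by
  intro i hi
  by_cases h : s = t
  · subst h
    simpa only [Function.update_idem] using hus i hi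
  · have h1 := hus i hi
    have h2 := hw i hi
    rw [Function.update_comm h] at h2 ⊢
    rw [multiDer_update_sub, h2, sub_zero]
    convert h1 using 2
    have : us s = Function.update us t (Pi.single i 1) s := by rw [Function.update_of_ne h]
    rw [this, Function.update_eq_self]

lemma expect_multiDer [Fintype R] {ψ : AddChar R ℂ} (hψ : ψ.IsPrimitive) (L : List κ)
    (t : Fin L.length) (P : MvPolynomial ι R) : 𝔼 us, ψ (multiDer col L us P) =
      (Finset.univ.filter fun us => us ∈ zeroLocus col R L t P).card /
        (Fintype.card (Fin L.length → ι → R) : ℂ) := by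
  rw [expect_update t]
  have h : ∀ us : Fin L.length → ι → R, 𝔼 w, ψ (multiDer col L (Function.update us t w) P) =
      if us ∈ zeroLocus col R L t P then 1 else 0 := by
    intro us
    simp only [mem_zeroLocus]
    rw [← expect_linear_form hψ]
    refine Finset.expect_congr rfl fun w _ => ?_
    rw [multiDer_eq_sum col L _ t]
    simp only [Function.update_self, Function.update_idem]
  simp only [h]
  rw [Fintype.expect_eq_sum_div_card, Finset.sum_boole]

end Probability

section IntegerPoints

lemma castMap_mem_degLE {ι κ : Type*} [DecidableEq κ] (col : ι → κ) {R : Type*} [CommRing R]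
    {e : κ → ℤ} {P : MvPolynomial ι ℤ}
    (hP : P ∈ degLE col ℤ e) : map (Int.castRingHom R) P ∈ degLE col R e :=
  fun _ ha => hP (support_map_subset _ _ ha)

variable {ι κ : Type*} [Fintype ι] (col : ι → κ)

/-- The integer points of height at most `B` at which the derivative form of `P` vanishes
identically in the argument `t`. -/
def integerPoints (L : List κ) (t : Fin L.length) (P : MvPolynomial ι ℤ) (B : ℕ) :
    Finset (Fin L.length → ι → ℤ) :=
  (Fintype.piFinset fun _ => Fintype.piFinset fun _ => Finset.Icc (-(B : ℤ)) B).filter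
    fun us => us ∈ zeroLocus col ℤ L t P

lemma mem_integerPoints {L : List κ} {t : Fin L.length} {P : MvPolynomial ι ℤ} {B : ℕ}
    {us : Fin L.length → ι → ℤ} : us ∈ integerPoints col L t P B ↔
      (∀ s i, |us s i| ≤ B) ∧ us ∈ zeroLocus col ℤ L t P := by
  simp only [integerPoints, Finset.mem_filter, Fintype.mem_piFinset, Finset.mem_Icc, abs_le]

lemma exists_abs_multiDer_le (L : List κ) : ∀ P : MvPolynomial ι ℤ, ∃ C : ℕ,
    ∀ (us : Fin L.length → ι → ℤ) (β : Fin L.length → ℤ), (∀ t i, |us t i| ≤ β t) →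
      (∀ t, 0 ≤ β t) → |multiDer col L us P| ≤ C * ∏ t, β t := by
  induction L with
  | nil =>
    intro P
    refine ⟨(constantCoeff P).natAbs, fun us β _ _ => ?_⟩
    simp [multiDer]
  | cons μ L ih =>
    intro P
    choose C hC using fun i => ih (derMap col μ (Pi.single i 1) P)
    refine ⟨∑ i, C i, fun us β h h0 => ?_⟩
    simp only [multiDer]
    rw [derMap_eq_sum, multiDer_sum]
    refine (Finset.abs_sum_le_sum_abs _ _).trans ?_
    rw [Nat.cast_sum, Finset.sum_mul]
    refine Finset.sum_le_sum fun i _ => ?_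
    rw [multiDer_smul, abs_mul]
    have h1 := hC i (Fin.tail us) (Fin.tail β) (fun t i => h _ i) fun t => h0 _
    have h2 := mul_le_mul (h 0 i) h1 (abs_nonneg _) (h0 0)
    refine h2.trans (le_of_eq ?_)
    refine (mul_left_comm _ _ _).trans (congrArg _ ?_)
    exact (Fin.prod_univ_succ β).symm

lemma exists_abs_multiDer_update_le (L : List κ) (t : Fin L.length) (P : MvPolynomial ι ℤ) :
    ∃ C : ℕ, ∀ (B : ℕ) (us : Fin L.length → ι → ℤ), (∀ t i, |us t i| ≤ B) → ∀ i,
      |multiDer col L (Function.update us t (Pi.single i 1)) P| ≤ C * (B : ℤ) ^ (L.length - 1) := by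
  obtain ⟨C, hC⟩ := exists_abs_multiDer_le col L P
  refine ⟨C, fun B us h i => ?_⟩
  convert hC (Function.update us t (Pi.single i 1)) (Function.update (fun _ => (B : ℤ)) t 1)
    (fun s j => ?_) (fun s => ?_) using 2
  · rw [Finset.prod_update_of_mem (Finset.mem_univ t), one_mul, Finset.prod_const,
      Finset.card_sdiff_of_subset (Finset.subset_univ _), Finset.card_univ, Fintype.card_fin,
      Finset.card_singleton]
  · by_cases hs : s = t
    · subst hs
      rw [Function.update_self, Function.update_self, Pi.single_apply]
      split_ifs <;> simp
    · rw [Function.update_of_ne hs, Function.update_of_ne hs]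
      exact h s j
  · by_cases hs : s = t
    · subst hs; simp
    · rw [Function.update_of_ne hs]; positivity

/-- Small zeros modulo `q` are zeros over the integers. -/
lemma card_filter_small_le {L : List κ} {t : Fin L.length} {P : MvPolynomial ι ℤ} {C : ℕ}
    (hC : ∀ (B : ℕ) (us : Fin L.length → ι → ℤ), (∀ t i, |us t i| ≤ B) → ∀ i,
      |multiDer col L (Function.update us t (Pi.single i 1)) P| ≤ C * (B : ℤ) ^ (L.length - 1))
    {q c B : ℕ} [NeZero q] (hc : 1 ≤ c) (hq : c * C * B ^ (L.length - 1) < q) :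
    (Finset.univ.filter fun us => us ∈ zeroLocus col (ZMod q) L t
      ((c : ZMod q) • map (Int.castRingHom (ZMod q)) P) ∧
        ∀ s, ∀ i, ∃ z : ℤ, |z| ≤ B ∧ (z : ZMod q) = us s i).card ≤
      (integerPoints col L t P B).card := by
  refine Finset.card_le_card_of_surjOn (fun us s i => ((us s i : ℤ) : ZMod q)) ?_
  intro us hus
  obtain ⟨h1, h2⟩ := (Finset.mem_filter.1 hus).2
  choose z hz hz' using h2
  refine ⟨z, (mem_integerPoints col).2 ⟨hz, fun i hi => ?_⟩, by simp only [hz']⟩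
  have h3 := h1 i hi
  have h4 : (fun s j => Int.castRingHom (ZMod q) (Function.update z t (Pi.single i 1) s j)) =
      Function.update us t (Pi.single i 1) := by
    ext s j
    by_cases hs : s = t
    · subst hs
      simp only [Function.update_self, Pi.single_apply]
      split_ifs <;> simp
    · simp [Function.update_of_ne hs, hz']
  rw [multiDer_smul, ← h4, ← map_multiDer] at h3
  have h5 := hC B z hz i
  generalize multiDer col L (Function.update z t (Pi.single i 1)) P = M at h3 h5 ⊢
  have h6 : ((c * M : ℤ) : ZMod q) = 0 := by simpa using h3
  rw [ZMod.intCast_zmod_eq_zero_iff_dvd] at h6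
  have h7 : (c : ℤ) * M = 0 := by
    refine Int.eq_zero_of_abs_lt_dvd h6 ?_
    rw [abs_mul, Nat.abs_cast]
    calc (c : ℤ) * |M| ≤ c * (C * (B : ℤ) ^ (L.length - 1)) := by gcongr
      _ < q := by rw [← mul_assoc]; exact_mod_cast hq
  rcases mul_eq_zero.1 h7 with h | h
  · omega
  · exact h

lemma card_zeroLocus_le {L : List κ} {t : Fin L.length} {P : MvPolynomial ι ℤ} {C : ℕ}
    (hC : ∀ (B : ℕ) (us : Fin L.length → ι → ℤ), (∀ t i, |us t i| ≤ B) → ∀ i,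
      |multiDer col L (Function.update us t (Pi.single i 1)) P| ≤ C * (B : ℤ) ^ (L.length - 1))
    {q c B : ℕ} [NeZero q] (hB : 1 ≤ B) (hc : 1 ≤ c) (hq : c * C * B ^ (L.length - 1) < q) :
    (Finset.univ.filter fun us => us ∈ zeroLocus col (ZMod q) L t
      ((c : ZMod q) • map (Int.castRingHom (ZMod q)) P)).card ≤
        (q / B + 1) ^ (Fintype.card ι * L.length) * (integerPoints col L t P B).card := by
  have h := card_le_pow_mul_card_filter
    (fun (v : ι → ZMod q) (i : ι) =>
      (⟨(v i).val / B, Nat.lt_succ_of_le (Nat.div_le_div_right (ZMod.val_lt _).le)⟩ :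
        Fin (q / B + 1)))
    {v | ∀ i, ∃ z : ℤ, |z| ≤ B ∧ (z : ZMod q) = v i} ?_
    (zeroLocus col (ZMod q) L t ((c : ZMod q) • map (Int.castRingHom (ZMod q)) P))
    (zeroLocus_sub_mem col L t _) Finset.univ
  · rw [Fintype.card_fun, Fintype.card_fin, Finset.card_univ, Fintype.card_fin, ← pow_mul] at h
    refine h.trans (Nat.mul_le_mul_left _ ?_)
    convert card_filter_small_le col hC hc hq using 5
    simp
  · intro v w hvw i
    refine ⟨(v i).val - (w i).val, ?_, by simp⟩
    have h1 : (v i).val / B = (w i).val / B := by simpa using congrFun hvw i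
    have h2 := Nat.div_add_mod (v i).val B
    have h3 := Nat.div_add_mod (w i).val B
    have h4 := Nat.mod_lt (v i).val hB
    have h5 := Nat.mod_lt (w i).val hB
    rw [h1] at h2
    rw [abs_le]
    constructor <;> omega

/-- The completely differenced sum attached to a form `c • P` modulo `q` is controlled by the
number of small integer zeros of the derivative form of `P`. -/
lemma exists_weylSum_re_le [DecidableEq κ] (L : List κ) (t : Fin L.length) (P : MvPolynomial ι ℤ)
    (hP : P ∈ degLE col ℤ fun μ => (L.count μ : ℤ)) :
    ∃ C : ℕ, ∀ (q c B : ℕ) [NeZero q] (ψ : AddChar (ZMod q) ℂ), ψ.IsPrimitive → 1 ≤ B → B ≤ q →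
      1 ≤ c → c * C * B ^ (L.length - 1) < q →
        (weylSum col ψ L ((c : ZMod q) • map (Int.castRingHom (ZMod q)) P)).re ≤
          (2 / B : ℝ) ^ (Fintype.card ι * L.length) * (integerPoints col L t P B).card := by
  obtain ⟨C, hC⟩ := exists_abs_multiDer_update_le col L t P
  refine ⟨C, fun q c B _ ψ hψ hB hBq hc hq => ?_⟩
  rw [weylSum_eq_expect_multiDer col ψ L _ (Submodule.smul_mem _ _ (castMap_mem_degLE col hP)),
    expect_multiDer col hψ L t]
  have h := card_zeroLocus_le col hC hB hc hq
  generalize (Finset.univ.filter fun us => us ∈ zeroLocus col (ZMod q) L t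
      ((c : ZMod q) • map (Int.castRingHom (ZMod q)) P)).card = A at h ⊢
  have h0 : ((A : ℂ) / (Fintype.card (Fin L.length → ι → ZMod q) : ℂ)).re =
      (A : ℝ) / (q : ℝ) ^ (Fintype.card ι * L.length) := by
    rw [Fintype.card_fun, Fintype.card_fun, ZMod.card, Fintype.card_fin, ← pow_mul]
    rw [← Complex.ofReal_natCast, ← Complex.ofReal_natCast, ← Complex.ofReal_div,
      Complex.ofReal_re, Nat.cast_pow]
  have hq0 : (0 : ℝ) < q := by exact_mod_cast (Nat.lt_of_lt_of_le hB hBq)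
  have hB0 : (0 : ℝ) < B := by exact_mod_cast hB
  have h1 : ((q / B + 1 : ℕ) : ℝ) ≤ 2 / B * q := by
    rw [Nat.cast_add, Nat.cast_one]
    have h2 : ((q / B : ℕ) : ℝ) ≤ q / B := Nat.cast_div_le
    have h3 : (1 : ℝ) ≤ q / B := by rw [le_div_iff₀ hB0, one_mul]; exact_mod_cast hBq
    calc ((q / B : ℕ) : ℝ) + 1 ≤ q / B + q / B := add_le_add h2 h3
      _ = _ := by ring
  rw [h0, div_le_iff₀ (by positivity)]
  calc (A : ℝ) ≤ ((q / B + 1 : ℕ) : ℝ) ^ (Fintype.card ι * L.length) *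
        (integerPoints col L t P B).card := by exact_mod_cast h
    _ ≤ (2 / B * q : ℝ) ^ (Fintype.card ι * L.length) * (integerPoints col L t P B).card := by
      gcongr
    _ = _ := by rw [mul_pow]; ring

end IntegerPoints

section Counting

variable {ι κ ρ : Type*} [Fintype ι] [DecidableEq κ] {col : ι → κ}

lemma IsMultiHom.isHomogeneous [Fintype κ] {R : Type*} [CommRing R] {e : κ → ℕ}
    {P : MvPolynomial ι R}
    (hP : IsMultiHom col e P) : P.IsHomogeneous (∑ μ, e μ) := by
  intro a ha
  rw [Finset.sum_congr rfl fun μ _ => (hP μ ha).symm]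
  simp only [Finsupp.weight_apply, Finsupp.sum_fintype, Pi.one_apply, smul_eq_mul, mul_one,
    zero_mul, implies_true]
  rw [Finset.sum_comm]
  refine Finset.sum_congr rfl fun i _ => ?_
  rw [← Finset.mul_sum]
  simp [colWeight]

lemma IsMultiHom.map {ι : Type*} {col : ι → κ} {R S : Type*} [CommRing R] [CommRing S]
    (f : R →+* S) {e : κ → ℕ}
    {P : MvPolynomial ι R} (hP : IsMultiHom col e P) : IsMultiHom col e (map f P) := by
  intro μ a ha
  refine hP μ fun h => ha ?_
  rw [coeff_map, h, map_zero]

lemma sum_count_eq_length {κ : Type*} [Fintype κ] [DecidableEq κ] (L : List κ) :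
    ∑ μ, L.count μ = L.length := by
  induction L with
  | nil => simp
  | cons ν L ih => simp [List.count_cons, Finset.sum_add_distrib, ih]

variable (col) (L : ρ → List κ) (t : ∀ p, Fin (L p).length) (P : ρ → MvPolynomial ι ℤ)

/-- Positions of the arguments of the derivative forms of all the pieces. -/
abbrev ArgPos (ι : Type*) (L : ρ → List κ) := Σ p, Fin (L p).length × ι

/-- The derivative form of a piece with generic arguments, except for a unit vector at `t p`. -/
def genericForm (k : Type*) [CommRing k] (p : ρ) (i : ι) : MvPolynomial (ι ⊕ ArgPos ι L) k :=
  multiDer col (L p)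
    (Function.update (fun s v => X (Sum.inr ⟨p, s, v⟩)) (t p) (Pi.single i 1))
    (map (C.comp (Int.castRingHom k)) (P p))

lemma totalDegree_genericForm_le {k : Type*} [Field k] (p : ρ) (i : ι) :
    (genericForm col L t P k p i).totalDegree ≤ (L p).length - 1 := by
  refine (totalDegree_multiDer_le col (L p) _ _ (Function.update (fun _ => 1) (t p) 0) 0
    (fun s v => ?_) fun a => ?_).trans ?_
  · by_cases hs : s = t p
    · subst hs
      rw [Function.update_self, Function.update_self, Pi.single_apply]
      split_ifs <;> simp
    · rw [Function.update_of_ne hs, Function.update_of_ne hs, totalDegree_X]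
  · rw [coeff_map, RingHom.comp_apply, totalDegree_C]
  · rw [Finset.sum_update_of_mem (Finset.mem_univ _), Finset.sum_const,
      Finset.card_sdiff_of_subset (Finset.subset_univ _)]
    simp

lemma specialize_genericForm {k : Type*} [Field k] (p : ρ) (i : ι)
    (hP : IsMultiHom col (fun μ => (L p).count μ) (P p)) (hi : (L p)[t p] = col i) :
    ∃ m : ℕ, 0 < m ∧ specialize k (fun s : ArgPos ι L => s.2.2) (genericForm col L t P k p i) =
      m * pderiv i (map (Int.castRingHom k) (P p)) := by
  obtain ⟨m, hm, h⟩ := multiDer_diagonal_update (col := col) (L p)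
    (fun v => (X v : MvPolynomial ι k)) i (t p) hi
  refine ⟨m, hm, ?_⟩
  have h1 := map_multiDer col
    (specialize k (fun s : ArgPos ι L => s.2.2)).toRingHom (L p)
    (Function.update (fun s v => X (Sum.inr ⟨p, s, v⟩)) (t p) (Pi.single i 1))
    (map (C.comp (Int.castRingHom k)) (P p))
  refine h1.trans ?_
  have h2 : (fun s j => (specialize k (fun s : ArgPos ι L => s.2.2)).toRingHom
      (Function.update (fun s v => X (Sum.inr ⟨p, s, v⟩)) (t p) (Pi.single i 1) s j)) =
      Function.update (fun _ v => (X v : MvPolynomial ι k)) (t p) (Pi.single i 1) := by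
    ext1 s
    ext1 j
    by_cases hs : s = t p
    · subst hs
      simp only [Function.update_self, Pi.single_apply]
      split_ifs <;> simp
    · simp [Function.update_of_ne hs, specialize]
  have h3 : (specialize k (fun s : ArgPos ι L => s.2.2)).toRingHom.comp
      (C.comp (Int.castRingHom k)) = C.comp (Int.castRingHom k) := RingHom.ext_int _ _
  have h4 : IsMultiHom col (fun μ => (L p).count μ)
      (map ((C : k →+* MvPolynomial ι k).comp (Int.castRingHom k)) (P p)) :=
    hP.map _
  rw [h2, map_map, h3, h _ h4, pderiv_map, pderiv_map, ← map_map, eval_map]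
  congr 1
  exact eval₂_eta _

lemma eval_genericForm {k : Type*} [Field k] (p : ρ) (i : ι) (x : ι → ℤ)
    (us : ∀ p, Fin (L p).length → ι → ℤ) :
    eval (fun j => ((Sum.elim x (fun s : ArgPos ι L => us s.1 s.2.1 s.2.2) j : ℤ) : k))
      (genericForm col L t P k p i) =
        ((multiDer col (L p) (Function.update (us p) (t p) (Pi.single i 1)) (P p) : ℤ) : k) := by
  have h5 := map_multiDer col (Int.castRingHom k) (L p)
    (Function.update (us p) (t p) (Pi.single i 1)) (P p)
  rw [eq_intCast] at h5
  rw [genericForm, map_multiDer, map_map, h5]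
  have h3 : (eval (fun j => ((Sum.elim x (fun s : ArgPos ι L => us s.1 s.2.1 s.2.2) j : ℤ) :
      k))).comp (C.comp (Int.castRingHom k)) = Int.castRingHom k := RingHom.ext_int _ _
  rw [h3]
  congr 1
  ext s j
  by_cases hs : s = t p
  · subst hs
    simp only [Function.update_self, Pi.single_apply]
    split_ifs <;> simp
  · simp [Function.update_of_ne hs]

end Counting

section Combination

variable {ι κ ρ : Type*} [Fintype ι] [Fintype κ] [DecidableEq κ] [Fintype ρ] (col : ι → κ)
  (L : ρ → List κ) (t : ∀ p, Fin (L p).length) (P : ρ → MvPolynomial ι ℤ)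

/-- The ideal generated by the partial derivatives of the pieces `P p` in the variables of the
colour attached to `p`, together with the variables in `Z`. -/
def piecesIdeal (Z : Finset ι) : Ideal (MvPolynomial ι ℂ) :=
  Ideal.span ({g | ∃ p i, (L p)[t p] = col i ∧ g = map (Int.castRingHom ℂ) (pderiv i (P p))} ∪
    {g | ∃ v ∈ Z, g = X v})

/-- The dimension bounds the number of points common to all the derivative forms. -/
lemma exists_prod_card_integerPoints_le
    (hP : ∀ p, IsMultiHom col (fun μ => (L p).count μ) (P p)) (Z : Finset ι)
    {I : Ideal (MvPolynomial ι ℂ)} (hI : I ≤ piecesIdeal col L t P Z) (D : ℕ)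
    (hD : ringKrullDim (MvPolynomial ι ℂ ⧸ I) = ((D : ℕ∞) : WithBot ℕ∞)) :
    ∃ K : ℕ, ∀ B, 1 ≤ B → B ^ (Finset.univ \ Z).card *
      ∏ p, (integerPoints col (L p) (t p) (P p) B).card ≤
        K * B ^ (D + ∑ p, Fintype.card ι * (L p).length) := by
  let g : (Σ p, {i // (L p)[t p] = col i}) ⊕ {v // v ∈ Z} → MvPolynomial (ι ⊕ ArgPos ι L) ℂ :=
    Sum.elim (fun j => genericForm col L t P ℂ j.1 j.2.1) fun v => X (Sum.inl v.1)
  let e : (Σ p, {i // (L p)[t p] = col i}) ⊕ {v // v ∈ Z} → ℕ :=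
    Sum.elim (fun j => (L j.1).length - 1) fun _ => 1
  have hspec : ∀ j : Σ p, {i // (L p)[t p] = col i}, ∃ m : ℕ, 0 < m ∧
      specialize ℂ (fun s : ArgPos ι L => s.2.2) (g (Sum.inl j)) =
        m * map (Int.castRingHom ℂ) (pderiv j.2.1 (P j.1)) := by
    intro j
    obtain ⟨m, hm, h⟩ := specialize_genericForm col L t P (k := ℂ) j.1 j.2.1 (hP j.1) j.2.2
    exact ⟨m, hm, by rw [← pderiv_map]; exact h⟩
  have hX : ∀ v : {v // v ∈ Z}, specialize ℂ (fun s : ArgPos ι L => s.2.2) (g (Sum.inr v)) =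
      X v.1 := fun v => by simp [g, specialize]
  have hge : ∀ j, (g j).totalDegree ≤ e j := by
    rintro (j | v)
    · exact totalDegree_genericForm_le col L t P j.1 j.2.1
    · exact (totalDegree_X _).le
  have hg : ∀ j, (specialize ℂ (fun s : ArgPos ι L => s.2.2) (g j)).IsHomogeneous (e j) := by
    rintro (j | v)
    · obtain ⟨m, -, h⟩ := hspec j
      rw [h, ← map_natCast C]
      have h1 := ((hP j.1).map (Int.castRingHom ℂ)).isHomogeneous.pderiv (i := j.2.1)
      rw [sum_count_eq_length, pderiv_map] at h1
      have := (isHomogeneous_C ι (m : ℂ)).mul h1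
      rwa [zero_add] at this
    · rw [hX]
      exact isHomogeneous_X _ _
  have hI' : I ≤ Ideal.span (Set.range fun j =>
      specialize ℂ (fun s : ArgPos ι L => s.2.2) (g j)) := by
    refine hI.trans (Ideal.span_le.2 ?_)
    rintro _ (⟨p, i, hi, rfl⟩ | ⟨v, hv, rfl⟩)
    · obtain ⟨m, hm, h⟩ := hspec ⟨p, i, hi⟩
      have h1 : specialize ℂ (fun s : ArgPos ι L => s.2.2) (g (Sum.inl ⟨p, i, hi⟩)) ∈
          Ideal.span (Set.range fun j => specialize ℂ (fun s : ArgPos ι L => s.2.2) (g j)) :=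
        Ideal.subset_span ⟨_, rfl⟩
      rw [h] at h1
      have h2 := Ideal.mul_mem_left _ (C ((m : ℂ)⁻¹)) h1
      rwa [← mul_assoc, ← map_natCast C, ← C_mul, inv_mul_cancel₀ (by exact_mod_cast hm.ne'),
        C_1, one_mul] at h2
    · rw [SetLike.mem_coe, ← hX ⟨v, hv⟩]
      exact Ideal.subset_span ⟨_, rfl⟩
  obtain ⟨K, hK⟩ := exists_card_le_of_ringKrullDim (fun s : ArgPos ι L => s.2.2) g e hge hg I
    hI' D hD
  refine ⟨K, fun B hB => ?_⟩
  let box : Finset (ι → ℤ) := Fintype.piFinset fun v => if v ∈ Z then {0} else Finset.Icc (-B) B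
  let pts : Finset (∀ p, Fin (L p).length → ι → ℤ) :=
    Fintype.piFinset fun p => integerPoints col (L p) (t p) (P p) B
  have hcard : B ^ (Finset.univ \ Z).card ≤ box.card := by
    rw [Fintype.card_piFinset, ← Finset.prod_const]
    rw [← Finset.prod_subset (Finset.sdiff_subset (s := Finset.univ) (t := Z))]
    · refine Finset.prod_le_prod' fun v hv => ?_
      rw [if_neg (Finset.mem_sdiff.1 hv).2, Int.card_Icc]
      omega
    · intro v _ hv
      rw [Finset.mem_sdiff, not_and, not_not] at hv
      rw [if_pos (hv (Finset.mem_univ v)), Finset.card_singleton]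
  let f : (ι → ℤ) × (∀ p, Fin (L p).length → ι → ℤ) → ι ⊕ ArgPos ι L → ℤ :=
    fun y => Sum.elim y.1 fun s => y.2 s.1 s.2.1 s.2.2
  have hf : Function.Injective f := by
    rintro ⟨x, us⟩ ⟨x', us'⟩ h
    refine Prod.ext (funext fun v => congrFun h (Sum.inl v)) ?_
    ext p s v
    exact congrFun h (Sum.inr ⟨p, s, v⟩)
  have h := hK B hB ((box ×ˢ pts).image f) ?_ ?_
  · have hpts : pts.card = ∏ p, (integerPoints col (L p) (t p) (P p) B).card :=
      Fintype.card_piFinset _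
    rw [Finset.card_image_of_injective _ hf, Finset.card_product, hpts] at h
    refine (Nat.mul_le_mul_right _ hcard).trans (h.trans (le_of_eq ?_))
    simp [ArgPos, mul_comm]
  · intro y hy i
    obtain ⟨⟨x, us⟩, hxy, rfl⟩ := Finset.mem_image.1 hy
    obtain ⟨hx, hus⟩ := Finset.mem_product.1 hxy
    rcases i with v | ⟨p, s, v⟩
    · have : x v ∈ _ := Fintype.mem_piFinset.1 hx v
      simp only [f, Sum.elim_inl]
      split_ifs at this
      · rw [Finset.mem_singleton.1 this]; simp
      · exact abs_le.2 (Finset.mem_Icc.1 this)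
    · exact ((mem_integerPoints col).1 (Fintype.mem_piFinset.1 hus p)).1 s v
  · intro y hy j
    obtain ⟨⟨x, us⟩, hxy, rfl⟩ := Finset.mem_image.1 hy
    obtain ⟨hx, hus⟩ := Finset.mem_product.1 hxy
    rcases j with j | v
    · refine (eval_genericForm col L t P j.1 j.2.1 x us).trans ?_
      rw [((mem_integerPoints col).1 (Fintype.mem_piFinset.1 hus j.1)).2 j.2.1 j.2.2.symm,
        Int.cast_zero]
    · have : x v.1 ∈ _ := Fintype.mem_piFinset.1 hx v.1
      rw [if_pos v.2] at this
      simp [g, f, Finset.mem_singleton.1 this]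

end Combination

section Pieces

variable {ι : Type*} [Fintype ι] (col : ι → Fin 3)

/-- Differencing pattern of the piece with degree `b` in the variables of colour `1`. -/
def pieceList (d₁ d₂ b : ℕ) : List (Fin 3) :=
  List.replicate b 1 ++ List.replicate (d₁ - b) 0 ++ List.replicate (d₂ - b) 2

/-- Number of applications of the Cauchy–Schwarz inequality used for the piece of degree `b`. -/
def pieceRank (d₁ d₂ b : ℕ) : ℕ := b + (d₁ - b - 1) + (d₂ - b - 1)

lemma count_pieceList (d₁ d₂ b : ℕ) :
    (fun μ => (pieceList d₁ d₂ b).count μ) = ![d₁ - b, b, d₂ - b] := by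
  ext μ
  fin_cases μ <;> simp [pieceList, List.count_replicate]

lemma IsMultiHom.mem_degLE {R : Type*} [CommRing R] {ι κ : Type*} [DecidableEq κ] {col : ι → κ}
    {e : κ → ℕ} {P : MvPolynomial ι R} (hP : IsMultiHom col e P) :
    P ∈ degLE col R fun μ => (e μ : ℤ) :=
  (PaperTM.mem_degLE col).2 fun _ ha μ => by rw [hP μ (mem_support_iff.1 ha)]

lemma IsMultiHom.isKilled {R : Type*} [CommRing R] {ι κ : Type*} [DecidableEq κ] {col : ι → κ}
    {e : κ → ℕ} {P : MvPolynomial ι R} (hP : IsMultiHom col e P) (L : List κ) (μ : κ)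
    (hμ : e μ < L.count μ) : IsKilled col L P :=
  isKilled_of_mem_degLE col L hP.mem_degLE μ (by exact_mod_cast hμ)

/-- Weyl's inequality for a sum of forms, one for each degree in the variables of colour `1`. -/
lemma pow_le_re_weylSum_piece {R : Type*} [CommRing R] [Fintype R] (ψ : AddChar R ℂ)
    {d₁ d₂ b : ℕ} (hd₁ : 1 ≤ d₁) (hb : b ≤ min d₁ d₂) (G : ℕ → MvPolynomial ι R)
    (hG : ∀ b ≤ min d₁ d₂, IsMultiHom col ![d₁ - b, b, d₂ - b] (G b)) :
    ‖𝔼 v, ψ (eval v (∑ b ∈ Finset.range (min d₁ d₂ + 1), G b))‖ ^ 2 ^ pieceRank d₁ d₂ b ≤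
      (weylSum col ψ (pieceList d₁ d₂ b) (G b)).re := by
  have hkill : ∀ b' ≤ min d₁ d₂, ∀ L : List (Fin 3), (∃ μ, ![d₁ - b', b', d₂ - b'] μ < L.count μ) →
      IsKilled col L (G b') := fun b' hb' L ⟨μ, hμ⟩ => (hG b' hb').isKilled L μ hμ
  rw [← weylSum_congr col ψ (pieceList d₁ d₂ b) (∑ b ∈ Finset.range (min d₁ d₂ + 1), G b) (G b)]
  · refine pow_le_re_weylSum col ψ _ 0 1 2 (d₁ - b) b (d₂ - b) (by omega) ?_ ?_
    · refine isKilled_sum col _ _ _ fun b' hb' => hkill b' ?_ _ ?_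
      · exact Nat.lt_succ_iff.1 (Finset.mem_range.1 hb')
      have hb'' := Nat.lt_succ_iff.1 (Finset.mem_range.1 hb')
      rcases lt_or_ge b' b with h | h
      · refine ⟨1, ?_⟩
        simp [List.count_replicate]
        omega
      · refine ⟨0, ?_⟩
        simp [List.count_replicate]
        omega
    · refine isKilled_sum col _ _ _ fun b' hb' => hkill b' ?_ _ ?_
      · exact Nat.lt_succ_iff.1 (Finset.mem_range.1 hb')
      have hb'' := Nat.lt_succ_iff.1 (Finset.mem_range.1 hb')
      rcases lt_or_ge b' b with h | h
      · refine ⟨1, ?_⟩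
        simp [List.count_replicate]
        omega
      · refine ⟨2, ?_⟩
        simp [List.count_replicate]
        omega
  · rw [← Finset.sum_erase_add _ _ (Finset.mem_range.2 (Nat.lt_succ_iff.2 hb)),
      add_sub_cancel_right]
    refine isKilled_sum col _ _ _ fun b' hb' => hkill b' ?_ _ ?_
    · exact Nat.lt_succ_iff.1 (Finset.mem_range.1 (Finset.mem_of_mem_erase hb'))
    have hne := Finset.ne_of_mem_erase hb'
    have hb'' := Nat.lt_succ_iff.1 (Finset.mem_range.1 (Finset.mem_of_mem_erase hb'))
    rcases lt_or_gt_of_ne hne with h | h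
    · refine ⟨1, ?_⟩
      simp [pieceList, List.count_replicate]
      omega
    · refine ⟨0, ?_⟩
      simp [pieceList, List.count_replicate]
      omega

/-- The main estimate: a complete exponential sum is small unless the dimension of the variety
cut out by the chosen partial derivatives of the pieces is large. -/
theorem exists_norm_expect_pow_le {d₁ d₂ : ℕ} (hd₁ : 1 ≤ d₁) (hd₂ : 1 ≤ d₂)
    (P : ℕ → MvPolynomial ι ℤ)
    (hP : ∀ b ≤ min d₁ d₂, IsMultiHom col ![d₁ - b, b, d₂ - b] (P b)) (S : Finset (ℕ × Fin 3))
    (hS : ∀ p ∈ S, p.1 ≤ min d₁ d₂ ∧ p.2 ∈ pieceList d₁ d₂ p.1) (Z : Finset ι)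
    (I : Ideal (MvPolynomial ι ℂ))
    (hI : I ≤ Ideal.span ({g | ∃ p ∈ S, ∃ i, col i = p.2 ∧
      g = map (Int.castRingHom ℂ) (pderiv i (P p.1))} ∪ {g | ∃ v ∈ Z, g = X v}))
    (D : ℕ) (hD : ringKrullDim (MvPolynomial ι ℂ ⧸ I) = ((D : ℕ∞) : WithBot ℕ∞))
    (e : ℕ) (he : ∀ p ∈ S, d₁ - p.1 ≤ e) :
    ∃ C K : ℕ, 1 ≤ C ∧ ∀ (q d B : ℕ) [NeZero q] (ψ : AddChar (ZMod q) ℂ), ψ.IsPrimitive →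
      1 ≤ d → 1 ≤ B → d ^ e * C * B ^ (d₁ + d₂ - 1) < q →
        ‖𝔼 v, ψ (eval v (∑ b ∈ Finset.range (min d₁ d₂ + 1),
          ((d ^ (d₁ - b) : ℕ) : ZMod q) • map (Int.castRingHom (ZMod q)) (P b)))‖ ^
            (∑ p ∈ S, 2 ^ pieceRank d₁ d₂ p.1) * (B : ℝ) ^ (Finset.univ \ Z).card ≤
              K * (B : ℝ) ^ D := by
  let L : {p // p ∈ S} → List (Fin 3) := fun p => pieceList d₁ d₂ p.1.1
  have ht : ∀ p : {p // p ∈ S}, ∃ t : Fin (L p).length, (L p)[t] = p.1.2 := fun p => by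
    obtain ⟨t, ht, h⟩ := List.getElem_of_mem (hS p.1 p.2).2
    exact ⟨⟨t, ht⟩, h⟩
  choose t ht using ht
  have hL : ∀ p : {p // p ∈ S}, IsMultiHom col (fun μ => (L p).count μ) (P p.1.1) := fun p => by
    rw [count_pieceList]
    exact hP _ (hS p.1 p.2).1
  have hI' : I ≤ piecesIdeal col L t (fun p => P p.1.1) Z := by
    refine hI.trans (Ideal.span_mono (Set.union_subset_union_left _ ?_))
    rintro _ ⟨p, hp, i, hi, rfl⟩
    exact ⟨⟨p, hp⟩, i, (ht _).trans hi.symm, rfl⟩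
  obtain ⟨K, hK⟩ := exists_prod_card_integerPoints_le col L t (fun p => P p.1.1) hL Z hI' D hD
  choose C hC using fun p : {p // p ∈ S} =>
    exists_weylSum_re_le col (L p) (t p) (P p.1.1) (hL p).mem_degLE
  set T := ∑ p, Fintype.card ι * (L p).length
  refine ⟨1 + ∑ p, C p, 2 ^ T * K, Nat.le_add_right _ _, fun q d B _ ψ hψ hd hB hq => ?_⟩
  have hB0 : (0 : ℝ) < B := by exact_mod_cast hB
  have hBq : B ≤ q := by
    refine (le_trans ?_ hq.le)
    calc B = 1 * 1 * B ^ 1 := by ring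
      _ ≤ d ^ e * (1 + ∑ p, C p) * B ^ (d₁ + d₂ - 1) :=
        Nat.mul_le_mul (Nat.mul_le_mul (Nat.one_le_pow _ _ hd) (Nat.le_add_right _ _))
          (Nat.pow_le_pow_right hB (by omega))
  have hG : ∀ b ≤ min d₁ d₂, IsMultiHom col ![d₁ - b, b, d₂ - b]
      (((d ^ (d₁ - b) : ℕ) : ZMod q) • map (Int.castRingHom (ZMod q)) (P b)) := by
    intro b hb μ
    rw [← mem_weightedHomogeneousSubmodule]
    exact Submodule.smul_mem _ _ ((hP b hb).map _ μ)
  set E := ‖𝔼 v, ψ (eval v (∑ b ∈ Finset.range (min d₁ d₂ + 1),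
    ((d ^ (d₁ - b) : ℕ) : ZMod q) • map (Int.castRingHom (ZMod q)) (P b)))‖
  have h1 : ∀ p : {p // p ∈ S}, E ^ 2 ^ pieceRank d₁ d₂ p.1.1 ≤
      (2 / B : ℝ) ^ (Fintype.card ι * (L p).length) *
        (integerPoints col (L p) (t p) (P p.1.1) B).card := by
    intro p
    refine (pow_le_re_weylSum_piece col ψ hd₁ (hS p.1 p.2).1 _ hG).trans ?_
    refine hC p q _ B ψ hψ hB hBq (Nat.one_le_pow _ _ hd) (lt_of_le_of_lt ?_ hq)
    have hlen : (L p).length - 1 ≤ d₁ + d₂ - 1 := by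
      have := (hS p.1 p.2).1
      simp only [L, pieceList, List.length_append, List.length_replicate]
      omega
    have hCp : C p ≤ 1 + ∑ p, C p :=
      (Finset.single_le_sum (fun p _ => Nat.zero_le (C p)) (Finset.mem_univ p)).trans
        (Nat.le_add_left _ _)
    exact Nat.mul_le_mul (Nat.mul_le_mul (Nat.pow_le_pow_right hd (he p.1 p.2)) hCp)
      (Nat.pow_le_pow_right hB hlen)
  have h2 : E ^ (∑ p ∈ S, 2 ^ pieceRank d₁ d₂ p.1) ≤ (2 / B : ℝ) ^ T *
      ∏ p, ((integerPoints col (L p) (t p) (P p.1.1) B).card : ℝ) := by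
    rw [← Finset.prod_pow_eq_pow_sum, ← Finset.prod_coe_sort, ← Finset.prod_pow_eq_pow_sum,
      ← Finset.prod_mul_distrib]
    exact Finset.prod_le_prod (fun p _ => by positivity) fun p _ => h1 p
  have h3 : (B : ℝ) ^ (Finset.univ \ Z).card *
      ∏ p, ((integerPoints col (L p) (t p) (P p.1.1) B).card : ℝ) ≤ K * (B : ℝ) ^ (D + T) := by
    exact_mod_cast hK B hB
  calc E ^ (∑ p ∈ S, 2 ^ pieceRank d₁ d₂ p.1) * (B : ℝ) ^ (Finset.univ \ Z).card
      ≤ ((2 / B : ℝ) ^ T * ∏ p, ((integerPoints col (L p) (t p) (P p.1.1) B).card : ℝ)) *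
        (B : ℝ) ^ (Finset.univ \ Z).card := by gcongr
    _ = (2 / B : ℝ) ^ T * ((B : ℝ) ^ (Finset.univ \ Z).card *
        ∏ p, ((integerPoints col (L p) (t p) (P p.1.1) B).card : ℝ)) := by ring
    _ ≤ (2 / B : ℝ) ^ T * (K * (B : ℝ) ^ (D + T)) := by gcongr
    _ = ((2 ^ T * K : ℕ) : ℝ) * (B : ℝ) ^ D := by
      rw [div_pow, pow_add]
      push_cast
      field_simp

end Pieces

section Exponents

/-- Optimising over the height `B` turns a family of bounds into a power saving. -/
lemma exists_le_mul_rpow (W W' C K k M D : ℕ) (s : ℝ) (hW : W ≤ W') (hW' : 1 ≤ W') (hC : 1 ≤ C)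
    (hk : 1 ≤ k) (hs : 0 ≤ s) (hsM : s * (k * W') ≤ (M : ℝ) - D) :
    ∃ A : ℝ, 0 ≤ A ∧ ∀ (σ : ℝ) (E q : ℕ), 0 ≤ σ → σ ≤ 1 → 1 ≤ E → 1 ≤ q →
      (∀ B : ℕ, 1 ≤ B → E * C * B ^ k < q → σ ^ W * (B : ℝ) ^ M ≤ K * (B : ℝ) ^ D) →
        σ ≤ A * ((E : ℝ) / q) ^ s := by
  refine ⟨max 1 (K : ℝ) * ((C : ℝ) * 2 ^ k) ^ s, by positivity, fun σ E q h0 h1 hE hq h => ?_⟩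
  have hC' : (1 : ℝ) ≤ C := by exact_mod_cast hC
  have hE' : (1 : ℝ) ≤ E := by exact_mod_cast hE
  have hq' : (0 : ℝ) < q := by exact_mod_cast hq
  have hmul : max 1 (K : ℝ) * ((C : ℝ) * 2 ^ k) ^ s * ((E : ℝ) / q) ^ s =
      max 1 (K : ℝ) * (E * C * 2 ^ k / q) ^ s := by
    rw [mul_assoc, ← Real.mul_rpow (by positivity) (by positivity)]
    ring_nf
  rw [hmul]
  by_cases hex : E * C < q
  · have hbd : ∀ B, E * C * B ^ k < q → B ≤ q := fun B hB =>
      calc B ≤ B ^ k := Nat.le_self_pow (by omega) B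
        _ ≤ E * C * B ^ k := Nat.le_mul_of_pos_left _ (by positivity)
        _ ≤ q := hB.le
    have hB := Nat.findGreatest_spec (P := fun B => E * C * B ^ k < q) (n := q) hq
      (by simpa using hex)
    have hB1 : 1 ≤ Nat.findGreatest (fun B => E * C * B ^ k < q) q :=
      Nat.le_findGreatest hq (by simpa using hex)
    have hBmax : ¬ E * C * (Nat.findGreatest (fun B => E * C * B ^ k < q) q + 1) ^ k < q :=
      fun h' => Nat.not_succ_le_self _
        (Nat.le_findGreatest (P := fun B => E * C * B ^ k < q) (hbd _ h') h')
    generalize Nat.findGreatest (fun B => E * C * B ^ k < q) q = B at hB hB1 hBmax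
    have hB1' : (1 : ℝ) ≤ B := by exact_mod_cast hB1
    have hB0 : (0 : ℝ) < B := by linarith
    have hqB : (q : ℝ) ≤ E * C * 2 ^ k * (B : ℝ) ^ k := by
      have h2 : q ≤ E * C * (2 * B) ^ k :=
        (not_lt.1 hBmax).trans (Nat.mul_le_mul_left _ (Nat.pow_le_pow_left (by omega) _))
      rw [mul_pow, ← mul_assoc] at h2
      exact_mod_cast h2
    have hY : σ ≤ max 1 (K : ℝ) * (B : ℝ) ^ (-(s * k)) := by
      refine le_of_pow_le_pow_left₀ (by omega : W' ≠ 0) (by positivity) ?_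
      calc σ ^ W' ≤ σ ^ W := pow_le_pow_of_le_one h0 h1 hW
        _ ≤ K * (B : ℝ) ^ ((D : ℝ) - M) := by
          rw [Real.rpow_sub hB0, Real.rpow_natCast, Real.rpow_natCast, ← mul_div_assoc,
            le_div_iff₀ (by positivity)]
          exact h B hB1 hB
        _ ≤ max 1 (K : ℝ) ^ W' * (B : ℝ) ^ (-(s * k) * W') := by
          gcongr
          · exact (le_max_right 1 _).trans (le_self_pow₀ (le_max_left _ _) (by omega))
          · linarith
        _ = (max 1 (K : ℝ) * (B : ℝ) ^ (-(s * k))) ^ W' := by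
          rw [mul_pow, ← Real.rpow_natCast ((B : ℝ) ^ _), ← Real.rpow_mul hB0.le]
    refine hY.trans (mul_le_mul_of_nonneg_left ?_ (by positivity))
    have hinv : (B : ℝ) ^ (-(s * k)) = (((B : ℝ) ^ k)⁻¹) ^ s := by
      rw [Real.inv_rpow (by positivity), ← Real.rpow_natCast, ← Real.rpow_mul hB0.le,
        Real.rpow_neg hB0.le, mul_comm s]
    rw [hinv]
    refine Real.rpow_le_rpow (by positivity) ?_ hs
    rw [inv_le_iff_one_le_mul₀ (by positivity), div_mul_eq_mul_div, le_div_iff₀ hq', one_mul]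
    exact hqB
  · have hge : (1 : ℝ) ≤ E * C * 2 ^ k / q := by
      rw [le_div_iff₀ hq', one_mul]
      have h2 : q ≤ E * C * 2 ^ k := (not_lt.1 hex).trans
        (Nat.le_mul_of_pos_right _ (by positivity))
      exact_mod_cast h2
    calc σ ≤ 1 * 1 := by linarith
      _ ≤ max 1 (K : ℝ) * (E * C * 2 ^ k / q) ^ s :=
        mul_le_mul (le_max_left _ _) (Real.one_le_rpow hge hs) zero_le_one (by positivity)

/-- The pairs consisting of a piece and a colour in `{0, 1}` occurring in it. -/
def lowPairs (d₁ d₂ : ℕ) : Finset (ℕ × Fin 3) :=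
  (Finset.range (min d₁ d₂ + 1) ×ˢ {0, 1}).filter fun p => p.2 ∈ pieceList d₁ d₂ p.1

lemma mem_pieceList {d₁ d₂ b : ℕ} {μ : Fin 3} :
    μ ∈ pieceList d₁ d₂ b ↔ 0 < ![d₁ - b, b, d₂ - b] μ := by
  rw [← count_pieceList, List.count_pos_iff]

lemma sum_lowPairs_le {d₁ d₂ : ℕ} (hd₁ : 1 ≤ d₁) (hd₂ : 1 ≤ d₂) :
    ∑ p ∈ lowPairs d₁ d₂, 2 ^ pieceRank d₁ d₂ p.1 ≤ 3 * 2 ^ (d₁ + d₂ - 2) := by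
  set c : ℕ → ℕ := fun b => (if b < d₁ then 1 else 0) + if 0 < b then 1 else 0 with hc
  have hsum : ∑ p ∈ lowPairs d₁ d₂, 2 ^ pieceRank d₁ d₂ p.1 =
      ∑ b ∈ Finset.range (min d₁ d₂ + 1), c b * 2 ^ pieceRank d₁ d₂ b := by
    rw [lowPairs, Finset.sum_filter, Finset.sum_product]
    refine Finset.sum_congr rfl fun b _ => ?_
    rw [Finset.sum_pair (by decide)]
    simp [mem_pieceList, hc, add_mul, ite_mul]
  have hpart : ∀ j, j + 1 ≤ min d₁ d₂ →
      ∑ b ∈ Finset.range (j + 1), c b * 2 ^ pieceRank d₁ d₂ b + 2 ^ (d₁ + d₂ - (j + 1)) ≤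
        3 * 2 ^ (d₁ + d₂ - 2) := by
    intro j
    induction j with
    | zero =>
      intro _
      have h1 : d₁ + d₂ - 1 = d₁ + d₂ - 2 + 1 := by omega
      have h2 : pieceRank d₁ d₂ 0 = d₁ + d₂ - 2 := by
        simp only [pieceRank]
        omega
      have h3 : c 0 = 1 := by simp [hc]; omega
      simp only [zero_add, Finset.sum_range_one]
      rw [h1, h2, h3, pow_succ]
      omega
    | succ j ih =>
      intro hj
      refine le_trans ?_ (ih (by omega))
      have h1 : d₁ + d₂ - (j + 1) = d₁ + d₂ - (j + 1 + 1) + 1 := by omega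
      have h2 : pieceRank d₁ d₂ (j + 1) = d₁ + d₂ - (j + 1 + 1) - 1 := by
        simp only [pieceRank]
        omega
      have h3 : d₁ + d₂ - (j + 1 + 1) = d₁ + d₂ - (j + 1 + 1) - 1 + 1 := by omega
      have h4 : c (j + 1) ≤ 2 := by simp only [hc]; split_ifs <;> omega
      rw [Finset.sum_range_succ, h2, h1, pow_succ]
      have h5 := Nat.mul_le_mul_right (2 ^ (d₁ + d₂ - (j + 1 + 1) - 1)) h4
      have h6 : 2 ^ (d₁ + d₂ - (j + 1 + 1)) = 2 * 2 ^ (d₁ + d₂ - (j + 1 + 1) - 1) := by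
        conv_lhs => rw [h3, pow_succ, mul_comm]
      omega
  obtain ⟨j, hj⟩ : ∃ j, min d₁ d₂ = j + 1 := ⟨min d₁ d₂ - 1, by omega⟩
  rw [hsum, hj, Finset.sum_range_succ]
  refine le_trans ?_ (hpart j hj.ge)
  gcongr
  rcases lt_or_ge d₂ d₁ with h | h
  · have h1 : c (j + 1) ≤ 2 := by simp only [hc]; split_ifs <;> omega
    have h2 : d₁ + d₂ - (j + 1) = pieceRank d₁ d₂ (j + 1) + 1 := by
      simp only [pieceRank]
      omega
    rw [h2, pow_succ, mul_comm _ 2]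
    exact Nat.mul_le_mul_right _ h1
  · have h1 : c (j + 1) = 1 := by simp [hc]; omega
    rw [h1, one_mul]
    refine Nat.pow_le_pow_right two_pos ?_
    simp only [pieceRank]
    omega

/-- The pairs consisting of the piece without variables of colour `0` and a colour in `{1, 2}`
occurring in it. -/
def topPairs (d₁ d₂ : ℕ) : Finset (ℕ × Fin 3) :=
  ({d₁} ×ˢ {1, 2} : Finset (ℕ × Fin 3)).filter fun p => p.1 ≤ min d₁ d₂ ∧ p.2 ∈ pieceList d₁ d₂ p.1

lemma sum_topPairs_le {d₁ d₂ : ℕ} (hd₁ : 2 ≤ d₁) :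
    ∑ p ∈ topPairs d₁ d₂, 2 ^ pieceRank d₁ d₂ p.1 ≤ 2 * 2 ^ (d₁ + d₂ - 2) := by
  have hcard : (topPairs d₁ d₂).card ≤ 2 := (Finset.card_filter_le _ _).trans (by simp)
  refine (Finset.sum_le_card_nsmul _ _ (2 ^ (d₁ + d₂ - 2)) fun p hp => ?_).trans
    (Nat.mul_le_mul_right _ hcard)
  simp only [topPairs, Finset.mem_filter, Finset.mem_product, Finset.mem_singleton] at hp
  refine Nat.pow_le_pow_right two_pos ?_
  simp only [pieceRank]
  omega

end Exponents

section Decomposition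

variable {ι : Type*} (col : ι → Fin 3)

lemma IsMultiHom.pderiv_eq_zero {R κ : Type*} [CommRing R] [DecidableEq κ] {col : ι → κ}
    {e : κ → ℕ} {P : MvPolynomial ι R} (hP : IsMultiHom col e P) {i : ι} (hi : e (col i) = 0) :
    MvPolynomial.pderiv i P = 0 := by
  refine pderiv_eq_zero_of_notMem_vars fun h => ?_
  obtain ⟨a, ha, hia⟩ := (mem_vars_iff_mem_support i).1 h
  have h1 := hP (col i) (mem_support_iff.1 ha)
  have h2 := Finsupp.le_weight (colWeight col (col i)) (s := i) (by simp [colWeight]) a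
  rw [h1, hi] at h2
  exact Finsupp.mem_support_iff.1 hia (Nat.le_zero.1 h2)

lemma IsMultiHom.mem_span_X {R κ : Type*} [CommRing R] [DecidableEq κ] {col : ι → κ}
    {e : κ → ℕ} {P : MvPolynomial ι R} (hP : IsMultiHom col e P) {μ : κ} (hμ : e μ ≠ 0) :
    P ∈ Ideal.span ((X : ι → MvPolynomial ι R) '' {v | col v = μ}) := by
  rw [mem_ideal_span_X_image]
  intro a ha
  by_contra! h
  refine hμ ((hP μ (mem_support_iff.1 ha)).symm.trans ?_)
  rw [Finsupp.weight_apply]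
  refine Finset.sum_eq_zero fun i _ => ?_
  by_cases hi : col i = μ
  · simp [h i hi]
  · simp [colWeight, hi]

/-- Every monomial of `F` has degree `d₁` in the variables of colours `0`, `1` and degree `d₂` in
those of colours `1`, `2`. -/
def IsBihom (d₁ d₂ : ℕ) (F : MvPolynomial ι ℤ) : Prop :=
  ∀ a ∈ F.support,
    Finsupp.weight (colWeight col 0) a + Finsupp.weight (colWeight col 1) a = d₁ ∧
      Finsupp.weight (colWeight col 1) a + Finsupp.weight (colWeight col 2) a = d₂

variable {col} {d₁ d₂ : ℕ} {F : MvPolynomial ι ℤ}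

lemma IsBihom.isMultiHom (hF : IsBihom col d₁ d₂ F) (b : ℕ) :
    IsMultiHom col ![d₁ - b, b, d₂ - b] (weightedHomogeneousComponent (colWeight col 1) b F) := by
  intro μ a ha
  rw [coeff_weightedHomogeneousComponent] at ha
  obtain ⟨hb, ha⟩ := ite_ne_right_iff.1 ha
  have h := hF a (mem_support_iff.2 ha)
  fin_cases μ
  · simp
    omega
  · exact hb
  · simp
    omega

lemma IsBihom.sum_pieces (hF : IsBihom col d₁ d₂ F) :
    ∑ b ∈ Finset.range (min d₁ d₂ + 1), weightedHomogeneousComponent (colWeight col 1) b F = F := by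
  ext a
  simp only [coeff_sum, coeff_weightedHomogeneousComponent]
  rw [Finset.sum_ite_eq]
  split_ifs with h
  · rfl
  · by_contra ha
    have := hF a (mem_support_iff.2 (Ne.symm ha))
    simp only [Finset.mem_range, not_lt] at h
    omega

lemma IsBihom.map_pderiv (hF : IsBihom col d₁ d₂ F) (i : ι) :
    map (Int.castRingHom ℂ) (pderiv i F) = ∑ b ∈ Finset.range (min d₁ d₂ + 1),
      map (Int.castRingHom ℂ) (pderiv i (weightedHomogeneousComponent (colWeight col 1) b F)) := by
  conv_lhs => rw [← hF.sum_pieces, map_sum, map_sum]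

lemma IsMultiHom.eval_scale {R κ : Type*} [CommRing R] [DecidableEq κ] {col : ι → κ}
    {e : κ → ℕ} {P : MvPolynomial ι R} (hP : IsMultiHom col e P) (μ : κ) (c : R) (v : ι → R) :
    eval (fun i => if col i = μ then c * v i else v i) P = c ^ e μ * eval v P := by
  simp only [eval_eq, Finset.mul_sum]
  refine Finset.sum_congr rfl fun a ha => ?_
  rw [← hP μ (mem_support_iff.1 ha), Finsupp.weight_apply, Finsupp.sum,
    ← Finset.prod_pow_eq_pow_sum,
    mul_left_comm, ← Finset.prod_mul_distrib]
  congr 1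
  refine Finset.prod_congr rfl fun i _ => ?_
  by_cases hi : col i = μ <;> simp [colWeight, hi, mul_pow]

lemma IsBihom.eval_scale (hF : IsBihom col d₁ d₂ F) {R : Type*} [CommRing R] (d : ℕ) (v : ι → R) :
    eval (fun i => if col i = 0 then (d : R) * v i else v i) (map (Int.castRingHom R) F) =
      eval v (∑ b ∈ Finset.range (min d₁ d₂ + 1), ((d ^ (d₁ - b) : ℕ) : R) •
        map (Int.castRingHom R) (weightedHomogeneousComponent (colWeight col 1) b F)) := by
  conv_lhs => rw [← hF.sum_pieces]
  simp only [map_sum]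
  refine Finset.sum_congr rfl fun b _ => ?_
  rw [((hF.isMultiHom b).map _).eval_scale, smul_eval]
  simp

lemma IsBihom.span_low_le (hF : IsBihom col d₁ d₂ F) {Z : Set (MvPolynomial ι ℂ)} :
    Ideal.span {g | ∃ i, (col i = 0 ∨ col i = 1) ∧ g = map (Int.castRingHom ℂ) (pderiv i F)} ≤
      Ideal.span ({g | ∃ p ∈ lowPairs d₁ d₂, ∃ i, col i = p.2 ∧ g = map (Int.castRingHom ℂ)
        (pderiv i (weightedHomogeneousComponent (colWeight col 1) p.1 F))} ∪ Z) := by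
  rw [Ideal.span_le]
  rintro _ ⟨i, hi, rfl⟩
  rw [SetLike.mem_coe, hF.map_pderiv]
  refine Ideal.sum_mem _ fun b hb => ?_
  by_cases h : col i ∈ pieceList d₁ d₂ b
  · refine Ideal.subset_span (Or.inl ⟨(b, col i), ?_, i, rfl, rfl⟩)
    simp only [lowPairs, Finset.mem_filter, Finset.mem_product, Finset.mem_insert,
      Finset.mem_singleton]
    exact ⟨⟨hb, hi⟩, h⟩
  · rw [(hF.isMultiHom b).pderiv_eq_zero, map_zero]
    · exact Ideal.zero_mem _
    · rw [mem_pieceList] at h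
      omega

lemma IsBihom.span_top_le (hF : IsBihom col d₁ d₂ F) {Z : Set (MvPolynomial ι ℂ)}
    (hZ : ∀ v, col v = 0 → X v ∈ Z) :
    Ideal.span {g | ∃ i, (col i = 1 ∨ col i = 2) ∧ g = map (Int.castRingHom ℂ) (pderiv i F)} ≤
      Ideal.span ({g | ∃ p ∈ topPairs d₁ d₂, ∃ i, col i = p.2 ∧ g = map (Int.castRingHom ℂ)
        (pderiv i (weightedHomogeneousComponent (colWeight col 1) p.1 F))} ∪ Z) := by
  rw [Ideal.span_le]
  rintro _ ⟨i, hi, rfl⟩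
  rw [SetLike.mem_coe, hF.map_pderiv]
  refine Ideal.sum_mem _ fun b hb => ?_
  have hb' := Finset.mem_range.1 hb
  by_cases h : col i ∈ pieceList d₁ d₂ b
  · rcases lt_or_ge b d₁ with hlt | hge
    · have h0 : IsMultiHom col (fun μ => ![d₁ - b, b, d₂ - b] μ - colWeight col μ i)
          (pderiv i (weightedHomogeneousComponent (colWeight col 1) b F)) := by
        refine (hF.isMultiHom b).pderiv fun μ => ?_
        rw [mem_pieceList] at h
        by_cases hμ : col i = μ
        · subst hμ
          simp only [colWeight, if_true]
          omega
        · simp [colWeight, hμ]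
      have h1 := (h0.map (Int.castRingHom ℂ)).mem_span_X (μ := 0) (by
        have : col i ≠ 0 := by rcases hi with h | h <;> simp [h]
        simp [colWeight, this]
        omega)
      refine Ideal.span_mono ?_ h1
      rintro _ ⟨v, hv, rfl⟩
      exact Or.inr (hZ v hv)
    · refine Ideal.subset_span (Or.inl ⟨(b, col i), ?_, i, rfl, rfl⟩)
      simp only [topPairs, Finset.mem_filter, Finset.mem_product, Finset.mem_insert,
        Finset.mem_singleton]
      exact ⟨⟨by omega, hi⟩, by omega, h⟩
  · rw [(hF.isMultiHom b).pderiv_eq_zero, map_zero]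
    · exact Ideal.zero_mem _
    · rw [mem_pieceList] at h
      omega

end Decomposition

section PowerSaving

variable {ι : Type*} [Fintype ι] {col : ι → Fin 3} {d₁ d₂ : ℕ} {F : MvPolynomial ι ℤ}

lemma norm_expect_addChar_le_one {R α : Type*} [AddCommGroup R] [Finite R] [Fintype α]
    (ψ : AddChar R ℂ)
    (f : α → R) : ‖𝔼 v, ψ (f v)‖ ≤ 1 := by
  rcases isEmpty_or_nonempty α with h | h
  · simp
  · refine (RCLike.norm_expect_le (K := ℂ)).trans ?_
    simp [Finset.expect_const]

/-- Power saving, with a loss in `d`, in terms of the dimension of the variety on which the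
derivatives in the variables of colours `0` and `1` vanish. -/
theorem IsBihom.exists_norm_expect_le_low (hF : IsBihom col d₁ d₂ F) (hd₁ : 2 ≤ d₁) (hd₂ : 1 ≤ d₂)
    {I : Ideal (MvPolynomial ι ℂ)} (hI : I = Ideal.span
      {g | ∃ i, (col i = 0 ∨ col i = 1) ∧ g = map (Int.castRingHom ℂ) (pderiv i F)}) (D : ℕ)
    (hD : ringKrullDim (MvPolynomial ι ℂ ⧸ I) = ((D : ℕ∞) : WithBot ℕ∞)) (s : ℝ) (hs : 0 ≤ s)
    (hsD : s * ((d₁ + d₂ - 1 : ℕ) * (3 * 2 ^ (d₁ + d₂ - 2) : ℕ)) ≤ (Fintype.card ι : ℝ) - D) :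
    ∃ A : ℝ, 0 ≤ A ∧ ∀ (q d : ℕ) [NeZero q] (ψ : AddChar (ZMod q) ℂ), ψ.IsPrimitive → 1 ≤ d →
      ‖𝔼 v : ι → ZMod q, ψ (eval (fun i => if col i = 0 then (d : ZMod q) * v i else v i)
        (map (Int.castRingHom (ZMod q)) F))‖ ≤ A * ((d : ℝ) ^ d₁ / q) ^ s := by
  have hS : ∀ p ∈ lowPairs d₁ d₂, p.1 ≤ min d₁ d₂ ∧ p.2 ∈ pieceList d₁ d₂ p.1 := fun p hp => by
    simp only [lowPairs, Finset.mem_filter, Finset.mem_product, Finset.mem_range] at hp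
    exact ⟨Nat.lt_succ_iff.1 hp.1.1, hp.2⟩
  obtain ⟨C, K, hC, h⟩ := exists_norm_expect_pow_le col (by omega) hd₂ _
    (fun b _ => hF.isMultiHom b) (lowPairs d₁ d₂) hS ∅ I
    (hI.le.trans hF.span_low_le) D hD d₁ (fun p _ => Nat.sub_le _ _)
  rw [Finset.sdiff_empty, Finset.card_univ] at h
  obtain ⟨A, hA, hA'⟩ := exists_le_mul_rpow _ _ C K (d₁ + d₂ - 1) (Fintype.card ι) D s
    (sum_lowPairs_le (by omega) hd₂) (Nat.mul_pos (by norm_num) (by positivity)) hC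
    (by omega) hs hsD
  refine ⟨A, hA, fun q d _ ψ hψ hd => ?_⟩
  simp only [hF.eval_scale]
  have := hA' _ (d ^ d₁) q (norm_nonneg _) (norm_expect_addChar_le_one ψ _)
    (Nat.one_le_pow _ _ hd) (NeZero.one_le) fun B hB hq => h q d B ψ hψ hd hB hq
  rwa [Nat.cast_pow] at this

/-- Power saving, uniform in `d`, in terms of the dimension of the variety on which the
derivatives in the variables of colours `1` and `2` vanish. -/
theorem IsBihom.exists_norm_expect_le_top (hF : IsBihom col d₁ d₂ F) (hd₁ : 2 ≤ d₁) (hd₂ : 1 ≤ d₂)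
    {I : Ideal (MvPolynomial ι ℂ)} (hI : I = Ideal.span
      {g | ∃ i, (col i = 1 ∨ col i = 2) ∧ g = map (Int.castRingHom ℂ) (pderiv i F)}) (D : ℕ)
    (hD : ringKrullDim (MvPolynomial ι ℂ ⧸ I) = ((D : ℕ∞) : WithBot ℕ∞)) (s : ℝ) (hs : 0 ≤ s)
    (hsD : s * ((d₁ + d₂ - 1 : ℕ) * (2 * 2 ^ (d₁ + d₂ - 2) : ℕ)) ≤
      ((Finset.univ.filter fun i => col i ≠ 0).card : ℝ) - D) :
    ∃ A : ℝ, 0 ≤ A ∧ ∀ (q d : ℕ) [NeZero q] (ψ : AddChar (ZMod q) ℂ), ψ.IsPrimitive → 1 ≤ d →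
      ‖𝔼 v : ι → ZMod q, ψ (eval (fun i => if col i = 0 then (d : ZMod q) * v i else v i)
        (map (Int.castRingHom (ZMod q)) F))‖ ≤ A * (1 / (q : ℝ)) ^ s := by
  have hZ : ∀ v, col v = 0 → (X v : MvPolynomial ι ℂ) ∈
      {g | ∃ v ∈ Finset.univ.filter fun i => col i = 0, g = X v} :=
    fun v hv => ⟨v, by simpa using hv, rfl⟩
  have hS : ∀ p ∈ topPairs d₁ d₂,
      p.1 = d₁ ∧ p.1 ≤ min d₁ d₂ ∧ p.2 ∈ pieceList d₁ d₂ p.1 := fun p hp => by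
    simp only [topPairs, Finset.mem_filter, Finset.mem_product, Finset.mem_singleton] at hp
    exact ⟨hp.1.1, hp.2⟩
  obtain ⟨C, K, hC, h⟩ := exists_norm_expect_pow_le col (by omega) hd₂ _
    (fun b _ => hF.isMultiHom b) (topPairs d₁ d₂) (fun p hp => (hS p hp).2)
    (Finset.univ.filter fun i => col i = 0) I (hI.le.trans (hF.span_top_le hZ)) D hD 0
    (fun p hp => by rw [(hS p hp).1, Nat.sub_self])
  rw [← Finset.compl_eq_univ_sdiff, Finset.compl_filter] at h
  obtain ⟨A, hA, hA'⟩ := exists_le_mul_rpow _ _ C K (d₁ + d₂ - 1) _ D s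
    (sum_topPairs_le hd₁) (Nat.mul_pos (by norm_num) (by positivity)) hC
    (by omega) hs hsD
  refine ⟨A, hA, fun q d _ ψ hψ hd => ?_⟩
  simp only [hF.eval_scale]
  have := hA' _ (d ^ 0) q (norm_nonneg _) (norm_expect_addChar_le_one ψ _)
    (Nat.one_le_pow _ _ hd) (NeZero.one_le) fun B hB hq => h q d B ψ hψ hd hB hq
  rwa [pow_zero, Nat.cast_one] at this

end PowerSaving

section Tail

lemma norm_tsum_sub_sum_Icc_le {f : ℕ → ℂ} {c δ : ℝ} (hδ : 0 < δ) (h0 : f 0 = 0) (hc : 0 ≤ c)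
    (hf : ∀ q : ℕ, 1 ≤ q → ‖f q‖ ≤ c * (q : ℝ) ^ (-(1 + 2 * δ))) :
    Summable (fun q => ‖f q‖) ∧ ∀ Q : ℕ, 1 ≤ Q → ‖∑' q, f q - ∑ q ∈ Finset.Icc 1 Q, f q‖ ≤
      c * (∑' q : ℕ, (q : ℝ) ^ (-(1 + δ))) * (Q : ℝ) ^ (-δ) := by
  have hsum : Summable fun q => ‖f q‖ := by
    refine Summable.of_nonneg_of_le (fun q => norm_nonneg _) (fun q => ?_)
      ((Real.summable_nat_rpow (p := -(1 + 2 * δ))).2 (by linarith) |>.mul_left c)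
    rcases Nat.eq_zero_or_pos q with rfl | hq
    · rw [h0, norm_zero]
      positivity
    · exact hf q hq
  refine ⟨hsum, fun Q hQ => ?_⟩
  have hT : Summable fun q : ℕ => (q : ℝ) ^ (-(1 + δ)) := Real.summable_nat_rpow.2 (by linarith)
  have hQ' : (0 : ℝ) < Q := by exact_mod_cast hQ
  have hIcc : ∑ q ∈ Finset.Icc 1 Q, f q = ∑ q ∈ Finset.range (Q + 1), f q := by
    rw [Finset.range_eq_Ico, Finset.sum_eq_sum_Ico_succ_bot (Nat.succ_pos Q), h0, zero_add]
    rfl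
  rw [hIcc, ← (Summable.of_norm hsum).sum_add_tsum_nat_add (Q + 1), add_sub_cancel_left]
  have htail : ∑' i : ℕ, ((i + (Q + 1) : ℕ) : ℝ) ^ (-(1 + δ)) ≤ ∑' q : ℕ, (q : ℝ) ^ (-(1 + δ)) := by
    rw [← hT.sum_add_tsum_nat_add (Q + 1)]
    exact le_add_of_nonneg_left (Finset.sum_nonneg fun q _ => by positivity)
  have hT' := ((summable_nat_add_iff (Q + 1)).2 hT).hasSum.mul_left (c * (Q : ℝ) ^ (-δ))
  refine (tsum_of_norm_bounded hT' fun i => ?_).trans ?_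
  · refine (hf _ (by omega)).trans ?_
    have hi : (0 : ℝ) < (i + (Q + 1) : ℕ) := by positivity
    have hexp : (-(1 + 2 * δ)) = -δ + -(1 + δ) := by ring
    rw [hexp, Real.rpow_add hi, ← mul_assoc]
    have hle : ((i + (Q + 1) : ℕ) : ℝ) ^ (-δ) ≤ (Q : ℝ) ^ (-δ) :=
      Real.rpow_le_rpow_of_nonpos hQ' (by exact_mod_cast (by omega)) (by linarith)
    gcongr
  · rw [mul_right_comm]
    gcongr

end Tail

section WeightedHomogeneous

lemma isWeightedHomogeneous_of_eval₂ {ι : Type*} {w : ι → ℕ} {P : MvPolynomial ι ℤ} {e : ℕ}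
    (h : eval₂ (Int.castRingHom (Polynomial (MvPolynomial ι ℤ)))
      (fun i => Polynomial.X ^ w i * Polynomial.C (X i)) P = Polynomial.X ^ e * Polynomial.C P) :
    IsWeightedHomogeneous w P e := by
  have hexp : eval₂ (Int.castRingHom (Polynomial (MvPolynomial ι ℤ)))
      (fun i => Polynomial.X ^ w i * Polynomial.C (X i)) P =
      ∑ a ∈ P.support,
        Polynomial.X ^ Finsupp.weight w a * Polynomial.C (monomial a (coeff a P)) := by
    rw [eval₂_eq]
    refine Finset.sum_congr rfl fun a _ => ?_
    simp only [mul_pow, Finset.prod_mul_distrib, ← pow_mul, Finset.prod_pow_eq_pow_sum,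
      monomial_eq, Finsupp.weight_apply, Finsupp.sum, Finsupp.prod, map_mul, map_prod, map_pow]
    rw [mul_left_comm]
    congr 2
    exact Finset.sum_congr rfl fun i _ => mul_comm _ _
  rw [hexp] at h
  intro a ha
  have h2 := congrArg (fun p => coeff a (Polynomial.coeff p (Finsupp.weight w a))) h
  simp only [Polynomial.finsetSum_coeff, Polynomial.coeff_X_pow_mul', Polynomial.coeff_C,
    coeff_sum] at h2
  rw [Finset.sum_eq_single a] at h2
  · by_contra hne
    rw [if_pos le_rfl, Nat.sub_self, if_pos rfl, coeff_monomial, if_pos rfl] at h2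
    split_ifs at h2
    · omega
    · exact ha (by simpa using h2)
    · exact ha (by simpa using h2)
  · intro b _ hba
    split_ifs <;> simp [coeff_monomial, hba]
  · intro h3
    simp [notMem_support_iff.1 h3]

end WeightedHomogeneous

section Link

variable {n m r : ℕ}

/-- The colours of the variables: `0` for `𝐱`, `1` for `𝐲` and `2` for `𝐳`. -/
def colour : Idx n m r → Fin 3 := Sum.elim (fun _ => 0) (Sum.elim (fun _ => 1) fun _ => 2)

variable {F : MvPolynomial (Idx n m r) ℤ} {d₁ d₂ : ℕ}

lemma Bihomogeneous.isBihom (hF : Bihomogeneous F d₁ d₂) : IsBihom colour d₁ d₂ F := by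
  have hadd : ∀ (μ ν : Fin 3) (a : Idx n m r →₀ ℕ),
      Finsupp.weight (colWeight colour μ) a + Finsupp.weight (colWeight colour ν) a =
        Finsupp.weight (fun i => colWeight colour μ i + colWeight colour ν i) a := fun μ ν a => by
    simp only [Finsupp.weight_apply, Finsupp.sum, smul_add, Finset.sum_add_distrib]
  have hX : eval₂ (Int.castRingHom (Polynomial (MvPolynomial (Idx n m r) ℤ)))
      (fun i => Polynomial.C (X i)) F = Polynomial.C F := by
    have h := eval₂_comp_left (Polynomial.C : MvPolynomial (Idx n m r) ℤ →+* _) C X F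
    rw [eval₂_eta] at h
    rw [h]
    exact congrArg (fun f => eval₂ f _ F) (RingHom.ext_int _ _)
  have hXsum : Sum.elim (fun i => (Polynomial.C (X (Sum.inl i)) :
      Polynomial (MvPolynomial (Idx n m r) ℤ)))
      (Sum.elim (fun j => Polynomial.C (X (Sum.inr (Sum.inl j))))
        fun k => Polynomial.C (X (Sum.inr (Sum.inr k)))) = fun i => Polynomial.C (X i) := by
    ext1 i
    rcases i with i | i | i <;> rfl
  have h1 := hF (Polynomial (MvPolynomial (Idx n m r) ℤ)) Polynomial.X 1
    (fun i => Polynomial.C (X (Sum.inl i))) (fun j => Polynomial.C (X (Sum.inr (Sum.inl j))))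
    fun k => Polynomial.C (X (Sum.inr (Sum.inr k)))
  have h2 := hF (Polynomial (MvPolynomial (Idx n m r) ℤ)) 1 Polynomial.X
    (fun i => Polynomial.C (X (Sum.inl i))) (fun j => Polynomial.C (X (Sum.inr (Sum.inl j))))
    fun k => Polynomial.C (X (Sum.inr (Sum.inr k)))
  simp only [evalF, one_pow, one_mul, mul_one, aeval_def, algebraMap_int_eq] at h1 h2
  rw [hXsum, hX] at h1 h2
  intro a ha
  rw [hadd, hadd]
  constructor
  · refine isWeightedHomogeneous_of_eval₂ ?_ (mem_support_iff.1 ha)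
    rw [← h1]
    congr 2
    ext1 i
    rcases i with i | i | i <;> simp [colour, colWeight]
  · refine isWeightedHomogeneous_of_eval₂ ?_ (mem_support_iff.1 ha)
    rw [← h2]
    congr 2
    ext1 i
    rcases i with i | i | i <;> simp [colour, colWeight]

lemma idealV1_eq : idealV1 F = Ideal.span {g | ∃ i, (colour i = 0 ∨ colour i = 1) ∧
    g = map (Int.castRingHom ℂ) (pderiv i F)} := by
  refine congrArg Ideal.span (Set.ext fun g => ?_)
  constructor
  · rintro (⟨i, rfl⟩ | ⟨i, rfl⟩)
    · exact ⟨Sum.inl i, Or.inl rfl, rfl⟩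
    · exact ⟨Sum.inr (Sum.inl i), Or.inr rfl, rfl⟩
  · rintro ⟨i | i | i, hi, rfl⟩
    · exact Or.inl ⟨i, rfl⟩
    · exact Or.inr ⟨i, rfl⟩
    · simp [colour] at hi

lemma idealV2_eq : idealV2 F = Ideal.span {g | ∃ i, (colour i = 1 ∨ colour i = 2) ∧
    g = map (Int.castRingHom ℂ) (pderiv i F)} := by
  refine congrArg Ideal.span (Set.ext fun g => ?_)
  constructor
  · rintro (⟨i, rfl⟩ | ⟨i, rfl⟩)
    · exact ⟨Sum.inr (Sum.inl i), Or.inl rfl, rfl⟩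
    · exact ⟨Sum.inr (Sum.inr i), Or.inr rfl, rfl⟩
  · rintro ⟨i | i | i, hi, rfl⟩
    · simp [colour] at hi
    · exact Or.inl ⟨i, rfl⟩
    · exact Or.inr ⟨i, rfl⟩

lemma card_Idx (hrm : r ≤ m) (hmn : m ≤ n) : Fintype.card (Idx n m r) = n + 2 := by
  simp only [Fintype.card_sum, Fintype.card_fin]
  omega

lemma card_colour_ne_zero :
    (Finset.univ.filter fun i : Idx n m r => colour i ≠ 0).card + (r + 1) =
      Fintype.card (Idx n m r) := by
  have h : (Finset.univ.filter fun i : Idx n m r => colour i = 0) =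
      Finset.univ.map Function.Embedding.inl := by
    ext i
    rw [Finset.mem_filter]
    rcases i with i | i | i <;> simp [colour]
  have h2 := Finset.card_filter_add_card_filter_not (s := (Finset.univ : Finset (Idx n m r)))
    fun i => colour i = 0
  rw [h, Finset.card_map, Finset.card_univ, Fintype.card_fin, Finset.card_univ] at h2
  rw [← h2, add_comm]

lemma eexp_eq_stdAddChar (a q : ℕ) [NeZero q] (x : ZMod q) :
    eexp ((a : ℝ) / (q : ℝ) * (x.val : ℝ)) = (ZMod.stdAddChar (N := q)).mulShift a x := by
  have h : (a : ZMod q) * x = ((a * x.val : ℤ) : ZMod q) := by simp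
  rw [AddChar.mulShift_apply, h, ZMod.stdAddChar_coe, eexp]
  congr 1
  push_cast
  ring

lemma Saqd_eq (F : MvPolynomial (Idx n m r) ℤ) (d a q : ℕ) [NeZero q] :
    Saqd F d a q = (q : ℂ) ^ Fintype.card (Idx n m r) *
      𝔼 v : Idx n m r → ZMod q, (ZMod.stdAddChar (N := q)).mulShift a
        (eval (fun i => if colour i = 0 then (d : ZMod q) * v i else v i)
          (map (Int.castRingHom (ZMod q)) F)) := by
  rw [Fintype.expect_eq_sum_div_card, Saqd, tsum_fintype, Fintype.card_fun, ZMod.card, Nat.cast_pow,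
    mul_div_cancel₀ _ (pow_ne_zero _ (Nat.cast_ne_zero.2 (NeZero.ne q)))]
  let e : (Fin (r + 1) → ZMod q) × (Fin (m - r) → ZMod q) × (Fin (n - m + 1) → ZMod q) ≃
      (Idx n m r → ZMod q) :=
    ((Equiv.refl _).prodCongr (Equiv.sumArrowEquivProdArrow _ _ _).symm).trans
      (Equiv.sumArrowEquivProdArrow _ _ _).symm
  refine Fintype.sum_equiv e _ _ fun b => ?_
  rw [eexp_eq_stdAddChar, evalF, aeval_def, eval₂_eq_eval_map]
  refine congrArg (fun v => (ZMod.stdAddChar (N := q)).mulShift a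
    (eval v (map (Int.castRingHom (ZMod q)) F))) (funext fun i => ?_)
  rcases i with i | i | i <;> rfl

lemma isPrimitive_mulShift_stdAddChar {a q : ℕ} [NeZero q] (h : Nat.gcd a q = 1) :
    ((ZMod.stdAddChar (N := q)).mulShift a).IsPrimitive := by
  intro b hb
  rw [AddChar.mulShift_mulShift]
  refine ZMod.isPrimitive_stdAddChar q ?_
  rwa [Ne, ((ZMod.isUnit_iff_coprime a q).2 h).mul_right_eq_zero]

lemma norm_Aq_le (hrm : r ≤ m) (hmn : m ≤ n) (d q : ℕ) [NeZero q] (c : ℝ)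
    (h : ∀ ψ : AddChar (ZMod q) ℂ, ψ.IsPrimitive → ‖𝔼 v : Idx n m r → ZMod q,
      ψ (eval (fun i => if colour i = 0 then (d : ZMod q) * v i else v i)
        (map (Int.castRingHom (ZMod q)) F))‖ ≤ c) : ‖Aq F d q‖ ≤ q * c := by
  have hq : (q : ℝ) ≠ 0 := Nat.cast_ne_zero.2 (NeZero.ne q)
  have hc : 0 ≤ c := (norm_nonneg _).trans (h _ (ZMod.isPrimitive_stdAddChar q))
  have hS : ∀ a ∈ (Finset.range q).filter fun a => Nat.gcd a q = 1,
      ‖Saqd F d a q‖ ≤ (q : ℝ) ^ (n + 2) * c := fun a ha => by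
    rw [Saqd_eq, norm_mul, norm_pow, Complex.norm_natCast, card_Idx hrm hmn]
    exact mul_le_mul_of_nonneg_left
      (h _ (isPrimitive_mulShift_stdAddChar (Finset.mem_filter.1 ha).2)) (by positivity)
  rw [Aq, norm_mul, norm_zpow, Complex.norm_natCast]
  calc (q : ℝ) ^ (-((n : ℤ) + 2)) * ‖_‖
      ≤ (q : ℝ) ^ (-((n : ℤ) + 2)) * (q * ((q : ℝ) ^ (n + 2) * c)) := by
        refine mul_le_mul_of_nonneg_left ((norm_sum_le_of_le _ hS).trans ?_) (by positivity)
        rw [Finset.sum_const, nsmul_eq_mul]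
        gcongr
        exact (Finset.card_filter_le _ _).trans (Finset.card_range q).le
    _ = q * c := by
      have : (q : ℝ) ^ (-((n : ℤ) + 2)) = ((q : ℝ) ^ (n + 2))⁻¹ := by
        rw [zpow_neg]
        norm_cast
      rw [this]
      field_simp

end Link

lemma norm_Aq_le_of_expect_le {n m r : ℕ} {F : MvPolynomial (Idx n m r) ℤ} (hrm : r ≤ m)
    (hmn : m ≤ n) (d q : ℕ) (hq : 1 ≤ q) {A E s : ℝ} (hE : 0 ≤ E)
    (h : ∀ [NeZero q] (ψ : AddChar (ZMod q) ℂ), ψ.IsPrimitive → ‖𝔼 v : Idx n m r → ZMod q,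
      ψ (eval (fun i => if colour i = 0 then (d : ZMod q) * v i else v i)
        (map (Int.castRingHom (ZMod q)) F))‖ ≤ A * (E / q) ^ (2 + 2 * s)) :
    ‖Aq F d q‖ ≤ A * E ^ (2 + 2 * s) * (q : ℝ) ^ (-(1 + 2 * s)) := by
  have : NeZero q := ⟨by omega⟩
  have hq0 : (0 : ℝ) < q := by exact_mod_cast hq
  refine (norm_Aq_le hrm hmn d q _ h).trans_eq ?_
  have hexp : (-(1 + 2 * s)) = 1 - (2 + 2 * s) := by ring
  rw [hexp, Real.rpow_sub hq0, Real.rpow_one, Real.div_rpow hE hq0.le]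
  ring

section

variable {n m r d₁ d₂ : ℕ} {F : MvPolynomial (Idx n m r) ℤ}

lemma Bihomogeneous.exists_norm_Aq_le_low (hF : Bihomogeneous F d₁ d₂) (hrm : r ≤ m) (hmn : m ≤ n)
    (hd₁ : 2 ≤ d₁) (hd₂ : 1 ≤ d₂) (D : ℕ) (hD : dimV1 F = ((D : ℕ∞) : WithBot ℕ∞))
    (s : ℝ) (hs : 0 ≤ s) (hsD : (2 + 2 * s) * (3 * (((d₁ : ℝ) + d₂ - 1) * 2 ^ (d₁ + d₂ - 2))) ≤
      (n : ℝ) + 2 - D) :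
    ∃ A : ℝ, 0 ≤ A ∧ ∀ d q : ℕ, 1 ≤ d → 1 ≤ q →
      ‖Aq F d q‖ ≤ A * ((d : ℝ) ^ d₁) ^ (2 + 2 * s) * (q : ℝ) ^ (-(1 + 2 * s)) := by
  have hcard : (Fintype.card (Idx n m r) : ℝ) = (n : ℝ) + 2 := by
    rw [card_Idx hrm hmn]
    push_cast
    ring
  obtain ⟨A, hA, h⟩ := hF.isBihom.exists_norm_expect_le_low hd₁ hd₂ idealV1_eq D hD (2 + 2 * s)
    (by linarith) (by
      rw [hcard, Nat.cast_sub (by omega)]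
      push_cast
      linarith)
  refine ⟨A, hA, fun d q hd hq => norm_Aq_le_of_expect_le hrm hmn d q hq (by positivity) ?_⟩
  intro _ ψ hψ
  convert h q d ψ hψ hd

lemma Bihomogeneous.exists_norm_Aq_le_top (hF : Bihomogeneous F d₁ d₂) (hrm : r ≤ m) (hmn : m ≤ n)
    (hd₁ : 2 ≤ d₁) (hd₂ : 1 ≤ d₂) (D : ℕ) (hD : dimV2 F = ((D : ℕ∞) : WithBot ℕ∞))
    (s : ℝ) (hs : 0 ≤ s) (hsD : (2 + 2 * s) * (2 * (((d₁ : ℝ) + d₂ - 1) * 2 ^ (d₁ + d₂ - 2))) ≤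
      (n : ℝ) + 2 - D - (r + 1)) :
    ∃ A : ℝ, 0 ≤ A ∧ ∀ d q : ℕ, 1 ≤ d → 1 ≤ q →
      ‖Aq F d q‖ ≤ A * (q : ℝ) ^ (-(1 + 2 * s)) := by
  have hcard : (Fintype.card (Idx n m r) : ℝ) = (n : ℝ) + 2 := by
    rw [card_Idx hrm hmn]
    push_cast
    ring
  have hc : ((Finset.univ.filter fun i : Idx n m r => colour i ≠ 0).card : ℝ) + (r + 1) =
      (n : ℝ) + 2 := by
    rw [← hcard, ← card_colour_ne_zero]
    push_cast
    congr!
  obtain ⟨A, hA, h⟩ := hF.isBihom.exists_norm_expect_le_top hd₁ hd₂ idealV2_eq D hD (2 + 2 * s)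
    (by linarith) (by
      rw [Nat.cast_sub (by omega)]
      push_cast
      refine (Eq.trans_le ?_ hsD).trans ?_
      · ring
      · rw [← hc]
        apply le_of_eq
        ring_nf)
  refine ⟨A, hA, fun d q hd hq => ?_⟩
  have := norm_Aq_le_of_expect_le hrm hmn d q hq (A := A) (s := s) zero_le_one
    (by intro _ ψ hψ; convert h q d ψ hψ hd)
  rwa [Real.one_rpow, mul_one] at this

end

/-!
Statement 7: assume `d₁ ≥ 2` and `K := (n + 2 - max(dim V₁*, dim V₂*)) / 2^{d₁+d₂-2}
> 7(d₁+d₂-1)`.  Then for every `d ≥ 1` the singular series `𝔖_d` is absolutely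
convergent, and for every sufficiently small `δ > 0` and every `ε > 0` there is a
constant (uniform in `d`) such that for all `Q ≥ d` sufficiently large:
`|𝔖_d - 𝔖_d(Q)| ≪ max(d^{d₁(r+1)/2^{d₁+d₂-2}+ε}, d) Q^{-δ}`.
-/
theorem statement7
    (n m r d₁ d₂ : ℕ) (hr1 : 1 ≤ r) (hrm : r ≤ m) (hmn : m ≤ n)
    (hd₁ : 2 ≤ d₁) (hd₂ : 1 ≤ d₂) (hdm : d₁ < m + 1) (hdn : d₂ < n - r + 1)
    (F : MvPolynomial (Idx n m r) ℤ) (hF : Bihomogeneous F d₁ d₂)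
    (D₁ D₂ : ℕ) (hD₁ : dimV1 F = ((D₁ : ℕ∞) : WithBot ℕ∞))
    (hD₂ : dimV2 F = ((D₂ : ℕ∞) : WithBot ℕ∞))
    (hK : 7 * ((d₁ : ℝ) + d₂ - 1) <
      ((n : ℝ) + 2 - (max D₁ D₂ : ℕ)) / 2 ^ (d₁ + d₂ - 2)) :
    (∀ d : ℕ, 1 ≤ d → Summable fun q : ℕ => ‖Aq F d q‖) ∧
      ∃ δ₀ : ℝ, 0 < δ₀ ∧ ∀ δ : ℝ, 0 < δ → δ < δ₀ → ∀ ε : ℝ, 0 < ε →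
        ∃ Cc : ℝ, 0 < Cc ∧ ∃ Q₀ : ℕ, ∀ d : ℕ, 1 ≤ d → ∀ Q : ℕ, d ≤ Q → Q₀ ≤ Q →
          ‖singSeries F d - singSeriesPartial F d Q‖ ≤
            Cc * max ((d : ℝ) ^ ((d₁ : ℝ) * (r + 1) / 2 ^ (d₁ + d₂ - 2) + ε)) (d : ℝ) *
              (Q : ℝ) ^ (-δ) := by
  set κ : ℝ := 2 ^ (d₁ + d₂ - 2) with hκ
  have hκ0 : 0 < κ := by positivity
  have hk1 : (2 : ℝ) ≤ (d₁ : ℝ) + d₂ - 1 := by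
    have h1 : (2 : ℝ) ≤ d₁ := by exact_mod_cast hd₁
    have h2 : (1 : ℝ) ≤ d₂ := by exact_mod_cast hd₂
    linarith
  rw [lt_div_iff₀ hκ0] at hK
  have hm₁ : (D₁ : ℝ) ≤ (max D₁ D₂ : ℕ) := by exact_mod_cast le_max_left _ _
  have hm₂ : (D₂ : ℝ) ≤ (max D₁ D₂ : ℕ) := by exact_mod_cast le_max_right _ _
  have hkκ : 2 * κ ≤ ((d₁ : ℝ) + d₂ - 1) * κ := mul_le_mul_of_nonneg_right hk1 hκ0.le
  have hAq0 : ∀ d, Aq F d 0 = 0 := fun d => by simp [Aq]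
  have hlow : ∀ δ : ℝ, 0 < δ → δ ≤ 1 / 6 → ∃ A : ℝ, 0 ≤ A ∧ ∀ d q : ℕ, 1 ≤ d → 1 ≤ q →
      ‖Aq F d q‖ ≤ A * ((d : ℝ) ^ d₁) ^ (2 + 2 * δ) * (q : ℝ) ^ (-(1 + 2 * δ)) := by
    intro δ hδ hδ'
    refine hF.exists_norm_Aq_le_low hrm hmn hd₁ hd₂ D₁ hD₁ δ hδ.le ?_
    rw [← hκ]
    have := mul_le_mul_of_nonneg_right hδ' (show 0 ≤ ((d₁ : ℝ) + d₂ - 1) * κ by linarith)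
    linarith
  have htop : (r : ℝ) + 1 ≤ 2 * κ → ∀ δ : ℝ, 0 < δ → δ ≤ 1 / 6 → ∃ A : ℝ, 0 ≤ A ∧
      ∀ d q : ℕ, 1 ≤ d → 1 ≤ q → ‖Aq F d q‖ ≤ A * (q : ℝ) ^ (-(1 + 2 * δ)) := by
    intro hr δ hδ hδ'
    refine hF.exists_norm_Aq_le_top hrm hmn hd₁ hd₂ D₂ hD₂ δ hδ.le ?_
    rw [← hκ]
    have := mul_le_mul_of_nonneg_right hδ' (show 0 ≤ ((d₁ : ℝ) + d₂ - 1) * κ by linarith)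
    linarith
  refine ⟨fun d hd => ?_, min (1 / 6) (1 / (2 * κ)), by positivity, fun δ hδ hδ' ε hε => ?_⟩
  · obtain ⟨A, hA, h⟩ := hlow (1 / 6) (by norm_num) le_rfl
    exact (norm_tsum_sub_sum_Icc_le (by norm_num) (hAq0 d) (by positivity)
      fun q hq => h d q hd hq).1
  have hδ₁ : δ ≤ 1 / 6 := hδ'.le.trans (min_le_left _ _)
  have hδ₂ : 2 * δ ≤ 1 / κ := by
    have h1 := hδ'.le.trans (min_le_right _ _)
    calc 2 * δ ≤ 2 * (1 / (2 * κ)) := by linarith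
      _ = 1 / κ := by field_simp
  set T : ℝ := ∑' q : ℕ, (q : ℝ) ^ (-(1 + δ)) with hT
  have hT0 : 0 ≤ T := tsum_nonneg fun q => by positivity
  rcases le_or_gt ((r : ℝ) + 1) (2 * κ) with hr | hr
  · obtain ⟨A, hA, h⟩ := htop hr δ hδ hδ₁
    refine ⟨A * T + 1, by positivity, 1, fun d hd Q hdQ hQ => ?_⟩
    refine ((norm_tsum_sub_sum_Icc_le hδ (hAq0 d) hA fun q hq => h d q hd hq).2 Q hQ).trans ?_
    refine mul_le_mul_of_nonneg_right ?_ (by positivity)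
    have hd' : (1 : ℝ) ≤ d := by exact_mod_cast hd
    calc A * T ≤ (A * T + 1) * 1 := by linarith
      _ ≤ _ := by
        gcongr
        exact hd'.trans (le_max_right _ _)
  · obtain ⟨A, hA, h⟩ := hlow δ hδ hδ₁
    refine ⟨A * T + 1, by positivity, 1, fun d hd Q hdQ hQ => ?_⟩
    refine ((norm_tsum_sub_sum_Icc_le hδ (hAq0 d) (by positivity) fun q hq => h d q hd hq).2
      Q hQ).trans ?_
    refine mul_le_mul_of_nonneg_right ?_ (by positivity)
    have hd' : (1 : ℝ) ≤ d := by exact_mod_cast hd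
    have hr' : 2 + 1 / κ ≤ ((r : ℝ) + 1) / κ := by
      have h1 : 2 * 2 ^ (d₁ + d₂ - 2) + 1 ≤ r + 1 := by
        rw [hκ] at hr
        exact_mod_cast hr
      have h2 : 2 * κ + 1 ≤ (r : ℝ) + 1 := by
        rw [hκ]
        exact_mod_cast h1
      rw [le_div_iff₀ hκ0, add_mul, one_div, inv_mul_cancel₀ hκ0.ne']
      exact h2
    have hpow : ((d : ℝ) ^ d₁) ^ (2 + 2 * δ) ≤ (d : ℝ) ^ ((d₁ : ℝ) * (r + 1) / κ + ε) := by
      rw [← Real.rpow_natCast, ← Real.rpow_mul (by linarith)]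
      refine Real.rpow_le_rpow_of_exponent_le hd' ?_
      rw [mul_div_assoc]
      have : (d₁ : ℝ) * (2 + 2 * δ) ≤ d₁ * ((r + 1) / κ) := by
        gcongr
        linarith
      linarith
    calc A * ((d : ℝ) ^ d₁) ^ (2 + 2 * δ) * T = A * T * ((d : ℝ) ^ d₁) ^ (2 + 2 * δ) := by ring
      _ ≤ (A * T + 1) * max ((d : ℝ) ^ ((d₁ : ℝ) * (r + 1) / κ + ε)) d := by
        gcongr
        · linarith
        · exact hpow.trans (le_max_left _ _)

end PaperTM
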